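/- Let Γ be a finite simple graph and A(Γ) the associated right-angled Artin group. Let G be a group containing a finite-index subgroup H such that H is isomorphic to a virtual retract of A(Γ) (that is, G belongs to the class AVR). Then the outer automorphism group Out(G) is residually finite. -/

import Mathlib

/-- A group `K` is residually finite if every nontrivial element survives in some
finite quotient. -/
def ResiduallyFinite (K : Type*) [Group K] : Prop :=
  ∀ k : K, k ≠ 1 → ∃ (F : Type) (_ : Group F) (_ : Finite F) (f : K →* F), f k ≠ 1

/-- The inner automorphisms form a normal subgroup of `MulAut G`. -/
instance conjRangeNormal (G : Type*) [Group G] :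
    ((MulAut.conj : G →* MulAut G).range).Normal := by
  constructor
  intro x hx α
  obtain ⟨g, rfl⟩ := hx
  refine ⟨α g, ?_⟩
  ext h
  simp [MulAut.conj_apply, MulAut.mul_apply]

/-- The outer automorphism group of `G`: the quotient of `MulAut G` by the
inner automorphisms. -/
abbrev OuterAut (G : Type*) [Group G] :=
  MulAut G ⧸ (MulAut.conj : G →* MulAut G).range

/-- The set of defining relators of the right-angled Artin group on `Γ`. -/
abbrev raagRels {V : Type*} (Γ : SimpleGraph V) : Set (FreeGroup V) :=
  {r | ∃ u v : V, Γ.Adj u v ∧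
    r = FreeGroup.of u * FreeGroup.of v * (FreeGroup.of u)⁻¹ * (FreeGroup.of v)⁻¹}

/-- The right-angled Artin group associated to a simple graph `Γ`. -/
abbrev RAAG {V : Type*} (Γ : SimpleGraph V) := PresentedGroup (raagRels Γ)

/-- A subgroup `H ≤ G` is a virtual retract of `G` if there is a finite-index subgroup
`K` of `G` with `H ≤ K` and a retraction `K →* H` restricting to the identity on `H`. -/
def IsVirtualRetract {G : Type*} [Group G] (H : Subgroup G) : Prop :=
  ∃ (K : Subgroup G) (hK : H ≤ K), K.index ≠ 0 ∧
    ∃ r : K →* H, ∀ h : H, r ⟨(h : G), hK h.2⟩ = h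

section CrossedMaps

/-- Two crossed maps out of a presented group which agree on the generators are equal. -/
theorem PresentedGroup.crossed_ext {V M : Type*} [Group M] {rels : Set (FreeGroup V)}
    {α : PresentedGroup rels → M → M} (hα : ∀ m, α 1 m = m)
    {F F' : PresentedGroup rels → M} (hF : ∀ a b, F (a * b) = F a * α a (F b))
    (hF' : ∀ a b, F' (a * b) = F' a * α a (F' b))
    (h : ∀ u, F (PresentedGroup.of u) = F' (PresentedGroup.of u)) (a : PresentedGroup rels) :
    F a = F' a := by
  have one : ∀ {E : PresentedGroup rels → M}, (∀ a b, E (a * b) = E a * α a (E b)) → E 1 = 1 := by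
    intro E hE
    have := hE 1 1
    rw [hα, mul_one] at this
    simpa using this
  have key : a ∈ Subgroup.closure (Set.range (PresentedGroup.of (rels := rels))) := by
    rw [PresentedGroup.closure_range_of]; trivial
  induction key using Subgroup.closure_induction with
  | mem x hx => obtain ⟨u, rfl⟩ := hx; exact h u
  | one => rw [one hF, one hF']
  | mul x y _ _ hx hy => rw [hF, hF', hx, hy]
  | inv x _ hx =>
    have h1 := hF x⁻¹ x
    have h2 := hF' x⁻¹ x
    rw [inv_mul_cancel, one hF] at h1
    rw [inv_mul_cancel, one hF', ← hx, h1] at h2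
    exact mul_right_cancel h2

/-- Turn an action by endomorphisms of a group into an action by automorphisms. -/
def mulAutOfEnd {A M : Type*} [Group A] [Group M] (α : A → M →* M) (h1 : α 1 = MonoidHom.id M)
    (hmul : ∀ a b, α (a * b) = (α a).comp (α b)) : A →* MulAut M where
  toFun a :=
    { toFun := α a
      invFun := α a⁻¹
      left_inv := fun m => by
        rw [← MonoidHom.comp_apply, ← hmul, inv_mul_cancel, h1, MonoidHom.id_apply]
      right_inv := fun m => by
        rw [← MonoidHom.comp_apply, ← hmul, mul_inv_cancel, h1, MonoidHom.id_apply]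
      map_mul' := (α a).map_mul }
  map_one' := by ext m; exact DFunLike.congr_fun h1 m
  map_mul' a b := by ext m; exact DFunLike.congr_fun (hmul a b) m

end CrossedMaps

namespace RAAG

variable {V : Type*} {Γ : SimpleGraph V}

/-- The generator attached to a vertex. -/
def gen (Γ : SimpleGraph V) (v : V) : RAAG Γ := PresentedGroup.of v

theorem gen_comm {u w : V} (h : Γ.Adj u w) : Commute (gen Γ u) (gen Γ w) := by
  have : PresentedGroup.mk (raagRels Γ) (FreeGroup.of u * FreeGroup.of w * (FreeGroup.of u)⁻¹ *
    (FreeGroup.of w)⁻¹) = 1 := PresentedGroup.one_of_mem ⟨u, w, h, rfl⟩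
  rw [map_mul, map_mul, map_mul, map_inv, map_inv, mul_inv_eq_one, mul_inv_eq_iff_eq_mul] at this
  exact this

/-- Existence of crossed maps on a right-angled Artin group with prescribed values on the
generators. -/
theorem exists_crossed {M : Type*} [Group M]
    (α : RAAG Γ → M →* M) (h1 : α 1 = MonoidHom.id M)
    (hmul : ∀ a b, α (a * b) = (α a).comp (α b)) (f : V → M)
    (hf : ∀ u w, Γ.Adj u w →
      f u * α (PresentedGroup.of u) (f w) = f w * α (PresentedGroup.of w) (f u)) :
    ∃ F : RAAG Γ → M, (∀ a b, F (a * b) = F a * α a (F b)) ∧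
      ∀ u, F (PresentedGroup.of u) = f u := by
  let g : V → M ⋊[mulAutOfEnd α h1 hmul] RAAG Γ := fun u => ⟨f u, PresentedGroup.of u⟩
  have hg : ∀ r ∈ raagRels Γ, FreeGroup.lift g r = 1 := by
    rintro r ⟨u, w, h, rfl⟩
    simp only [map_mul, map_inv, FreeGroup.lift_apply_of]
    rw [mul_inv_eq_one, mul_inv_eq_iff_eq_mul]
    exact SemidirectProduct.ext (hf u w h) (gen_comm h)
  let Φ := PresentedGroup.toGroup hg
  have hΦ : ∀ a, (Φ a).right = a := by
    intro a
    have : (SemidirectProduct.rightHom.comp Φ : RAAG Γ →* RAAG Γ) = MonoidHom.id _ := by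
      ext u
      simp [Φ, g]
    exact DFunLike.congr_fun this a
  refine ⟨fun a => (Φ a).left, fun a b => ?_, fun u => ?_⟩
  · change (Φ (a * b)).left = _
    rw [map_mul, SemidirectProduct.mul_left, hΦ]; rfl
  · simp [Φ, g]

theorem hom_ext {M : Type*} [Group M] {f g : RAAG Γ →* M} (h : ∀ u, f (gen Γ u) = g (gen Γ u)) :
    f = g :=
  PresentedGroup.ext h

@[elab_as_elim]
theorem gen_induction {p : RAAG Γ → Prop} (a : RAAG Γ) (gen : ∀ u, p (gen Γ u)) (one : p 1)
    (mul : ∀ a b, p a → p b → p (a * b)) (inv : ∀ a, p a → p a⁻¹) : p a := by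
  have key : a ∈ Subgroup.closure (Set.range (PresentedGroup.of (rels := raagRels Γ))) := by
    rw [PresentedGroup.closure_range_of]; trivial
  induction key using Subgroup.closure_induction with
  | mem x hx => obtain ⟨u, rfl⟩ := hx; exact gen u
  | one => exact one
  | mul x y _ _ hx hy => exact mul x y hx hy
  | inv x _ hx => exact inv x hx

open Classical in
/-- The retraction of `A(Γ)` onto the subgroup generated by a set `T` of vertices, killing the
other generators. -/
noncomputable def ret (Γ : SimpleGraph V) (T : Set V) : RAAG Γ →* RAAG Γ :=
  PresentedGroup.toGroup (f := fun u => if u ∈ T then gen Γ u else 1) <| by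
    rintro r ⟨u, w, h, rfl⟩
    simp only [map_mul, map_inv, FreeGroup.lift_apply_of]
    rw [mul_inv_eq_one, mul_inv_eq_iff_eq_mul]
    split_ifs <;> simp [(gen_comm h).eq]

theorem ret_gen_of_mem {T : Set V} {u : V} (h : u ∈ T) : ret Γ T (gen Γ u) = gen Γ u := by
  simp only [ret, gen, PresentedGroup.toGroup.of, if_pos h]

theorem ret_gen_of_notMem {T : Set V} {u : V} (h : u ∉ T) : ret Γ T (gen Γ u) = 1 := by
  simp only [ret, gen, PresentedGroup.toGroup.of, if_neg h]

theorem ret_ret (S T : Set V) (a : RAAG Γ) : ret Γ S (ret Γ T a) = ret Γ (S ∩ T) a := by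
  have : (ret Γ S).comp (ret Γ T) = ret Γ (S ∩ T) := by
    refine hom_ext fun u => ?_
    by_cases hT : u ∈ T
    · by_cases hS : u ∈ S
      · simp [ret_gen_of_mem, hS, hT]
      · simp [ret_gen_of_mem, ret_gen_of_notMem, hS, hT]
    · simp [ret_gen_of_notMem, hT]
  exact DFunLike.congr_fun this a

theorem ret_univ (a : RAAG Γ) : ret Γ Set.univ a = a := by
  have : ret Γ Set.univ = MonoidHom.id _ := hom_ext fun u => by simp [ret_gen_of_mem]
  exact DFunLike.congr_fun this a

theorem ret_empty (a : RAAG Γ) : ret Γ ∅ a = 1 := by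
  have : ret Γ ∅ = 1 := hom_ext fun u => by simp [ret_gen_of_notMem]
  exact DFunLike.congr_fun this a

theorem ret_ret_self (T : Set V) (a : RAAG Γ) : ret Γ T (ret Γ T a) = ret Γ T a := by
  rw [ret_ret, Set.inter_self]

theorem ret_comm (S T : Set V) (a : RAAG Γ) : ret Γ S (ret Γ T a) = ret Γ T (ret Γ S a) := by
  rw [ret_ret, ret_ret, Set.inter_comm]

theorem ret_ret_of_subset {S T : Set V} (h : S ⊆ T) (a : RAAG Γ) :
    ret Γ S (ret Γ T a) = ret Γ S a := by
  rw [ret_ret, Set.inter_eq_left.2 h]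

theorem ret_eq_of_subset {S T : Set V} (h : S ⊆ T) {a : RAAG Γ} (ha : ret Γ S a = a) :
    ret Γ T a = a := by
  rw [← ha, ret_ret, Set.inter_eq_right.2 h]

/-- The subgroup generated by the link of a vertex. -/
noncomputable def link (Γ : SimpleGraph V) (v : V) : Subgroup (RAAG Γ) :=
  (ret Γ (Γ.neighborSet v)).range

theorem mem_link {v : V} {a : RAAG Γ} : a ∈ link Γ v ↔ ret Γ (Γ.neighborSet v) a = a := by
  constructor
  · rintro ⟨b, rfl⟩; exact ret_ret_self _ _
  · intro h; exact ⟨a, h⟩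

theorem ret_mem_link (T : Set V) {v : V} {a : RAAG Γ} (ha : a ∈ link Γ v) :
    ret Γ T a ∈ link Γ v := by
  rw [mem_link] at *
  rw [ret_comm, ha]

theorem ret_compl_of_mem_link {v : V} {a : RAAG Γ} (ha : a ∈ link Γ v) :
    ret Γ {v}ᶜ a = a :=
  ret_eq_of_subset (fun _ hw h => Γ.ne_of_adj hw (Set.mem_singleton_iff.1 h).symm) (mem_link.1 ha)

theorem gen_mem_link {v w : V} (h : Γ.Adj v w) : gen Γ w ∈ link Γ v :=
  mem_link.2 (ret_gen_of_mem h)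

/-- The quotient of the action on the cosets of the link. -/
abbrev Cosets (Γ : SimpleGraph V) (v : V) := RAAG Γ ⧸ link Γ v

/-- The map induced on cosets of a link by a retraction. -/
noncomputable def cosetRet (v : V) (T : Set V) : Cosets Γ v → Cosets Γ v :=
  Quotient.map' (ret Γ T) fun a b h => by
    rw [QuotientGroup.leftRel_apply] at *
    rw [← map_inv, ← map_mul]
    exact ret_mem_link T h

@[simp]
theorem cosetRet_mk (v : V) (T : Set V) (a : RAAG Γ) :
    cosetRet v T (a : Cosets Γ v) = (ret Γ T a : RAAG Γ) := rfl

theorem cosetRet_smul (v : V) (T : Set V) (a : RAAG Γ) (x : Cosets Γ v) :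
    cosetRet v T (a • x) = ret Γ T a • cosetRet v T x := by
  induction x using QuotientGroup.induction_on with | H b => ?_
  change (((ret Γ T (a * b) : RAAG Γ)) : Cosets Γ v) = ((ret Γ T a * ret Γ T b : RAAG Γ) : Cosets Γ v)
  rw [map_mul]

/-- The action of `A(Γ)`, through the retraction deleting `v`, on the free group on the cosets of
the link of `v`. -/
noncomputable def freeAct (v : V) (a : RAAG Γ) :
    FreeGroup (Cosets Γ v) →* FreeGroup (Cosets Γ v) :=
  FreeGroup.map fun x => ret Γ {v}ᶜ a • x

theorem freeAct_of (v : V) (a : RAAG Γ) (x : Cosets Γ v) :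
    freeAct v a (FreeGroup.of x) = FreeGroup.of (ret Γ {v}ᶜ a • x) := by
  simp [freeAct]

theorem freeAct_one (v : V) : freeAct (Γ := Γ) v 1 = MonoidHom.id _ := by
  ext x; simp [freeAct]

theorem freeAct_mul (v : V) (a b : RAAG Γ) : freeAct v (a * b) = (freeAct v a).comp (freeAct v b) := by
  ext x; simp [freeAct, mul_smul]

open Classical in
theorem exists_word (Γ : SimpleGraph V) (v : V) : ∃ F : RAAG Γ → FreeGroup (Cosets Γ v),
    (∀ a b, F (a * b) = F a * freeAct v a (F b)) ∧
      ∀ u, F (PresentedGroup.of u) = if u = v then FreeGroup.of ((1 : RAAG Γ) : Cosets Γ v) else 1 := by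
  refine exists_crossed (freeAct v) (freeAct_one v) (freeAct_mul v) _ fun u w h => ?_
  have key : ∀ u w, Γ.Adj u w → u = v →
      FreeGroup.of ((1 : RAAG Γ) : Cosets Γ v) =
      freeAct v (PresentedGroup.of w) (FreeGroup.of ((1 : RAAG Γ) : Cosets Γ v)) := by
    rintro u w h rfl
    rw [freeAct_of]
    congr 1
    have : ret Γ {u}ᶜ (gen Γ w) = gen Γ w := ret_gen_of_mem (by simpa using (Γ.ne_of_adj h).symm)
    change _ = ((ret Γ {u}ᶜ (gen Γ w) * 1 : RAAG Γ) : Cosets Γ u)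
    rw [this, mul_one]
    refine (QuotientGroup.eq.2 ?_)
    simpa using gen_mem_link h
  by_cases hu : u = v
  · have hw : w ≠ v := by rintro rfl; exact Γ.ne_of_adj h hu
    simp only [hu, hw, if_true, if_false, map_one, mul_one, one_mul]
    exact key u w h hu
  · by_cases hw : w = v
    · simp only [hu, hw, if_true, if_false, map_one, mul_one, one_mul]
      exact (key w u h.symm hw).symm
    · simp [hu, hw]

/-- The `v`-word of an element of `A(Γ)`: the element of the free group on the cosets of the link
of `v` recording the occurrences of `v`. -/
noncomputable def word (v : V) : RAAG Γ → FreeGroup (Cosets Γ v) := (exists_word Γ v).choose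

theorem word_mul (v : V) (a b : RAAG Γ) : word v (a * b) = word v a * freeAct v a (word v b) :=
  (exists_word Γ v).choose_spec.1 a b

theorem word_gen_self (v : V) : word v (gen Γ v) = FreeGroup.of ((1 : RAAG Γ) : Cosets Γ v) :=
  ((exists_word Γ v).choose_spec.2 v).trans (if_pos rfl)

theorem word_gen_of_ne {v u : V} (h : u ≠ v) : word v (gen Γ u) = 1 :=
  ((exists_word Γ v).choose_spec.2 u).trans (if_neg h)

@[simp]
theorem word_one (v : V) : word v (1 : RAAG Γ) = 1 := by
  have := word_mul v (1 : RAAG Γ) 1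
  simpa [freeAct_one] using this

theorem word_inv (v : V) (a : RAAG Γ) : word v a⁻¹ = freeAct v a⁻¹ (word v a)⁻¹ := by
  have := word_mul v a⁻¹ a
  rw [inv_mul_cancel, word_one] at this
  rw [map_inv]
  exact eq_inv_of_mul_eq_one_left this.symm

theorem word_ret (v : V) {T : Set V} (hv : v ∈ T) (a : RAAG Γ) :
    word v (ret Γ T a) = FreeGroup.map (cosetRet v (T \ {v})) (word v a) := by
  have hs : ({v}ᶜ ∩ T : Set V) = T \ {v} := by ext; simp [and_comm]
  refine PresentedGroup.crossed_ext (α := fun a m => FreeGroup.map (fun x => ret Γ (T \ {v}) a • x) m)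
    (by intro m; simp) (F := fun a => word v (ret Γ T a))
    (F' := fun a => FreeGroup.map (cosetRet v (T \ {v})) (word v a)) ?_ ?_ ?_ a
  · intro a b
    simp only [map_mul, word_mul, freeAct, ret_ret, hs]
  · intro a b
    simp only [word_mul, map_mul, freeAct, FreeGroup.map.comp]
    congr 2
    refine congrArg _ (funext fun x => ?_)
    simp [cosetRet_smul, ret_ret, Set.sdiff_eq, Set.inter_assoc]
  · intro u
    change word v (ret Γ T (gen Γ u)) = FreeGroup.map (cosetRet v (T \ {v})) (word v (gen Γ u))
    by_cases hu : u = v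
    · subst hu
      rw [ret_gen_of_mem hv, word_gen_self, FreeGroup.map.of, cosetRet_mk, map_one]
    · rw [word_gen_of_ne hu, map_one]
      by_cases hT : u ∈ T
      · rw [ret_gen_of_mem hT, word_gen_of_ne hu]
      · rw [ret_gen_of_notMem hT, word_one]

theorem word_ret_of_notMem (v : V) {T : Set V} (hv : v ∉ T) (a : RAAG Γ) :
    word v (ret Γ T a) = 1 := by
  induction a using gen_induction with
  | gen u =>
    by_cases hT : u ∈ T
    · rw [ret_gen_of_mem hT, word_gen_of_ne (by rintro rfl; exact hv hT)]
    · rw [ret_gen_of_notMem hT, word_one]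
  | one => simp
  | mul a b ha hb => rw [map_mul, word_mul, ha, hb]; simp
  | inv a ha => rw [map_inv, word_inv, ha]; simp

theorem word_eq_one (v : V) {a : RAAG Γ} (ha : ret Γ {v}ᶜ a = a) : word v a = 1 := by
  rw [← ha]; exact word_ret_of_notMem v (by simp) a

theorem gen_commute_link {v : V} {a : RAAG Γ} (ha : a ∈ link Γ v) : Commute (gen Γ v) a := by
  obtain ⟨b, rfl⟩ := ha
  induction b using gen_induction with
  | gen u =>
    by_cases h : u ∈ Γ.neighborSet v
    · rw [ret_gen_of_mem h]; exact gen_comm h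
    · rw [ret_gen_of_notMem h]; exact Commute.one_right _
  | one => simp
  | mul a b ha hb => rw [map_mul]; exact ha.mul_right hb
  | inv a ha => rw [map_inv]; exact ha.inv_right

/-- Evaluation of words: a coset `gL` is sent to `g v g⁻¹`. -/
noncomputable def eval (Γ : SimpleGraph V) (v : V) : FreeGroup (Cosets Γ v) →* RAAG Γ :=
  FreeGroup.lift fun x => x.out * gen Γ v * x.out⁻¹

theorem eval_of (v : V) (g : RAAG Γ) :
    eval Γ v (FreeGroup.of (g : Cosets Γ v)) = g * gen Γ v * g⁻¹ := by
  obtain ⟨h, hh⟩ := QuotientGroup.mk_out_eq_mul (link Γ v) g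
  rw [eval, FreeGroup.lift_apply_of, hh, mul_assoc g, ← (gen_commute_link h.2).eq]
  group

theorem eval_freeAct (v : V) (a : RAAG Γ) (f : FreeGroup (Cosets Γ v)) :
    eval Γ v (freeAct v a f) = ret Γ {v}ᶜ a * eval Γ v f * (ret Γ {v}ᶜ a)⁻¹ := by
  have : (eval Γ v).comp (freeAct v a) =
      (MulAut.conj (ret Γ {v}ᶜ a)).toMonoidHom.comp (eval Γ v) := by
    ext x
    induction x using QuotientGroup.induction_on with | H b => ?_
    simp only [MonoidHom.comp_apply, freeAct_of]
    change eval Γ v (FreeGroup.of ((ret Γ {v}ᶜ a * b : RAAG Γ) : Cosets Γ v)) =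
      ret Γ {v}ᶜ a * _ * (ret Γ {v}ᶜ a)⁻¹
    rw [eval_of, eval_of]; group
  exact DFunLike.congr_fun this f

theorem eval_word (v : V) (a : RAAG Γ) : eval Γ v (word v a) * ret Γ {v}ᶜ a = a := by
  induction a using gen_induction with
  | gen u =>
    by_cases hu : u = v
    · subst hu
      rw [word_gen_self, eval_of, ret_gen_of_notMem (by simp)]; simp
    · rw [word_gen_of_ne hu, ret_gen_of_mem (by simpa using hu)]; simp
  | one => simp
  | mul a b ha hb =>
    rw [word_mul, map_mul, eval_freeAct, map_mul]
    conv_rhs => rw [← ha, ← hb]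
    group
  | inv a ha =>
    rw [word_inv, eval_freeAct, map_inv, map_inv]
    conv_rhs => rw [← ha]
    group

theorem eq_of_word_eq (v : V) {a b : RAAG Γ} (hw : word v a = word v b)
    (hr : ret Γ {v}ᶜ a = ret Γ {v}ᶜ b) : a = b := by
  rw [← eval_word v a, ← eval_word v b, hw, hr]

theorem freeAct_eq_id {v : V} {a : RAAG Γ} (ha : ret Γ {v}ᶜ a = 1) : freeAct v a = MonoidHom.id _ := by
  ext x; simp [freeAct, ha]

theorem word_pow_of_ret_eq_one {v : V} {a : RAAG Γ} (ha : ret Γ {v}ᶜ a = 1) (n : ℕ) :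
    word v (a ^ n) = word v a ^ n := by
  induction n with
  | zero => simp
  | succ n ih => rw [pow_succ, word_mul, ih, freeAct_eq_id (by rw [map_pow, ha, one_pow]), pow_succ]; rfl

theorem eq_one_of_pow_eq_one (v : V) {a : RAAG Γ} (ha : ret Γ {v}ᶜ a = 1) {n : ℕ} (hn : n ≠ 0)
    (h : a ^ n = 1) : a = 1 := by
  refine eq_of_word_eq v ?_ (by rw [ha, map_one])
  have h2 := word_pow_of_ret_eq_one ha n
  rw [h, word_one] at h2
  rw [word_one]
  exact (pow_eq_one_iff_left hn).1 h2.symm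

end RAAG

section FreeGroupActions

/-- A partial injection of a finite type extends to a permutation. -/
theorem exists_perm_of_rel {I : Type*} [Finite I] (R : I → I → Prop)
    (hfun : ∀ a b b', R a b → R a b' → b = b') (hinj : ∀ a a' b, R a b → R a' b → a = a') :
    ∃ σ : Equiv.Perm I, ∀ a b, R a b → σ a = b := by
  classical
  have := Fintype.ofFinite I
  let f : {a // ∃ b, R a b} → {b // ∃ a, R a b} := fun a => ⟨a.2.choose, a.1, a.2.choose_spec⟩
  have hf : Function.Bijective f := by
    constructor
    · intro a a' h
      have h1 := a.2.choose_spec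
      have h2 := a'.2.choose_spec
      have h3 : a.2.choose = a'.2.choose := congrArg Subtype.val h
      rw [← h3] at h2
      exact Subtype.ext (hinj _ _ _ h1 h2)
    · rintro ⟨b, a, hab⟩
      exact ⟨⟨a, b, hab⟩, Subtype.ext (hfun _ _ _ (Exists.choose_spec (⟨b, hab⟩ : ∃ b, R a b)) hab)⟩
  refine ⟨(Equiv.ofBijective f hf).extendSubtype, fun a b hab => ?_⟩
  rw [Equiv.extendSubtype_apply_of_mem _ a ⟨b, hab⟩]
  exact hfun a _ _ (Exists.choose_spec (⟨b, hab⟩ : ∃ b, R a b)) hab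

/-- Integer-valued cocycles for actions of a free group exist with prescribed values on the
generators. -/
theorem FreeGroup.exists_cocycle {Y I : Type*} (σ : Y → Equiv.Perm I) (δ : Y → I → ℤ) :
    ∃ t : FreeGroup Y → I → ℤ,
      (∀ f g i, t (f * g) i = t f i + t g ((FreeGroup.lift σ f)⁻¹ i)) ∧
      ∀ y i, t (FreeGroup.of y) i = δ y i := by
  let Φ : FreeGroup Y →* (I → Multiplicative ℤ) ⋊[mulAutArrow] Equiv.Perm I :=
    FreeGroup.lift fun y => ⟨fun i => Multiplicative.ofAdd (δ y i), σ y⟩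
  have hΦ : ∀ f, (Φ f).right = FreeGroup.lift σ f := by
    intro f
    have : SemidirectProduct.rightHom.comp Φ = FreeGroup.lift σ := by ext y : 1; simp [Φ]
    exact DFunLike.congr_fun this f
  refine ⟨fun f i => Multiplicative.toAdd ((Φ f).left i), fun f g i => ?_, fun y i => by simp [Φ]⟩
  change Multiplicative.toAdd ((Φ (f * g)).left i) = _
  rw [_root_.map_mul, SemidirectProduct.mul_left, hΦ]
  rfl

theorem FreeGroup.IsCyclicallyReduced.getElem {Y : Type*} {l : List (Y × Bool)}
    (h : FreeGroup.IsCyclicallyReduced l) [NeZero l.length] (i : ZMod l.length)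
    (hi : (l[i.val]'i.val_lt).1 = (l[(i + 1).val]'(i + 1).val_lt).1) :
    (l[i.val]'i.val_lt).2 = (l[(i + 1).val]'(i + 1).val_lt).2 := by
  have hlt := i.val_lt
  rcases Nat.lt_or_ge (i.val + 1) l.length with h1 | h1
  · have h2 : (i + 1).val = i.val + 1 := by
      have : i + 1 = ((i.val + 1 : ℕ) : ZMod l.length) := by push_cast; rw [ZMod.natCast_zmod_val]
      rw [this, ZMod.val_natCast_of_lt h1]
    have h3 := List.isChain_iff_getElem.1 h.1 i.val h1
    simp only [h2] at hi ⊢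
    exact h3 hi
  · have h3 : i.val = l.length - 1 := by omega
    have h2 : (i + 1).val = 0 := by
      have : i + 1 = ((i.val + 1 : ℕ) : ZMod l.length) := by push_cast; rw [ZMod.natCast_zmod_val]
      rw [this, show i.val + 1 = l.length by omega, ZMod.natCast_self, ZMod.val_zero]
    simp only [h2, h3] at hi ⊢
    have hpos : 0 < l.length := NeZero.pos _
    refine h.2 _ ?_ _ ?_ hi
    · rw [List.getLast?_eq_getElem?, List.getElem?_eq_getElem (by omega)]; rfl
    · rw [List.head?_eq_getElem?, List.getElem?_eq_getElem hpos]; rfl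

/-- Every nontrivial element of a free group fixes a point of some finite permutation
representation at which some integral cocycle is nonzero. -/
theorem FreeGroup.exists_cocycle_ne_zero {Y : Type*} {f : FreeGroup Y} (hf : f ≠ 1) :
    ∃ (I : Type) (_ : Finite I) (σ : Y → Equiv.Perm I) (t : FreeGroup Y → I → ℤ) (i₀ : I),
      (∀ f g i, t (f * g) i = t f i + t g ((FreeGroup.lift σ f)⁻¹ i)) ∧
      FreeGroup.lift σ f i₀ = i₀ ∧ t f i₀ ≠ 0 := by
  classical
  set l := FreeGroup.reduceCyclically f.toWord with hl
  have hcyc : FreeGroup.IsCyclicallyReduced l :=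
    FreeGroup.reduceCyclically.isCyclicallyReduced FreeGroup.isReduced_toWord
  set g : FreeGroup Y := FreeGroup.mk (FreeGroup.reduceCyclically.conjugator f.toWord)
  have hconj : f = g * FreeGroup.mk l * g⁻¹ := by
    rw [FreeGroup.inv_mk, FreeGroup.mul_mk, FreeGroup.mul_mk,
      FreeGroup.reduceCyclically.conj_conjugator_reduceCyclically, FreeGroup.mk_toWord]
  have hlen : l.length ≠ 0 := by
    intro h
    rw [List.length_eq_zero_iff] at h
    apply hf
    rw [hconj, h, ← FreeGroup.one_eq_mk]; group
  have : NeZero l.length := ⟨hlen⟩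
  let w : ZMod l.length → Y × Bool := fun i => l[i.val]'i.val_lt
  have hw : ∀ i, (w i).1 = (w (i + 1)).1 → (w i).2 = (w (i + 1)).2 := fun i => hcyc.getElem i
  have hwbad : ∀ i y b, w i = (y, b) → w (i + 1) = (y, !b) → False := by
    intro i y b h1 h2
    have := hw i (by rw [h1, h2])
    rw [h1, h2] at this
    simp at this
  have hσ : ∀ y : Y, ∃ σ : Equiv.Perm (ZMod l.length), ∀ a b,
      ((w b = (y, true) ∧ a = b + 1) ∨ (w a = (y, false) ∧ b = a + 1)) → σ a = b := by
    intro y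
    apply exists_perm_of_rel
    · rintro a b b' (⟨h1, h2⟩ | ⟨h1, h2⟩) (⟨h3, h4⟩ | ⟨h3, h4⟩)
      · exact add_right_cancel (h2.symm.trans h4)
      · exact (hwbad b y true h1 (h2 ▸ h3)).elim
      · exact (hwbad b' y true h3 (h4 ▸ h1)).elim
      · rw [h2, h4]
    · rintro a a' b (⟨h1, h2⟩ | ⟨h1, h2⟩) (⟨h3, h4⟩ | ⟨h3, h4⟩)
      · rw [h2, h4]
      · exact (hwbad a' y false h3 (h4 ▸ h1)).elim
      · exact (hwbad a y false h1 (h2 ▸ h3)).elim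
      · exact add_right_cancel (h2.symm.trans h4)
  choose σ hσ using hσ
  obtain ⟨t, ht, htδ⟩ := FreeGroup.exists_cocycle σ fun y i =>
    (if w i = (y, true) then 1 else 0) - (if w (i - 1) = (y, false) then 1 else 0)
  have ht1 : ∀ i, t 1 i = 0 := by
    intro i
    have := ht 1 1 i
    rw [mul_one, _root_.map_one, inv_one] at this
    simpa using this
  have hinv : ∀ f i, t f⁻¹ i = - t f (FreeGroup.lift σ f i) := by
    intro f i
    have := ht f⁻¹ f i
    rw [inv_mul_cancel, ht1, _root_.map_inv, inv_inv] at this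
    linarith
  have hstep : ∀ i : ZMod l.length, FreeGroup.lift σ (FreeGroup.mk [w i]) (i + 1) = i ∧
      t (FreeGroup.mk [w i]) i = 1 := by
    intro i
    rcases hi : w i with ⟨y, b⟩
    cases b with
    | true =>
      refine ⟨hσ y _ _ (Or.inl ⟨hi, rfl⟩), ?_⟩
      change t (FreeGroup.of y) i = 1
      rw [htδ, if_pos hi, if_neg, sub_zero]
      intro h
      exact hwbad (i - 1) y false h (by simpa using hi)
    | false =>
      have h1 : σ y i = i + 1 := hσ y _ _ (Or.inr ⟨hi, rfl⟩)
      have h0 : (FreeGroup.mk [(y, false)]) = (FreeGroup.of y)⁻¹ := rfl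
      rw [h0]
      refine ⟨?_, ?_⟩
      · rw [_root_.map_inv, FreeGroup.lift_apply_of, Equiv.Perm.inv_eq_iff_eq, h1]
      · rw [hinv, FreeGroup.lift_apply_of, h1, htδ, if_neg, if_pos]
        · rfl
        · simpa using hi
        · intro h; exact hwbad i y false hi h
  have hsuf : ∀ l' pre : List (Y × Bool), l = pre ++ l' →
      FreeGroup.lift σ (FreeGroup.mk l') 0 = (pre.length : ZMod l.length) ∧
      t (FreeGroup.mk l') (pre.length : ZMod l.length) = l'.length := by
    intro l'
    induction l' with
    | nil =>
      intro pre h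
      rw [List.append_nil] at h
      rw [← FreeGroup.one_eq_mk, _root_.map_one, ht1, ← h]
      simp
    | cons p l' ih =>
      intro pre h
      obtain ⟨h1, h2⟩ := ih (pre ++ [p]) (by simpa using h)
      have hp : w (pre.length : ZMod l.length) = p := by
        have hlt : pre.length < l.length := by rw [h]; simp
        have hval : ((pre.length : ZMod l.length)).val = pre.length := ZMod.val_natCast_of_lt hlt
        have : l[pre.length] = p := by simp [h]
        simp only [w, hval]
        exact this
      have hmk : FreeGroup.mk (p :: l') = FreeGroup.mk [p] * FreeGroup.mk l' := by
        rw [FreeGroup.mul_mk]; rfl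
      obtain ⟨h3, h4⟩ := hstep (pre.length : ZMod l.length)
      rw [hp] at h3 h4
      have hcast : (((pre ++ [p]).length : ℕ) : ZMod l.length) = pre.length + 1 := by simp
      rw [hcast] at h1 h2
      rw [hmk]
      refine ⟨?_, ?_⟩
      · rw [_root_.map_mul, Equiv.Perm.mul_apply, h1, h3]
      · rw [ht, h4, Equiv.Perm.inv_eq_iff_eq.2 h3.symm, h2]
        simp [add_comm]
  obtain ⟨h1, h2⟩ := hsuf l [] rfl
  simp only [List.length_nil, Nat.cast_zero] at h1 h2
  refine ⟨ZMod l.length, inferInstance, σ, t, FreeGroup.lift σ g 0, ht, ?_, ?_⟩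
  · rw [hconj, _root_.map_mul, _root_.map_mul, _root_.map_inv, Equiv.Perm.mul_apply,
      Equiv.Perm.mul_apply, Equiv.Perm.inv_eq_iff_eq.2 rfl, h1]
  · have hg : (FreeGroup.lift σ g)⁻¹ (FreeGroup.lift σ g 0) = 0 := Equiv.Perm.inv_eq_iff_eq.2 rfl
    have hl : (FreeGroup.lift σ (FreeGroup.mk l))⁻¹ 0 = 0 := Equiv.Perm.inv_eq_iff_eq.2 h1.symm
    have : t f (FreeGroup.lift σ g 0) = l.length := by
      rw [hconj, ht, ht, hinv, _root_.map_mul, mul_inv_rev, Equiv.Perm.mul_apply, hg, hl, h2]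
      ring
    rw [this]
    exact_mod_cast hlen

/-- If the word of `f` is preserved by a substitution of letters, then all its letters are. -/
theorem FreeGroup.eq_of_mem_toWord_of_map_eq {X : Type*} [DecidableEq X] {φ : X → X}
    {f : FreeGroup X} (h : FreeGroup.map φ f = f) {p : X × Bool} (hp : p ∈ f.toWord) :
    φ p.1 = p.1 := by
  have h1 : FreeGroup.mk (f.toWord.map fun q => (φ q.1, q.2)) = f := by
    rw [← FreeGroup.map.mk, FreeGroup.mk_toWord, h]
  have h2 : FreeGroup.reduce (f.toWord.map fun q => (φ q.1, q.2)) = f.toWord := by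
    rw [← FreeGroup.toWord_mk, h1]
  have h3 : f.toWord = f.toWord.map fun q => (φ q.1, q.2) := by
    have hs : List.Sublist (FreeGroup.reduce (f.toWord.map fun q => (φ q.1, q.2)))
      (f.toWord.map fun q => (φ q.1, q.2)) := FreeGroup.Red.sublist FreeGroup.reduce.red
    rw [h2] at hs
    exact hs.eq_of_length (by simp)
  have h4 : f.toWord.map (fun q => (φ q.1, q.2)) = f.toWord.map id := by rw [List.map_id, ← h3]
  exact congrArg Prod.fst (List.map_inj_left.1 h4 p hp)

/-- A substitution which is injective on the letters of a reduced word keeps it reduced. -/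
theorem FreeGroup.IsReduced.map_of_injOn {X Y : Type*} {l : List (X × Bool)}
    (hl : FreeGroup.IsReduced l) {φ : X → Y}
    (hφ : Set.InjOn φ {x | ∃ b, (x, b) ∈ l}) :
    FreeGroup.IsReduced (l.map fun q => (φ q.1, q.2)) := by
  unfold FreeGroup.IsReduced at *
  rw [List.isChain_iff_getElem] at *
  intro i hi h
  simp only [List.getElem_map] at h ⊢
  simp only [List.length_map] at hi
  exact hl i hi (hφ ⟨_, List.getElem_mem _⟩ ⟨_, List.getElem_mem _⟩ h)

end FreeGroupActions

namespace FiniteIndexNormalSubgroup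

variable {G : Type*} [Group G]

theorem mem_of_le {N M : FiniteIndexNormalSubgroup G} (h : N ≤ M) {a : G} (ha : a ∈ N) : a ∈ M :=
  h ha

theorem conj_mem (N : FiniteIndexNormalSubgroup G) {a : G} (ha : a ∈ N) (g : G) :
    g * a * g⁻¹ ∈ N :=
  N.isNormal'.conj_mem a ha g

/-- A finite family has a common lower bound. -/
theorem exists_forall_le {ι : Type*} [Finite ι] (N : ι → FiniteIndexNormalSubgroup G)
    (M : FiniteIndexNormalSubgroup G) : ∃ N' ≤ M, ∀ i, N' ≤ N i := by
  have := Fintype.ofFinite ι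
  classical
  suffices h : ∀ s : Finset ι, ∃ N' ≤ M, ∀ i ∈ s, N' ≤ N i by
    obtain ⟨N', h1, h2⟩ := h Finset.univ
    exact ⟨N', h1, fun i => h2 i (Finset.mem_univ i)⟩
  intro s
  induction s using Finset.induction_on with
  | empty => exact ⟨M, le_rfl, by simp⟩
  | insert i s _ ih =>
    obtain ⟨N', h1, h2⟩ := ih
    refine ⟨N' ⊓ N i, inf_le_left.trans h1, fun j hj => ?_⟩
    rcases Finset.mem_insert.1 hj with rfl | hj
    · exact inf_le_right
    · exact inf_le_left.trans (h2 j hj)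

/-- A property of elements that can be excluded one by one modulo finite index normal subgroups
can be excluded simultaneously on a finite set. -/
theorem exists_forall_of_finite {ι : Type*} {s : Set ι} (hs : s.Finite)
    {p : ι → FiniteIndexNormalSubgroup G → Prop} (hp : ∀ i N N', N' ≤ N → p i N → p i N')
    (h : ∀ i ∈ s, ∃ N, p i N) (M : FiniteIndexNormalSubgroup G) :
    ∃ N ≤ M, ∀ i ∈ s, p i N := by
  have := hs.to_subtype
  choose N hN using fun i : s => h i i.2
  obtain ⟨N', h1, h2⟩ := exists_forall_le N M
  exact ⟨N', h1, fun i hi => hp i _ _ (h2 ⟨i, hi⟩) (hN ⟨i, hi⟩)⟩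

theorem exists_pow_mem (N : FiniteIndexNormalSubgroup G) (a : G) : ∃ n : ℕ, 0 < n ∧ a ^ n ∈ N := by
  obtain ⟨n, hn, -, h⟩ :=
    N.toSubgroup.exists_pow_mem_of_index_ne_zero N.isFiniteIndex'.index_ne_zero a
  exact ⟨n, hn, h⟩

/-- The kernel of a homomorphism to a finite group. -/
def ker {F : Type*} [Group F] [Finite F] (f : G →* F) : FiniteIndexNormalSubgroup G :=
  have : f.ker.FiniteIndex := Subgroup.finiteIndex_ker f
  ofSubgroup f.ker

theorem mem_ker {F : Type*} [Group F] [Finite F] {f : G →* F} {a : G} : a ∈ ker f ↔ f a = 1 :=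
  Iff.rfl

/-- The elements of `N` on which an integral cocycle vanishes modulo `m`. -/
theorem exists_mem_iff_dvd {Ω : Type*} [Finite Ω] [MulAction G Ω] {T : G → Ω → ℤ}
    (hT : ∀ a b ω, T (a * b) ω = T a ω + T b (a⁻¹ • ω)) (N : FiniteIndexNormalSubgroup G)
    (hN : ∀ a ∈ N, ∀ ω : Ω, a • ω = ω) {m : ℕ} (hm : m ≠ 0) :
    ∃ N' ≤ N, ∀ a, a ∈ N' ↔ a ∈ N ∧ ∀ ω, (m : ℤ) ∣ T a ω := by
  have : NeZero m := ⟨hm⟩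
  let Φ : G →* (Ω → Multiplicative (ZMod m)) ⋊[mulAutArrow] Equiv.Perm Ω :=
    MonoidHom.mk' (fun a => ⟨fun ω => Multiplicative.ofAdd ((T a ω : ℤ) : ZMod m),
      MulAction.toPermHom G Ω a⟩) fun a b => by
        refine SemidirectProduct.ext (funext fun ω => ?_) (map_mul _ _ _)
        change Multiplicative.ofAdd ((T (a * b) ω : ℤ) : ZMod m) = _
        rw [hT, Int.cast_add]; rfl
  have : Finite ((Ω → Multiplicative (ZMod m)) ⋊[mulAutArrow] Equiv.Perm Ω) :=
    Finite.of_equiv _ SemidirectProduct.equivProd.symm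
  refine ⟨N ⊓ ker Φ, inf_le_left, fun a => ?_⟩
  constructor
  · rintro ⟨h1, h2⟩
    refine ⟨h1, fun ω => ?_⟩
    have h3 : Φ a = 1 := h2
    have h4 := congrFun (congrArg SemidirectProduct.left h3) ω
    have h5 : ((T a ω : ℤ) : ZMod m) = 0 := h4
    exact (ZMod.intCast_zmod_eq_zero_iff_dvd _ _).1 h5
  · rintro ⟨h1, h2⟩
    refine ⟨h1, ?_⟩
    change Φ a = 1
    refine SemidirectProduct.ext (funext fun ω => ?_) (Equiv.ext fun ω => hN a h1 ω)
    exact (ZMod.intCast_zmod_eq_zero_iff_dvd _ _).2 (h2 ω)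

end FiniteIndexNormalSubgroup

namespace RAAG

open FiniteIndexNormalSubgroup

universe u

variable {V : Type u} {Γ : SimpleGraph V}

/-- Invariance of a subgroup under the retractions. -/
def RetInv (N : FiniteIndexNormalSubgroup (RAAG Γ)) : Prop :=
  ∀ (T : Set V), ∀ a ∈ N, ret Γ T a ∈ N

theorem exists_le_retInv [Finite V] (M : FiniteIndexNormalSubgroup (RAAG Γ)) :
    ∃ N ≤ M, RetInv N := by
  have h1 : (⨅ T : Set V, M.toSubgroup.comap (ret Γ T)).Normal :=
    Subgroup.normal_iInf_normal fun T => inferInstance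
  have h2 : (⨅ T : Set V, M.toSubgroup.comap (ret Γ T)).FiniteIndex :=
    Subgroup.finiteIndex_iInf fun T => (comap (ret Γ T) M).isFiniteIndex'
  refine ⟨ofSubgroup (⨅ T : Set V, M.toSubgroup.comap (ret Γ T)), fun a ha => ?_, ?_⟩
  · have := Subgroup.mem_iInf.1 ha Set.univ
    rw [Subgroup.mem_comap, ret_univ] at this
    exact this
  · intro T a ha
    refine Subgroup.mem_iInf.2 fun S => ?_
    rw [Subgroup.mem_comap, ret_ret]
    exact Subgroup.mem_iInf.1 ha _

/-- The cosets of the link of `v` modulo `N`. -/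
abbrev FinCosets (v : V) (N : FiniteIndexNormalSubgroup (RAAG Γ)) :=
  RAAG Γ ⧸ (link Γ v ⊔ N.toSubgroup)

instance (v : V) (N : FiniteIndexNormalSubgroup (RAAG Γ)) : Finite (FinCosets v N) := by
  have : (link Γ v ⊔ N.toSubgroup).FiniteIndex := Subgroup.finiteIndex_of_le le_sup_right
  exact Subgroup.finite_quotient_of_finiteIndex

/-- Reduction of cosets modulo `N`. -/
noncomputable def proj (v : V) (N : FiniteIndexNormalSubgroup (RAAG Γ)) : Cosets Γ v → FinCosets v N :=
  Subgroup.quotientMapOfLE le_sup_left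

theorem proj_mk (v : V) (N : FiniteIndexNormalSubgroup (RAAG Γ)) (a : RAAG Γ) :
    proj v N (a : Cosets Γ v) = (a : FinCosets v N) := rfl

theorem proj_smul (v : V) (N : FiniteIndexNormalSubgroup (RAAG Γ)) (a : RAAG Γ)
    (x : Cosets Γ v) : proj v N (a • x) = a • proj v N x := by
  induction x using QuotientGroup.induction_on with | H b => rfl

theorem smul_eq_of_mem {v : V} {N : FiniteIndexNormalSubgroup (RAAG Γ)} {a : RAAG Γ} (ha : a ∈ N)
    (y : FinCosets v N) : a • y = y := by
  induction y using QuotientGroup.induction_on with | H b => ?_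
  refine QuotientGroup.eq.2 (Subgroup.mem_sup_right ?_)
  have := N.conj_mem (N.toSubgroup.inv_mem ha) b⁻¹
  simpa [mul_assoc, mem_toSubgroup_iff] using this

theorem smul_eq_smul_of_mem {v : V} {N : FiniteIndexNormalSubgroup (RAAG Γ)} {a b : RAAG Γ}
    (h : a⁻¹ * b ∈ N) (y : FinCosets v N) : a • y = b • y := by
  conv_lhs => rw [← smul_eq_of_mem h y]
  rw [smul_smul, mul_inv_cancel_left]

theorem mk_eq_mk_iff {v : V} {N : FiniteIndexNormalSubgroup (RAAG Γ)} {a b : RAAG Γ} :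
    (a : FinCosets v N) = b ↔ ∃ l ∈ link Γ v, (a * l)⁻¹ * b ∈ N := by
  rw [QuotientGroup.eq, Subgroup.mem_sup_of_normal_right]
  constructor
  · rintro ⟨l, hl, n, hn, h⟩
    refine ⟨l, hl, ?_⟩
    rw [mul_inv_rev, mul_assoc, ← h, inv_mul_cancel_left]; exact hn
  · rintro ⟨l, hl, h⟩
    exact ⟨l, hl, _, h, by group⟩

theorem proj_eq_of_le {v : V} {N N' : FiniteIndexNormalSubgroup (RAAG Γ)} (h : N' ≤ N)
    {x y : Cosets Γ v} (hxy : proj v N' x = proj v N' y) : proj v N x = proj v N y := by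
  induction x using QuotientGroup.induction_on with | H a => ?_
  induction y using QuotientGroup.induction_on with | H b => ?_
  rw [proj_mk, proj_mk, mk_eq_mk_iff] at *
  obtain ⟨l, hl, hn⟩ := hxy
  exact ⟨l, hl, h hn⟩

/-- The action of `A(Γ)` induced from a permutation representation of the free group on the cosets
of the link modulo `N`, together with the induced cocycle. -/
theorem exists_induced (v : V) {N : FiniteIndexNormalSubgroup (RAAG Γ)}
    {I : Type} [Finite I] (σ : FinCosets v N → Equiv.Perm I)
    {t : FreeGroup (FinCosets v N) → I → ℤ}
    (ht : ∀ f g i, t (f * g) i = t f i + t g ((FreeGroup.lift σ f)⁻¹ i)) :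
    ∃ (Ω : Type u) (_ : Finite Ω) (_ : MulAction (RAAG Γ) Ω) (T : RAAG Γ → Ω → ℤ) (base : I → Ω),
      Function.Injective base ∧
      (∀ a b ω, T (a * b) ω = T a ω + T b (a⁻¹ • ω)) ∧
      (∀ u ≠ v, ∀ ω, T (gen Γ u) ω = 0) ∧
      (∀ a i, T a (base i) = t (FreeGroup.map (proj v N) (word v a)) i) ∧
      (∀ a i, ret Γ {v}ᶜ a ∈ N →
        a • base i = base (FreeGroup.lift σ (FreeGroup.map (proj v N) (word v a)) i)) := by
  let L : RAAG Γ ⧸ N.toSubgroup → FreeGroup (Cosets Γ v) →* FreeGroup (FinCosets v N) :=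
    fun p => FreeGroup.map fun x => p.out⁻¹ • proj v N x
  have hL : ∀ b : RAAG Γ, L b = FreeGroup.map fun x => b⁻¹ • proj v N x := by
    intro b
    obtain ⟨n, hn⟩ := QuotientGroup.mk_out_eq_mul N.toSubgroup b
    refine congrArg FreeGroup.map (funext fun x => smul_eq_smul_of_mem ?_ _)
    rw [hn]
    simpa using N.conj_mem n.2 b
  have hL1 : L 1 = FreeGroup.map (proj v N) := by
    have := hL 1
    simpa using this
  have hact : ∀ (a : RAAG Γ) (p : RAAG Γ ⧸ N.toSubgroup) f,
      L ((ret Γ {v}ᶜ a : RAAG Γ) * p) (freeAct v a f) = L p f := by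
    intro a p f
    induction p using QuotientGroup.induction_on with | H b => ?_
    rw [← QuotientGroup.mk_mul, hL, hL, freeAct, FreeGroup.map.comp]
    refine DFunLike.congr_fun (congrArg FreeGroup.map (funext fun x => ?_)) f
    simp [proj_smul, smul_smul]
  let act : MulAction (RAAG Γ) ((RAAG Γ ⧸ N.toSubgroup) × I) :=
    { smul := fun a ω => ((ret Γ {v}ᶜ a : RAAG Γ) * ω.1,
        FreeGroup.lift σ (L ((ret Γ {v}ᶜ a : RAAG Γ) * ω.1) (word v a)) ω.2)
      one_smul := fun ω => by
        refine Prod.ext ?_ ?_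
        · change ((ret Γ {v}ᶜ (1 : RAAG Γ) : RAAG Γ) : RAAG Γ ⧸ N.toSubgroup) * ω.1 = _
          rw [map_one, QuotientGroup.mk_one, one_mul]
        · change FreeGroup.lift σ (L _ (word v 1)) ω.2 = ω.2
          rw [word_one, map_one, map_one]; rfl
      mul_smul := fun a b ω => by
        refine Prod.ext ?_ ?_
        · change ((ret Γ {v}ᶜ (a * b) : RAAG Γ) : RAAG Γ ⧸ N.toSubgroup) * ω.1 =
            (ret Γ {v}ᶜ a : RAAG Γ) * ((ret Γ {v}ᶜ b : RAAG Γ) * ω.1)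
          rw [map_mul, QuotientGroup.mk_mul, mul_assoc]
        · change FreeGroup.lift σ (L ((ret Γ {v}ᶜ (a * b) : RAAG Γ) * ω.1) (word v (a * b))) ω.2 =
            FreeGroup.lift σ (L ((ret Γ {v}ᶜ a : RAAG Γ) * ((ret Γ {v}ᶜ b : RAAG Γ) * ω.1))
              (word v a)) (FreeGroup.lift σ (L ((ret Γ {v}ᶜ b : RAAG Γ) * ω.1) (word v b)) ω.2)
          rw [word_mul, map_mul (ret Γ _), QuotientGroup.mk_mul, mul_assoc, map_mul (L _), hact,
            map_mul, Equiv.Perm.mul_apply] }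
  have hinv : ∀ (a : RAAG Γ) (p : RAAG Γ ⧸ N.toSubgroup) (i : I), a⁻¹ • ((p, i) : _ × I) =
      ((ret Γ {v}ᶜ a : RAAG Γ)⁻¹ * p, (FreeGroup.lift σ (L p (word v a)))⁻¹ i) := by
    intro a p i
    rw [inv_smul_eq_iff]
    refine Prod.ext ?_ ?_
    · change p = (ret Γ {v}ᶜ a : RAAG Γ) * (((ret Γ {v}ᶜ a : RAAG Γ) : RAAG Γ ⧸ N.toSubgroup)⁻¹ * p)
      rw [mul_inv_cancel_left]
    · change i = FreeGroup.lift σ (L ((ret Γ {v}ᶜ a : RAAG Γ) *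
        (((ret Γ {v}ᶜ a : RAAG Γ) : RAAG Γ ⧸ N.toSubgroup)⁻¹ * p)) (word v a))
        ((FreeGroup.lift σ (L p (word v a)))⁻¹ i)
      rw [mul_inv_cancel_left]
      exact (Equiv.Perm.inv_eq_iff_eq.1 rfl)
  refine ⟨(RAAG Γ ⧸ N.toSubgroup) × I, inferInstance, act, fun a ω => t (L ω.1 (word v a)) ω.2,
    fun i => (1, i), fun i j h => (Prod.ext_iff.1 h).2, ?_, ?_, ?_, ?_⟩
  · rintro a b ⟨p, i⟩
    rw [hinv]
    change t (L p (word v (a * b))) i = t (L p (word v a)) i +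
      t (L (((ret Γ {v}ᶜ a : RAAG Γ) : RAAG Γ ⧸ N.toSubgroup)⁻¹ * p) (word v b)) _
    rw [word_mul, map_mul, ht, ← hact a (_ * p), mul_inv_cancel_left]
  · rintro u hu ⟨p, i⟩
    have h1 := ht 1 1 i
    rw [mul_one, map_one, inv_one] at h1
    change t (L p (word v (gen Γ u))) i = 0
    rw [word_gen_of_ne hu, map_one]
    simpa using h1
  · intro a i
    change t (L 1 (word v a)) i = _
    rw [hL1]
  · intro a i ha
    have h1 : ((ret Γ {v}ᶜ a : RAAG Γ) : RAAG Γ ⧸ N.toSubgroup) * 1 = 1 := by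
      rw [mul_one]; exact (QuotientGroup.eq_one_iff _).2 ha
    refine Prod.ext h1 ?_
    change FreeGroup.lift σ (L ((ret Γ {v}ᶜ a : RAAG Γ) * 1) (word v a)) i = _
    rw [h1, hL1]

/-- A nontrivial word modulo `N` is excluded in a deep enough finite quotient. -/
theorem exists_notMem_of_word_eq (v : V) {N : FiniteIndexNormalSubgroup (RAAG Γ)}
    {f : FreeGroup (FinCosets v N)} (hf : f ≠ 1) :
    ∃ N' : FiniteIndexNormalSubgroup (RAAG Γ),
      ∀ a, FreeGroup.map (proj v N) (word v a) = f → a ∉ N' := by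
  obtain ⟨I, _, σ, t, i₀, ht, -, h0⟩ := FreeGroup.exists_cocycle_ne_zero hf
  obtain ⟨Ω, _, _, T, base, -, hT, -, hbase, -⟩ := exists_induced v σ ht
  obtain ⟨N', -, hN'⟩ := exists_mem_iff_dvd hT (ker (MulAction.toPermHom (RAAG Γ) Ω))
    (fun a ha ω => DFunLike.congr_fun (mem_ker.1 ha) ω) (Nat.succ_ne_zero (t f i₀).natAbs)
  refine ⟨N', fun a ha haN => ?_⟩
  have h1 := ((hN' a).1 haN).2 (base i₀)
  rw [hbase, ha] at h1
  have h2 := Nat.le_of_dvd (Int.natAbs_pos.2 h0) (Int.natAbs_dvd_natAbs.2 h1)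
  rw [Int.natAbs_natCast] at h2
  omega

end RAAG

namespace FreeGroup

/-- The set of letters of a word. -/
def letters {X : Type*} [DecidableEq X] (f : FreeGroup X) : Set X := {x | ∃ b, (x, b) ∈ f.toWord}

theorem finite_letters {X : Type*} [DecidableEq X] (f : FreeGroup X) : f.letters.Finite := by
  refine ((f.toWord.map Prod.fst).toFinset.finite_toSet).subset ?_
  rintro x ⟨b, hb⟩
  simpa only [List.coe_toFinset, List.mem_map, Set.mem_ofPred_eq] using ⟨_, hb, rfl⟩

theorem toWord_map_of_injOn {X Y : Type*} [DecidableEq X] [DecidableEq Y] {φ : X → Y}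
    {f : FreeGroup X} (hφ : Set.InjOn φ f.letters) :
    (FreeGroup.map φ f).toWord = f.toWord.map fun q => (φ q.1, q.2) := by
  have h1 : FreeGroup.map φ f = FreeGroup.mk (f.toWord.map fun q => (φ q.1, q.2)) := by
    rw [← FreeGroup.map.mk, FreeGroup.mk_toWord]
  rw [h1, FreeGroup.toWord_mk]
  exact (FreeGroup.IsReduced.map_of_injOn FreeGroup.isReduced_toWord hφ).reduce_eq

theorem map_ne_one_of_injOn {X Y : Type*} [DecidableEq X] {φ : X → Y}
    {f : FreeGroup X} (hf : f ≠ 1) (hφ : Set.InjOn φ f.letters) : FreeGroup.map φ f ≠ 1 := by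
  classical
  intro h
  have := toWord_map_of_injOn hφ
  rw [h, FreeGroup.toWord_one] at this
  exact hf (FreeGroup.toWord_eq_nil_iff.1 (List.map_eq_nil_iff.1 this.symm))

end FreeGroup

namespace RAAG

open FiniteIndexNormalSubgroup

universe u

variable {V : Type u} {Γ : SimpleGraph V}

theorem RetInv.mul_ret_inv_mem {N : FiniteIndexNormalSubgroup (RAAG Γ)} (hN : RetInv N) {T : Set V}
    {c l : RAAG Γ} (hl : ret Γ T l = l) (h : l⁻¹ * c ∈ N) : c * (ret Γ T c)⁻¹ ∈ N := by
  have h1 := N.conj_mem (mul_mem h (inv_mem (hN T _ h))) l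
  rw [map_mul, map_inv, hl] at h1
  convert h1 using 1
  group

theorem exists_proj_mk_ne_of [Finite V] (v : V) {g g' : RAAG Γ}
    (h : ∃ N : FiniteIndexNormalSubgroup (RAAG Γ),
      g⁻¹ * g' * (ret Γ (Γ.neighborSet v) (g⁻¹ * g'))⁻¹ ∉ N) :
    ∃ N, proj v N (g : Cosets Γ v) ≠ proj v N g' := by
  obtain ⟨M, hM⟩ := h
  obtain ⟨N, hNM, hN⟩ := exists_le_retInv M
  refine ⟨N, fun h => hM (hNM ?_)⟩
  obtain ⟨l, hl, h⟩ := mk_eq_mk_iff.1 h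
  exact hN.mul_ret_inv_mem (mem_link.1 hl) (by simpa [mul_assoc] using h)

theorem exists_injOn_of {v : V} {s : Set (Cosets Γ v)} (hs : s.Finite)
    (h : ∀ x ∈ s, ∀ y ∈ s, x ≠ y → ∃ N, proj v N x ≠ proj v N y)
    (M : FiniteIndexNormalSubgroup (RAAG Γ)) :
    ∃ N ≤ M, ∀ N' ≤ N, Set.InjOn (proj v N') s := by
  obtain ⟨N, hNM, hN⟩ := exists_forall_of_finite (s := s ×ˢ s) (hs.prod hs)
    (p := fun q N => q.1 ≠ q.2 → proj v N q.1 ≠ proj v N q.2)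
    (fun q N N' hle h hne h' => h hne (proj_eq_of_le hle h'))
    (fun q hq => by
      by_cases hne : q.1 = q.2
      · exact ⟨M, fun h => (h hne).elim⟩
      · obtain ⟨N, hN⟩ := h _ hq.1 _ hq.2 hne
        exact ⟨N, fun _ => hN⟩) M
  refine ⟨N, hNM, fun N' hle x hx y hy hxy => ?_⟩
  by_contra hne
  exact hN (x, y) ⟨hx, hy⟩ hne (proj_eq_of_le hle hxy)

/-- Right-angled Artin groups are residually finite. -/
theorem exists_notMem [Finite V] {a : RAAG Γ} (ha : a ≠ 1) :
    ∃ N : FiniteIndexNormalSubgroup (RAAG Γ), a ∉ N := by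
  suffices H : ∀ (S : Set V) (a : RAAG Γ), ret Γ S a = a → a ≠ 1 →
      ∃ N : FiniteIndexNormalSubgroup (RAAG Γ), a ∉ N from H _ a (ret_univ a) ha
  classical
  intro S
  refine WellFoundedLT.induction (motive := fun S : Set V => ∀ a, ret Γ S a = a → a ≠ 1 →
    ∃ N : FiniteIndexNormalSubgroup (RAAG Γ), a ∉ N) S fun S ih => ?_
  intro a haS ha
  obtain ⟨v, hv⟩ : S.Nonempty := by
    rw [Set.nonempty_iff_ne_empty]; rintro rfl
    rw [ret_empty] at haS; exact ha haS.symm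
  have hlt : S \ {v} < S := Set.sdiff_singleton_ssubset.2 hv
  by_cases hr : ret Γ {v}ᶜ a = 1
  · have hw : word v a ≠ 1 := fun h => ha (eq_of_word_eq v (by rw [h, word_one]) (by rw [hr, map_one]))
    have hlet : ∀ x ∈ (word v a).letters, cosetRet v (S \ {v}) x = x := by
      rintro x ⟨b, hb⟩
      exact FreeGroup.eq_of_mem_toWord_of_map_eq (by rw [← word_ret v hv, haS]) hb
    obtain ⟨N, -, hN⟩ := exists_injOn_of (word v a).finite_letters (fun x hx y hy hxy => by
      have hx1 := hlet x hx
      have hy1 := hlet y hy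
      obtain ⟨g, rfl⟩ := QuotientGroup.mk_surjective x
      obtain ⟨g', rfl⟩ := QuotientGroup.mk_surjective y
      rw [cosetRet_mk] at hx1 hy1
      rw [← hx1, ← hy1] at hxy ⊢
      refine exists_proj_mk_ne_of v (ih _ hlt _ ?_ fun h => hxy (QuotientGroup.eq.2 ?_))
      · rw [map_mul, map_inv, ret_comm, map_mul, map_inv, ret_ret_self, ret_ret_self]
      · rw [mul_inv_eq_one] at h
        exact mem_link.2 h.symm) (ker (1 : RAAG Γ →* Equiv.Perm Unit))
    obtain ⟨N', hN'⟩ := exists_notMem_of_word_eq v (FreeGroup.map_ne_one_of_injOn hw (hN N le_rfl))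
    exact ⟨N', hN' a rfl⟩
  · obtain ⟨N, hN⟩ := ih _ hlt (ret Γ {v}ᶜ a)
      (by rw [ret_ret, show S \ {v} ∩ {v}ᶜ = {v}ᶜ ∩ S by ext; simp; tauto, ← ret_ret, haS]) hr
    exact ⟨comap (ret Γ {v}ᶜ) N, hN⟩

theorem exists_proj_ne [Finite V] {v : V} {x y : Cosets Γ v} (h : x ≠ y) :
    ∃ N, proj v N x ≠ proj v N y := by
  obtain ⟨g, rfl⟩ := QuotientGroup.mk_surjective x
  obtain ⟨g', rfl⟩ := QuotientGroup.mk_surjective y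
  refine exists_proj_mk_ne_of v (exists_notMem fun h1 => h (QuotientGroup.eq.2 ?_))
  rw [mul_inv_eq_one] at h1
  exact mem_link.2 h1.symm

/-- Finite sets of cosets are separated in deep enough finite quotients. -/
theorem exists_injOn [Finite V] {v : V} {s : Set (Cosets Γ v)} (hs : s.Finite)
    (M : FiniteIndexNormalSubgroup (RAAG Γ)) : ∃ N ≤ M, ∀ N' ≤ N, Set.InjOn (proj v N') s :=
  exists_injOn_of hs (fun _ _ _ _ => exists_proj_ne) M

end RAAG

namespace RAAG

open FiniteIndexNormalSubgroup

universe u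

variable {V : Type u} {Γ : SimpleGraph V}

open Classical in
theorem exists_fox (Γ : SimpleGraph V) (v : V) : ∃ F : RAAG Γ → Cosets Γ v →₀ ℤ,
    (∀ a b, F (a * b) = F a + (F b).mapDomain (a • ·)) ∧
      ∀ u, F (gen Γ u) = if u = v then Finsupp.single ((1 : RAAG Γ) : Cosets Γ v) 1 else 0 := by
  have key : ∀ u w, Γ.Adj u w → u = v → Finsupp.single ((1 : RAAG Γ) : Cosets Γ v) (1 : ℤ) =
      (Finsupp.single ((1 : RAAG Γ) : Cosets Γ v) (1 : ℤ)).mapDomain (gen Γ w • ·) := by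
    rintro u w h rfl
    rw [Finsupp.mapDomain_single]
    congr 1
    refine QuotientGroup.eq.2 ?_
    simpa using gen_mem_link h
  refine exists_crossed (M := Multiplicative (Cosets Γ v →₀ ℤ))
    (fun a => (Finsupp.mapDomain.addMonoidHom (a • ·)).toMultiplicative) ?_ ?_ _ fun u w h => ?_
  · refine MonoidHom.ext fun m => ?_
    change Finsupp.mapDomain (fun x => (1 : RAAG Γ) • x) m = m
    simp only [one_smul]
    exact Finsupp.mapDomain_id
  · intro a b
    refine MonoidHom.ext fun m => ?_
    change Finsupp.mapDomain (fun x => (a * b) • x) m =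
      Finsupp.mapDomain (fun x => a • x) (Finsupp.mapDomain (fun x => b • x) m)
    have h : (fun x : Cosets Γ v => (a * b) • x) = (a • ·) ∘ (b • ·) :=
      funext fun x => mul_smul a b x
    rw [h]
    exact Finsupp.mapDomain_comp
  · change (if u = v then _ else 0) + Finsupp.mapDomain (gen Γ u • ·) (if w = v then _ else 0) =
      (if w = v then _ else 0) + Finsupp.mapDomain (gen Γ w • ·) (if u = v then _ else 0)
    by_cases hu : u = v
    · have hw : w ≠ v := by rintro rfl; exact Γ.ne_of_adj h hu
      simp only [hu, hw, if_true, if_false, Finsupp.mapDomain_zero, add_zero, zero_add]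
      exact key u w h hu
    · by_cases hw : w = v
      · simp only [hu, hw, if_true, if_false, Finsupp.mapDomain_zero, add_zero, zero_add]
        exact (key w u h.symm hw).symm
      · simp [hu, hw]

/-- The Fox derivative with respect to `v`, with values in the permutation module on the cosets of
the link of `v`. -/
noncomputable def fox (v : V) : RAAG Γ → Cosets Γ v →₀ ℤ := (exists_fox Γ v).choose

theorem fox_mul (v : V) (a b : RAAG Γ) : fox v (a * b) = fox v a + (fox v b).mapDomain (a • ·) :=
  (exists_fox Γ v).choose_spec.1 a b

theorem fox_gen_self (v : V) : fox v (gen Γ v) = Finsupp.single ((1 : RAAG Γ) : Cosets Γ v) 1 :=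
  ((exists_fox Γ v).choose_spec.2 v).trans (if_pos rfl)

theorem fox_gen_of_ne {v u : V} (h : u ≠ v) : fox v (gen Γ u) = 0 :=
  ((exists_fox Γ v).choose_spec.2 u).trans (if_neg h)

@[simp]
theorem fox_one (v : V) : fox v (1 : RAAG Γ) = 0 := by
  have := fox_mul v (1 : RAAG Γ) 1
  have h : (fun x : Cosets Γ v => (1 : RAAG Γ) • x) = id := funext fun x => one_smul _ x
  rw [h, Finsupp.mapDomain_id, mul_one] at this
  simpa using this

theorem fox_ret (v : V) {T : Set V} (hv : v ∈ T) (a : RAAG Γ) :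
    fox v (ret Γ T a) = (fox v a).mapDomain (cosetRet v T) := by
  refine PresentedGroup.crossed_ext (M := Multiplicative (Cosets Γ v →₀ ℤ))
    (α := fun a m => Finsupp.mapDomain (fun x => ret Γ T a • x) m) ?_
    (F := fun a => fox v (ret Γ T a))
    (F' := fun a => (fox v a).mapDomain (cosetRet v T)) ?_ ?_ ?_ a
  · intro m
    simp only [map_one, one_smul]
    exact Finsupp.mapDomain_id
  · intro a b
    simp only [map_mul, fox_mul]; rfl
  · intro a b
    simp only [fox_mul]
    rw [Finsupp.mapDomain_add, ← Finsupp.mapDomain_comp]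
    refine congrArg (Finsupp.mapDomain (cosetRet v T) (fox v a) + ·) ?_
    change _ = Finsupp.mapDomain (fun x => ret Γ T a • x) (Finsupp.mapDomain (cosetRet v T) (fox v b))
    rw [← Finsupp.mapDomain_comp]
    congr 1
    exact funext fun x => cosetRet_smul v T a x
  · intro u
    change fox v (ret Γ T (gen Γ u)) = Finsupp.mapDomain (cosetRet v T) (fox v (gen Γ u))
    by_cases hu : u = v
    · subst hu
      rw [ret_gen_of_mem hv, fox_gen_self, Finsupp.mapDomain_single, cosetRet_mk, map_one]
    · rw [fox_gen_of_ne hu, Finsupp.mapDomain_zero]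
      by_cases hT : u ∈ T
      · rw [ret_gen_of_mem hT, fox_gen_of_ne hu]
      · rw [ret_gen_of_notMem hT, fox_one]

/-- The Fox derivative modulo a finite index normal subgroup. -/
noncomputable def foxMod (v : V) (N : FiniteIndexNormalSubgroup (RAAG Γ)) (a : RAAG Γ)
    (y : FinCosets v N) : ℤ := (fox v a).mapDomain (proj v N) y

theorem exists_mem_support_of_foxMod_ne_zero {v : V} {N : FiniteIndexNormalSubgroup (RAAG Γ)}
    {a : RAAG Γ} {y : FinCosets v N} (h : foxMod v N a y ≠ 0) :
    ∃ x ∈ (fox v a).support, proj v N x = y := by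
  classical
  have := Finsupp.mapDomain_support (Finsupp.mem_support_iff.2 h)
  simpa using this

theorem foxMod_mul (v : V) (N : FiniteIndexNormalSubgroup (RAAG Γ)) (a b : RAAG Γ)
    (y : FinCosets v N) : foxMod v N (a * b) y = foxMod v N a y + foxMod v N b (a⁻¹ • y) := by
  rw [foxMod, fox_mul, Finsupp.mapDomain_add, Finsupp.add_apply, ← Finsupp.mapDomain_comp]
  congr 1
  have : proj v N ∘ (fun x => a • x) = (fun y => a • y) ∘ proj v N :=
    funext fun x => proj_smul v N a x
  rw [this, Finsupp.mapDomain_comp]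
  conv_lhs => rw [← smul_inv_smul a y]
  exact Finsupp.mapDomain_apply (MulAction.injective a) _ _

@[simp]
theorem foxMod_one (v : V) (N : FiniteIndexNormalSubgroup (RAAG Γ)) (y : FinCosets v N) :
    foxMod v N 1 y = 0 := by simp [foxMod]

theorem foxMod_gen_of_ne {v u : V} (h : u ≠ v) (N : FiniteIndexNormalSubgroup (RAAG Γ))
    (y : FinCosets v N) : foxMod v N (gen Γ u) y = 0 := by simp [foxMod, fox_gen_of_ne h]

/-- The elements of `N` whose Fox derivative vanishes modulo `m`. -/
theorem exists_mem_iff_dvd_foxMod (v : V) (N : FiniteIndexNormalSubgroup (RAAG Γ)) {m : ℕ}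
    (hm : m ≠ 0) : ∃ N' ≤ N, ∀ a, a ∈ N' ↔ a ∈ N ∧ ∀ y, (m : ℤ) ∣ foxMod v N a y :=
  exists_mem_iff_dvd (foxMod_mul v N) N (fun _ ha y => smul_eq_of_mem ha y) hm

theorem foxMod_conj {v : V} {N : FiniteIndexNormalSubgroup (RAAG Γ)} {w : RAAG Γ} (hw : w ∈ N)
    (g : RAAG Γ) (y : FinCosets v N) :
    foxMod v N (g * w * g⁻¹) y = foxMod v N w (g⁻¹ • y) := by
  have h1 : foxMod v N (g * w) y = foxMod v N (g * w * g⁻¹ * g) y := by rw [inv_mul_cancel_right]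
  rw [foxMod_mul v N (g * w * g⁻¹), smul_eq_of_mem (inv_mem (N.conj_mem hw g)), foxMod_mul] at h1
  linarith

section Universal

variable {Ω : Type*} [MulAction (RAAG Γ) Ω] {T : RAAG Γ → Ω → ℤ}

theorem cocycle_one (hT : ∀ a b ω, T (a * b) ω = T a ω + T b (a⁻¹ • ω)) (ω : Ω) : T 1 ω = 0 := by
  have := hT 1 1 ω
  simpa using this

theorem cocycle_inv (hT : ∀ a b ω, T (a * b) ω = T a ω + T b (a⁻¹ • ω)) (a : RAAG Γ) (ω : Ω) :
    T a⁻¹ ω = - T a (a • ω) := by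
  have := hT a⁻¹ a ω
  rw [inv_mul_cancel, cocycle_one hT, inv_inv] at this
  linarith

theorem cocycle_ret {v : V} (hT : ∀ a b ω, T (a * b) ω = T a ω + T b (a⁻¹ • ω))
    (hv : ∀ u ≠ v, ∀ ω, T (gen Γ u) ω = 0) {S : Set V} (hS : v ∉ S) (a : RAAG Γ) (ω : Ω) :
    T (ret Γ S a) ω = 0 := by
  induction a using gen_induction generalizing ω with
  | gen u =>
    by_cases hu : u ∈ S
    · rw [ret_gen_of_mem hu]; exact hv u (fun h => hS (h ▸ hu)) ω
    · rw [ret_gen_of_notMem hu]; exact cocycle_one hT ω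
  | one => rw [map_one]; exact cocycle_one hT ω
  | mul a b ha hb => rw [map_mul, hT, ha, hb, add_zero]
  | inv a ha => rw [map_inv, cocycle_inv hT, ha, neg_zero]

/-- The Fox derivative modulo `N` is the universal cocycle among those factoring through `N` and
vanishing on the generators different from `v`. -/
theorem dvd_cocycle_of_dvd_foxMod {v : V} {N : FiniteIndexNormalSubgroup (RAAG Γ)}
    (hT : ∀ a b ω, T (a * b) ω = T a ω + T b (a⁻¹ • ω))
    (hv : ∀ u ≠ v, ∀ ω, T (gen Γ u) ω = 0) (hN : ∀ a ∈ N, ∀ ω : Ω, a • ω = ω)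
    {m : ℤ} {a : RAAG Γ} (ha : ∀ y, m ∣ foxMod v N a y) (ω : Ω) : m ∣ T a ω := by
  have := Fintype.ofFinite (FinCosets v N)
  have hlink : ∀ l ∈ link Γ v, ∀ ω, T (gen Γ v) (l⁻¹ • ω) = T (gen Γ v) ω := by
    intro l hl ω
    have h0 : ∀ ω, T l ω = 0 := fun ω => by
      rw [← ret_compl_of_mem_link hl]; exact cocycle_ret hT hv (by simp) l ω
    have h1 := hT l (gen Γ v) ω
    rw [← (gen_commute_link hl).eq, hT, h0, h0] at h1
    linarith
  have hwd : ∀ (g g' : RAAG Γ), (g : FinCosets v N) = g' → ∀ ω,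
      T (gen Γ v) (g⁻¹ • ω) = T (gen Γ v) (g'⁻¹ • ω) := by
    intro g g' h ω
    obtain ⟨l, hl, hn⟩ := mk_eq_mk_iff.1 h
    rw [← hlink l hl (g⁻¹ • ω), smul_smul, ← mul_inv_rev, ← hN _ (inv_mem hn) ((g * l)⁻¹ • ω),
      smul_smul]
    congr 2
    group
  have key : ∀ a : RAAG Γ, (fun ω => T a ω) =
      fun ω => ∑ y : FinCosets v N, foxMod v N a y * T (gen Γ v) (y.out⁻¹ • ω) := by
    intro a
    refine PresentedGroup.crossed_ext (M := Multiplicative (Ω → ℤ))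
      (α := fun a m => fun ω => m (a⁻¹ • ω)) ?_ (F := fun a => fun ω => T a ω)
      (F' := fun a => fun ω => ∑ y : FinCosets v N, foxMod v N a y * T (gen Γ v) (y.out⁻¹ • ω))
      ?_ ?_ ?_ a
    · intro m
      funext ω
      simp
    · intro a b
      exact funext fun ω => hT a b ω
    · intro a b
      funext ω
      change _ = (∑ y : FinCosets v N, foxMod v N a y * T (gen Γ v) (y.out⁻¹ • ω)) +
        ∑ y : FinCosets v N, foxMod v N b y * T (gen Γ v) (y.out⁻¹ • a⁻¹ • ω)
      simp only [foxMod_mul, add_mul, Finset.sum_add_distrib]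
      congr 1
      rw [← Equiv.sum_comp (MulAction.toPerm a)]
      refine Finset.sum_congr rfl fun y _ => ?_
      change foxMod v N b (a⁻¹ • a • y) * T (gen Γ v) ((a • y).out⁻¹ • ω) = _
      rw [inv_smul_smul, smul_smul, ← mul_inv_rev]
      congr 1
      refine hwd _ _ ?_ ω
      rw [QuotientGroup.out_eq']
      conv_lhs => rw [← QuotientGroup.out_eq' y]
      rfl
    · intro u
      funext ω
      change T (gen Γ u) ω = ∑ y : FinCosets v N, foxMod v N (gen Γ u) y * T (gen Γ v) (y.out⁻¹ • ω)
      by_cases hu : u = v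
      · subst hu
        rw [Finset.sum_eq_single ((1 : RAAG Γ) : FinCosets u N)]
        · have h1 : foxMod u N (gen Γ u) ((1 : RAAG Γ) : FinCosets u N) = 1 := by
            rw [foxMod, fox_gen_self, Finsupp.mapDomain_single, proj_mk, Finsupp.single_eq_same]
          rw [h1, one_mul, hwd _ 1 (QuotientGroup.out_eq' _), inv_one, one_smul]
        · intro y _ hy
          rw [foxMod, fox_gen_self, Finsupp.mapDomain_single, proj_mk,
            Finsupp.single_eq_of_ne hy, zero_mul]
        · simp
      · rw [hv u hu]
        simp [foxMod_gen_of_ne hu]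
  rw [congrFun (key a) ω]
  exact Finset.dvd_sum fun y _ => (ha y).mul_right _

end Universal

end RAAG

namespace RAAG

open FiniteIndexNormalSubgroup

universe u

variable {V : Type u} {Γ : SimpleGraph V}

theorem ret_compl_letter {v : V} {a : RAAG Γ} {p : Cosets Γ v × Bool}
    [DecidableEq (Cosets Γ v)] (hp : p ∈ (word v a).toWord) : cosetRet v {v}ᶜ p.1 = p.1 := by
  refine FreeGroup.eq_of_mem_toWord_of_map_eq ?_ hp
  have := word_ret v (Set.mem_univ v) a
  rw [ret_univ, ← Set.compl_eq_univ_sdiff] at this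
  exact this.symm

theorem exists_word_eq_mk {v : V} {x : Cosets Γ v} (hx : cosetRet v {v}ᶜ x = x) (b : Bool) :
    ∃ y : RAAG Γ, ret Γ {v}ᶜ y = 1 ∧ word v y = FreeGroup.mk [(x, b)] := by
  obtain ⟨g, rfl⟩ := QuotientGroup.mk_surjective x
  rw [cosetRet_mk] at hx
  have hB : ret Γ {v}ᶜ (ret Γ {v}ᶜ g) = ret Γ {v}ᶜ g := ret_ret_self _ _
  have h1 : ret Γ {v}ᶜ (gen Γ v) = 1 := ret_gen_of_notMem (by simp)
  have hy : word v (ret Γ {v}ᶜ g * gen Γ v * (ret Γ {v}ᶜ g)⁻¹) = FreeGroup.mk [((g : Cosets Γ v), true)] := by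
    rw [word_mul, word_mul, word_eq_one v hB, word_gen_self, one_mul, ← map_inv (ret Γ {v}ᶜ) g,
      word_eq_one v (ret_ret_self _ _), map_one, mul_one, freeAct_of, hB]
    change FreeGroup.of ((ret Γ {v}ᶜ g * 1 : RAAG Γ) : Cosets Γ v) = _
    rw [mul_one, hx]; rfl
  have hr : ret Γ {v}ᶜ (ret Γ {v}ᶜ g * gen Γ v * (ret Γ {v}ᶜ g)⁻¹) = 1 := by
    rw [map_mul, map_mul, h1, map_inv]; group
  cases b with
  | true => exact ⟨_, hr, hy⟩
  | false =>
    refine ⟨_⁻¹, by rw [map_inv, hr, inv_one], ?_⟩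
    rw [word_inv, hy, freeAct_eq_id (by rw [map_inv, hr, inv_one])]
    rfl

/-- An element with shortest `v`-word in its conjugacy class is cyclically reduced with respect to
`v`. -/
theorem snd_eq_of_minimal {v : V} [DecidableEq (Cosets Γ v)] {w : RAAG Γ}
    (hmin : ∀ g, (word v w).toWord.length ≤ (word v (g * w * g⁻¹)).toWord.length)
    {p q : Cosets Γ v × Bool} (hp : p ∈ (word v w).toWord.getLast?)
    (hq : q ∈ (word v w).toWord.head?) (h : p.1 = ret Γ {v}ᶜ w • q.1) : p.2 = q.2 := by
  by_contra hne
  have hpq : p = (ret Γ {v}ᶜ w • q.1, !q.2) := Prod.ext h (by cases hp2 : p.2 <;> cases hq2 : q.2 <;> simp_all)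
  obtain ⟨L, hL⟩ : ∃ L, (word v w).toWord = q :: L := by
    cases hW : (word v w).toWord with
    | nil => rw [hW] at hq; simp at hq
    | cons a L => rw [hW] at hq; exact ⟨L, by simp at hq; rw [hq]⟩
  rcases List.eq_nil_or_concat L with rfl | ⟨L', p', rfl⟩
  · rw [hL] at hp
    simp at hp
    exact hne (by rw [hp])
  · rw [hL] at hp
    have hp' : p' = p := by
      rw [List.concat_eq_append, ← List.cons_append, List.getLast?_append_of_ne_nil _ (by simp)] at hp
      simpa using hp
    obtain ⟨y, hy, hwy⟩ := exists_word_eq_mk (v := v) (x := q.1)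
      (ret_compl_letter (a := w) (p := q) (by rw [hL]; simp)) q.2
    have hy' : ret Γ {v}ᶜ y⁻¹ = 1 := by rw [map_inv, hy, inv_one]
    have hW : word v (y⁻¹ * w * y⁻¹⁻¹) = FreeGroup.mk L' := by
      rw [inv_inv, word_mul, word_mul, word_inv, freeAct_eq_id hy', hwy, ← FreeGroup.mk_toWord (x := word v w),
        hL, freeAct, FreeGroup.map.mk, map_mul, hy', one_mul, hp', hpq]
      simp only [MonoidHom.id_apply, FreeGroup.inv_mk, FreeGroup.mul_mk]
      apply FreeGroup.Red.exact.2
      refine ⟨L', ?_, .refl⟩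
      refine Relation.ReflTransGen.trans (b := L' ++ [(ret Γ {v}ᶜ w • q.1, !q.2), (ret Γ {v}ᶜ w • q.1, q.2)]) ?_ ?_
      · refine FreeGroup.Red.Step.to_red ?_
        simpa [FreeGroup.invRev] using FreeGroup.Red.Step.not (L₁ := []) (x := q.1) (b := !q.2)
          (L₂ := L' ++ [(ret Γ {v}ᶜ w • q.1, !q.2), (ret Γ {v}ᶜ w • q.1, q.2)])
      · refine FreeGroup.Red.Step.to_red ?_
        simpa using FreeGroup.Red.Step.not (L₁ := L') (x := ret Γ {v}ᶜ w • q.1) (b := !q.2) (L₂ := [])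
    have h1 := hmin y⁻¹
    rw [hW, hL, FreeGroup.toWord_mk] at h1
    have h2 : (FreeGroup.reduce L').length ≤ L'.length := FreeGroup.Red.sublist FreeGroup.reduce.red |>.length_le
    simp at h1
    omega

theorem map_proj_freeAct (v : V) (N : FiniteIndexNormalSubgroup (RAAG Γ)) (a : RAAG Γ)
    (f : FreeGroup (Cosets Γ v)) : FreeGroup.map (proj v N) (freeAct v a f) =
      FreeGroup.map (ret Γ {v}ᶜ a • ·) (FreeGroup.map (proj v N) f) := by
  rw [freeAct, FreeGroup.map.comp, FreeGroup.map.comp]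
  exact DFunLike.congr_fun (congrArg FreeGroup.map (funext fun x => proj_smul v N _ x)) f

theorem exists_map_word_pow_ne_one [Finite V] {v : V} {w : RAAG Γ} (hw : word v w ≠ 1)
    (hcyc : ∀ [DecidableEq (Cosets Γ v)] (p q : Cosets Γ v × Bool), p ∈ (word v w).toWord.getLast? →
      q ∈ (word v w).toWord.head? → p.1 = ret Γ {v}ᶜ w • q.1 → p.2 = q.2) :
    ∃ N : FiniteIndexNormalSubgroup (RAAG Γ), ∀ r : ℕ,
      FreeGroup.map (proj v N) (word v (w ^ (r + 1))) ≠ 1 := by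
  classical
  obtain ⟨N, -, hN⟩ := exists_injOn
    ((word v w).finite_letters.union ((word v w).finite_letters.image (ret Γ {v}ᶜ w • ·)))
    (ker (1 : RAAG Γ →* Equiv.Perm Unit))
  replace hN := hN N le_rfl
  set L := (word v w).toWord.map fun q => (proj v N q.1, q.2) with hLdef
  have hL : FreeGroup.map (proj v N) (word v w) = FreeGroup.mk L := by
    rw [hLdef, ← FreeGroup.map.mk, FreeGroup.mk_toWord]
  have hLred : FreeGroup.IsReduced L :=
    FreeGroup.IsReduced.map_of_injOn FreeGroup.isReduced_toWord (hN.mono Set.subset_union_left)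
  have hLne : L ≠ [] := by
    intro h
    rw [hLdef, List.map_eq_nil_iff, FreeGroup.toWord_eq_nil_iff] at h
    exact hw h
  have key : ∀ r : ℕ, ∃ K, FreeGroup.map (proj v N) (word v (w ^ (r + 1))) = FreeGroup.mk (L ++ K) ∧
      FreeGroup.IsReduced (L ++ K) := by
    intro r
    induction r with
    | zero => exact ⟨[], by simp [hL], by simpa using hLred⟩
    | succ r ih =>
      obtain ⟨K, hK, hKr⟩ := ih
      refine ⟨(L ++ K).map fun q => (ret Γ {v}ᶜ w • q.1, q.2), ?_, ?_⟩
      · rw [pow_succ', word_mul, map_mul, map_proj_freeAct, hK, hL, FreeGroup.map.mk,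
          FreeGroup.mul_mk]
      · unfold FreeGroup.IsReduced
        rw [List.isChain_append]
        refine ⟨hLred, FreeGroup.IsReduced.map_of_injOn hKr (MulAction.injective _).injOn, ?_⟩
        intro p hp q hq hpq
        rw [List.head?_map, List.head?_append_of_ne_nil _ hLne] at hq
        rw [hLdef, List.getLast?_map, Option.mem_map] at hp
        obtain ⟨p', hp', rfl⟩ := hp
        rw [Option.mem_map] at hq
        obtain ⟨q₁, hq₁, rfl⟩ := hq
        rw [hLdef, List.head?_map, Option.mem_map] at hq₁
        obtain ⟨q', hq', rfl⟩ := hq₁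
        refine hcyc p' q' hp' hq' (hN ?_ ?_ ?_)
        · exact Or.inl ⟨p'.2, List.mem_of_mem_getLast? hp'⟩
        · exact Or.inr ⟨q'.1, ⟨q'.2, List.mem_of_mem_head? hq'⟩, rfl⟩
        · rw [proj_smul]; exact hpq
  refine ⟨N, fun r h => ?_⟩
  obtain ⟨K, hK, hKr⟩ := key r
  rw [hK] at h
  have h2 := congrArg FreeGroup.toWord h
  rw [FreeGroup.toWord_mk, hKr.reduce_eq, FreeGroup.toWord_one] at h2
  exact hLne (List.append_eq_nil_iff.1 h2).1

theorem foxMod_pow {v : V} {N : FiniteIndexNormalSubgroup (RAAG Γ)} {a : RAAG Γ} (ha : a ∈ N)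
    (n : ℕ) (y : FinCosets v N) : foxMod v N (a ^ n) y = n * foxMod v N a y := by
  induction n with
  | zero => simp
  | succ n ih =>
    rw [pow_succ', foxMod_mul, smul_eq_of_mem (inv_mem ha), ih]; push_cast; ring

theorem cocycle_pow {Ω : Type*} [MulAction (RAAG Γ) Ω] {T : RAAG Γ → Ω → ℤ}
    (hT : ∀ a b ω, T (a * b) ω = T a ω + T b (a⁻¹ • ω)) {a : RAAG Γ} {ω : Ω} (ha : a • ω = ω)
    (n : ℕ) : T (a ^ n) ω = n * T a ω := by
  induction n with
  | zero => rw [pow_zero, cocycle_one hT]; simp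
  | succ n ih =>
    rw [pow_succ', hT, inv_smul_eq_iff.2 ha.symm, ih]; push_cast; ring

/-- If `z` is not conjugate into the subgroup generated by the vertices different from `v`, then
the Fox derivatives of its powers do not vanish modulo small finite index subgroups. -/
theorem exists_foxMod_pow_ne_zero [Finite V] {v : V} {z : RAAG Γ}
    (hz : ∀ g, ret Γ {v}ᶜ (g * z * g⁻¹) ≠ g * z * g⁻¹) (M : FiniteIndexNormalSubgroup (RAAG Γ)) :
    ∃ N ≤ M, ∀ N' ≤ N, ∀ r : ℕ, r ≠ 0 → z ^ r ∈ N' → ∃ y, foxMod v N' (z ^ r) y ≠ 0 := by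
  classical
  obtain ⟨g, hg⟩ : ∃ g, ∀ g', (word v (g * z * g⁻¹)).toWord.length ≤
      (word v (g' * z * g'⁻¹)).toWord.length := by
    obtain ⟨g, -, hg⟩ := WellFounded.has_min (measure fun g => (word v (g * z * g⁻¹)).toWord.length).wf
      Set.univ ⟨1, trivial⟩
    exact ⟨g, fun g' => not_lt.1 (hg g' trivial)⟩
  set w := g * z * g⁻¹ with hwdef
  have hw : word v w ≠ 1 := by
    intro h
    refine hz g (eq_of_word_eq v ?_ (ret_ret_self _ _))
    rw [← hwdef, h, word_ret_of_notMem v (by simp)]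
  obtain ⟨P, hP⟩ := exists_map_word_pow_ne_one hw (fun [_] p q hp hq h => by
    refine snd_eq_of_minimal (w := w) (fun g' => ?_) hp hq h
    have := hg (g' * g)
    convert this using 4
    rw [hwdef]; group)
  obtain ⟨r₀, hr₀, hr⟩ := P.exists_pow_mem (ret Γ {v}ᶜ w)
  obtain ⟨I, _, σ, t, i₀, ht, hfix, h0⟩ := FreeGroup.exists_cocycle_ne_zero (hP (r₀ - 1))
  rw [Nat.sub_add_cancel hr₀] at hfix h0
  obtain ⟨Ω, _, _, T, base, -, hT, hTv, hbase, hact⟩ := exists_induced v σ ht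
  have hfix' : w ^ r₀ • base i₀ = base i₀ := by
    rw [hact _ _ (by rw [map_pow]; exact hr), hfix]
  refine ⟨M ⊓ ker (MulAction.toPermHom (RAAG Γ) Ω), inf_le_left, fun N' hN' r hr0 hzr => ?_⟩
  by_contra! hzero
  have hwr : w ^ r = g * z ^ r * g⁻¹ := conj_pow
  have hwr' : w ^ r ∈ N' := hwr ▸ N'.conj_mem hzr g
  have h1 : ∀ y, foxMod v N' ((w ^ r) ^ r₀) y = 0 := by
    intro y
    rw [foxMod_pow hwr', hwr, foxMod_conj hzr, hzero, mul_zero]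
  have h2 : (0 : ℤ) ∣ T ((w ^ r) ^ r₀) (base i₀) :=
    dvd_cocycle_of_dvd_foxMod hT hTv
      (fun a ha ω => DFunLike.congr_fun (mem_ker.1 (hN' ha).2) ω) (fun y => by rw [h1]) _
  rw [zero_dvd_iff, ← pow_mul, mul_comm, pow_mul, cocycle_pow hT hfix', hbase] at h2
  rcases mul_eq_zero.1 h2 with h | h
  · exact hr0 (by exact_mod_cast h)
  · exact h0 h

end RAAG

namespace FiniteIndexNormalSubgroup

variable {G : Type*} [Group G]

/-- The quotient homomorphism. -/
abbrev quot (N : FiniteIndexNormalSubgroup G) : G →* G ⧸ N.toSubgroup := QuotientGroup.mk' N.toSubgroup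

theorem quot_eq_one {N : FiniteIndexNormalSubgroup G} {a : G} : quot N a = 1 ↔ a ∈ N :=
  QuotientGroup.eq_one_iff a

theorem quot_eq {N : FiniteIndexNormalSubgroup G} {a b : G} : quot N a = quot N b ↔ a⁻¹ * b ∈ N :=
  QuotientGroup.eq

theorem quot_eq_of_le {N N' : FiniteIndexNormalSubgroup G} (h : N' ≤ N) {a b : G}
    (hab : quot N' a = quot N' b) : quot N a = quot N b :=
  quot_eq.2 (h (quot_eq.1 hab))

end FiniteIndexNormalSubgroup

namespace RAAG

open FiniteIndexNormalSubgroup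

universe u

variable {V : Type u} {Γ : SimpleGraph V}

theorem RetInv.quot_eq {N : FiniteIndexNormalSubgroup (RAAG Γ)} (hN : RetInv N) (T : Set V)
    {a b : RAAG Γ} (h : quot N a = quot N b) : quot N (ret Γ T a) = quot N (ret Γ T b) := by
  rw [FiniteIndexNormalSubgroup.quot_eq] at *
  rw [← map_inv, ← map_mul]
  exact hN T _ h

/-- A twisted conjugacy equation `x * k = k' * ret T x` in the unknown `x`. -/
structure Eqn (Γ : SimpleGraph V) where
  /-- the vertices kept by the retraction -/
  T : Set V
  /-- the right coefficient -/
  k : RAAG Γ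
  /-- the left coefficient -/
  k' : RAAG Γ

namespace Eqn

/-- `x` solves the equation. -/
def Solves (x : RAAG Γ) (τ : Eqn Γ) : Prop := x * τ.k = τ.k' * ret Γ τ.T x

/-- `x` solves the equation modulo `N`. -/
def Approx (N : FiniteIndexNormalSubgroup (RAAG Γ)) (x : RAAG Γ) (τ : Eqn Γ) : Prop :=
  quot N (x * τ.k) = quot N (τ.k' * ret Γ τ.T x)

theorem Approx.mono {N N' : FiniteIndexNormalSubgroup (RAAG Γ)} (h : N' ≤ N) {x : RAAG Γ}
    {τ : Eqn Γ} (hx : τ.Approx N' x) : τ.Approx N x := quot_eq_of_le h hx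

/-- The systems to which the approximation theorem applies. -/
def Admissible (S : Set V) (sys : Set (Eqn Γ)) : Prop :=
  (∀ τ ∈ sys, ¬ S ⊆ τ.T → ret Γ (τ.T ∩ S) τ.k = 1 ∧ ret Γ (τ.T ∩ S) τ.k' = 1) ∧
  ∀ τ ∈ sys, ∀ τ₂ ∈ sys, S ⊆ τ.T → S ⊆ τ₂.T → Commute (ret Γ S τ.k) (ret Γ S τ₂.k)

/-- Approximate solutions in `A(S)` of the system are close to solutions. -/
def Approximable (S : Set V) (sys : Set (Eqn Γ)) : Prop :=
  ∀ M : FiniteIndexNormalSubgroup (RAAG Γ), ∃ N : FiniteIndexNormalSubgroup (RAAG Γ), ∀ x,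
    ret Γ S x = x → (∀ τ ∈ sys, τ.Approx N x) →
    ∃ a, ret Γ S a = a ∧ (∀ τ ∈ sys, τ.Solves a) ∧ a⁻¹ * x ∈ M

/-- The equation expressing that `x * g` and `g'` lie in the same coset of the link of `v`. -/
noncomputable def ofCoset (v : V) (g g' : RAAG Γ) : Eqn Γ where
  T := Γ.neighborSet v
  k := g * (ret Γ (Γ.neighborSet v) g)⁻¹
  k' := g' * (ret Γ (Γ.neighborSet v) g')⁻¹

theorem ret_ofCoset_k (v : V) (g g' : RAAG Γ) : ret Γ (Γ.neighborSet v) (ofCoset v g g').k = 1 := by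
  rw [ofCoset, map_mul, map_inv, ret_ret_self, mul_inv_cancel]

theorem ret_ofCoset_k' (v : V) (g g' : RAAG Γ) : ret Γ (Γ.neighborSet v) (ofCoset v g g').k' = 1 := by
  rw [ofCoset, map_mul, map_inv, ret_ret_self, mul_inv_cancel]

theorem ofCoset_solves {v : V} {g g' x : RAAG Γ} (h : (ofCoset v g g').Solves x) :
    x • (g : Cosets Γ v) = g' := by
  change x * (g * (ret Γ (Γ.neighborSet v) g)⁻¹) =
    g' * (ret Γ (Γ.neighborSet v) g')⁻¹ * ret Γ (Γ.neighborSet v) x at h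
  refine (QuotientGroup.eq.2 ?_).symm
  change g'⁻¹ * (x * g) ∈ link Γ v
  have h1 : g'⁻¹ * (x * g) = (ret Γ (Γ.neighborSet v) g')⁻¹ * ret Γ (Γ.neighborSet v) x *
      ret Γ (Γ.neighborSet v) g := by
    generalize ret Γ (Γ.neighborSet v) g = rg at *
    have h2 : x * g = x * (g * rg⁻¹) * rg := by group
    rw [h2, h]; group
  rw [h1, ← map_inv, ← map_mul, ← map_mul]
  exact mem_link.2 (ret_ret_self _ _)

theorem approx_ofCoset {v : V} {g g' x : RAAG Γ} {N : FiniteIndexNormalSubgroup (RAAG Γ)}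
    (hN : RetInv N) (h : x • (g : FinCosets v N) = g') : (ofCoset v g g').Approx N x := by
  change ((x * g : RAAG Γ) : FinCosets v N) = g' at h
  obtain ⟨l, hl, h⟩ := mk_eq_mk_iff.1 h.symm
  have h1 := hN.mul_ret_inv_mem (mem_link.1 hl) (c := g'⁻¹ * (x * g)) (by simpa [mul_assoc] using h)
  rw [← quot_eq_one] at h1
  simp only [map_mul, map_inv] at h1
  change quot N (x * (g * (ret Γ (Γ.neighborSet v) g)⁻¹)) =
    quot N (g' * (ret Γ (Γ.neighborSet v) g')⁻¹ * ret Γ (Γ.neighborSet v) x)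
  simp only [map_mul, map_inv]
  generalize quot N (ret Γ (Γ.neighborSet v) x) = rx at *
  generalize quot N (ret Γ (Γ.neighborSet v) g) = rg at *
  generalize quot N (ret Γ (Γ.neighborSet v) g') = rg' at *
  rw [mul_inv_eq_one, inv_mul_eq_iff_eq_mul] at h1
  rw [← mul_assoc, h1]
  group

end Eqn

/-- Comparison of words modulo small subgroups. -/
theorem exists_toWord_eq [Finite V] (v : V) [DecidableEq (Cosets Γ v)] (k k' : RAAG Γ)
    (M : FiniteIndexNormalSubgroup (RAAG Γ)) :
    ∃ N₁ ≤ M, RetInv N₁ ∧ ∃ N : FiniteIndexNormalSubgroup (RAAG Γ), ∀ y y',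
      ret Γ {v}ᶜ y = y → ret Γ {v}ᶜ y' = y' → quot N (y * k) = quot N (k' * y') →
      (word v k).toWord.map (fun q => (y • proj v N₁ q.1, q.2)) =
        (word v k').toWord.map fun q => (proj v N₁ q.1, q.2) := by
  classical
  obtain ⟨N₀, hN₀, hinj⟩ := exists_injOn ((word v k).finite_letters) M
  obtain ⟨N₀', hN₀', hinj'⟩ := exists_injOn ((word v k').finite_letters) N₀
  obtain ⟨N₁, hN₁, hret⟩ := exists_le_retInv N₀'
  refine ⟨N₁, hN₁.trans (hN₀'.trans hN₀), hret, ?_⟩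
  have hfin : (Set.range fun φ : FinCosets v N₁ → FinCosets v N₁ =>
      FreeGroup.map φ (FreeGroup.map (proj v N₁) (word v k)) *
        (FreeGroup.map (proj v N₁) (word v k'))⁻¹).Finite := Set.finite_range _
  obtain ⟨N, hN, hNf⟩ := exists_forall_of_finite hfin
    (p := fun f N => f ≠ 1 → ∀ a, FreeGroup.map (proj v N₁) (word v a) = f → a ∉ N)
    (fun f N N' hle h hf a ha haN => h hf a ha (hle haN))
    (fun f _ => by
      by_cases hf : f = 1
      · exact ⟨M, fun h => (h hf).elim⟩
      · obtain ⟨N, hN⟩ := exists_notMem_of_word_eq v hf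
        exact ⟨N, fun _ => hN⟩) N₁
  refine ⟨N, fun y y' hy hy' h => ?_⟩
  have hmem : y * k * y'⁻¹ * k'⁻¹ ∈ N := by
    rw [← quot_eq_one]
    simp only [map_mul, map_inv] at h ⊢
    rw [h]; group
  have hw : FreeGroup.map (proj v N₁) (word v (y * k * y'⁻¹ * k'⁻¹)) =
      FreeGroup.map (y • ·) (FreeGroup.map (proj v N₁) (word v k)) *
        (FreeGroup.map (proj v N₁) (word v k'))⁻¹ := by
    have h1 : word v (y * k * y'⁻¹ * k'⁻¹) =
        freeAct v y (word v k) * freeAct v (y * k * y'⁻¹ * k'⁻¹) (word v k')⁻¹ := by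
      rw [word_mul, word_mul _ _ y'⁻¹, word_mul _ y, word_eq_one v hy,
        word_eq_one v (a := y'⁻¹) (by rw [map_inv, hy']), map_one, one_mul, mul_one, word_inv,
        freeAct_mul v _ k'⁻¹]
      rfl
    rw [h1, map_mul, map_proj_freeAct, map_proj_freeAct, hy, map_inv]
    congr 1
    have h2 : (fun x : FinCosets v N₁ => ret Γ {v}ᶜ (y * k * y'⁻¹ * k'⁻¹) • x) = id :=
      funext fun x => smul_eq_of_mem (hret _ _ (hN hmem)) x
    rw [h2, FreeGroup.map.id]
  have hf : FreeGroup.map (y • ·) (FreeGroup.map (proj v N₁) (word v k)) *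
        (FreeGroup.map (proj v N₁) (word v k'))⁻¹ = 1 := by
    by_contra hf
    exact hNf _ ⟨(y • ·), rfl⟩ hf _ hw hmem
  rw [mul_inv_eq_one, FreeGroup.map.comp] at hf
  have h3 := congrArg FreeGroup.toWord hf
  rw [FreeGroup.toWord_map_of_injOn, FreeGroup.toWord_map_of_injOn] at h3
  · exact h3
  · exact hinj' _ hN₁
  · exact ((MulAction.injective y).injOn).comp (hinj _ (hN₁.trans hN₀')) (Set.mapsTo_univ _ _)

end RAAG

namespace RAAG

open FiniteIndexNormalSubgroup

universe u

variable {V : Type u} {Γ : SimpleGraph V}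

theorem freeAct_eq_of_forall_letters {v : V} [DecidableEq (Cosets Γ v)] {a : RAAG Γ}
    (ha : ret Γ {v}ᶜ a = a) {w w' : FreeGroup (Cosets Γ v)}
    (hlen : w.toWord.length = w'.toWord.length)
    (h : ∀ q ∈ w.toWord.zip w'.toWord, a • q.1.1 = q.2.1 ∧ q.1.2 = q.2.2) :
    freeAct v a w = w' := by
  have h1 : w.toWord.map (fun q => (a • q.1, q.2)) = w'.toWord := by
    refine List.ext_getElem (by simpa using hlen) fun i hi hi' => ?_
    rw [List.length_map] at hi
    have := h (w.toWord[i], w'.toWord[i])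
      (List.mem_iff_getElem.2 ⟨i, by simp [hi, hi'], by simp⟩)
    rw [List.getElem_map]
    exact Prod.ext this.1 this.2
  rw [freeAct, ha, ← FreeGroup.mk_toWord (x := w), FreeGroup.map.mk, h1, FreeGroup.mk_toWord]

/-- An equation can be replaced by a finite system whose coefficients avoid a vertex. -/
theorem exists_reduction [Finite V] {S S' : Set V} {u : V} (hu : u ∈ S') (huS : u ∉ S) {τ : Eqn Γ}
    (hk : ret Γ S' τ.k = τ.k) (hk' : ret Γ S' τ.k' = τ.k') :
    ∃ l : Set (Eqn Γ), l.Finite ∧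
      (∀ σ ∈ l, ret Γ (S' \ {u}) σ.k = σ.k ∧ ret Γ (S' \ {u}) σ.k' = σ.k') ∧
      (∀ σ ∈ l, (σ.T = τ.T ∧ ret Γ S σ.k = ret Γ S τ.k ∧ ret Γ S σ.k' = ret Γ S τ.k') ∨
        (ret Γ (σ.T ∩ S) σ.k = 1 ∧ ret Γ (σ.T ∩ S) σ.k' = 1)) ∧
      ∀ N', ∃ N, ∀ x, ret Γ S x = x → τ.Approx N x → (∀ σ ∈ l, σ.Approx N' x) ∧
        ∀ a, ret Γ S a = a → (∀ σ ∈ l, σ.Solves a) → τ.Solves a := by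
  classical
  have hSu : S ⊆ {u}ᶜ := fun s hs h => huS (h ▸ hs)
  have hS'u : S' \ {u} = S' ∩ {u}ᶜ := rfl
  set rep : Cosets Γ u → RAAG Γ := fun p => ret Γ (S' \ {u}) p.out with hrep
  have hrepret : ∀ p, ret Γ (S' \ {u}) (rep p) = rep p := fun p => ret_ret_self _ _
  have hret_ofCoset : ∀ p, ret Γ (S' \ {u}) (rep p * (ret Γ (Γ.neighborSet u) (rep p))⁻¹) =
      rep p * (ret Γ (Γ.neighborSet u) (rep p))⁻¹ := fun p => by
    rw [map_mul, map_inv, ret_comm _ (Γ.neighborSet u), hrepret]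
  have hrepmk : ∀ {w : RAAG Γ} {p : Cosets Γ u × Bool}, ret Γ S' w = w → p ∈ (word u w).toWord →
      ((rep p.1 : RAAG Γ) : Cosets Γ u) = p.1 := fun {w p} hw hp => by
    have h1 := word_ret u hu w
    rw [hw] at h1
    have := FreeGroup.eq_of_mem_toWord_of_map_eq h1.symm hp
    rw [hrep, ← cosetRet_mk]
    have h2 : ((p.1.out : RAAG Γ) : Cosets Γ u) = p.1 := QuotientGroup.out_eq' _
    rw [h2, this]
  set σ₀ : Eqn Γ := ⟨τ.T, ret Γ {u}ᶜ τ.k, ret Γ {u}ᶜ τ.k'⟩ with hσ₀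
  set L := (word u τ.k).toWord.zip (word u τ.k').toWord with hL
  set φ : (Cosets Γ u × Bool) × (Cosets Γ u × Bool) → Eqn Γ := fun q =>
    Eqn.ofCoset u (rep q.1.1) (rep q.2.1) with hφ
  refine ⟨insert σ₀ (φ '' {q | q ∈ L}), (L.finite_toSet.image φ).insert _, ?_, ?_, ?_⟩
  · rintro σ (rfl | ⟨q, -, rfl⟩)
    · rw [hσ₀, hS'u, ← ret_ret, ← ret_ret, ret_ret_self, ret_ret_self, ret_comm, hk, ret_comm, hk']
      exact ⟨rfl, rfl⟩
    · exact ⟨hret_ofCoset _, hret_ofCoset _⟩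
  · rintro σ (rfl | ⟨q, -, rfl⟩)
    · exact .inl ⟨rfl, ret_ret_of_subset hSu _, ret_ret_of_subset hSu _⟩
    · right
      change ret Γ (Γ.neighborSet u ∩ S) _ = 1 ∧ ret Γ (Γ.neighborSet u ∩ S) _ = 1
      rw [Set.inter_comm, ← ret_ret, ← ret_ret, Eqn.ret_ofCoset_k, Eqn.ret_ofCoset_k']
      simp
  · intro N'
    obtain ⟨N₁, hN₁, hinv, N, hN⟩ := exists_toWord_eq u τ.k τ.k' N'
    refine ⟨N ⊓ N₁, fun x hx happ => ?_⟩
    have hxu : ret Γ {u}ᶜ x = x := ret_eq_of_subset hSu hx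
    have hretx : ∀ a, ret Γ {u}ᶜ a = a → ret Γ {u}ᶜ (ret Γ τ.T a) = ret Γ τ.T a := fun a ha => by
      rw [ret_comm, ha]
    have hw := hN x (ret Γ τ.T x) hxu (hretx x hxu) (quot_eq_of_le inf_le_left happ)
    have hlen : (word u τ.k).toWord.length = (word u τ.k').toWord.length := by
      simpa using congrArg List.length hw
    have hzip : ∀ q ∈ L, x • proj u N₁ q.1.1 = proj u N₁ q.2.1 ∧ q.1.2 = q.2.2 := by
      intro q hq
      obtain ⟨i, hi, rfl⟩ := List.mem_iff_getElem.1 hq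
      have hi' : i < (word u τ.k).toWord.length ∧ i < (word u τ.k').toWord.length := by
        simpa [hL] using hi
      have := List.getElem_of_eq hw (i := i) (by simpa using hi'.1)
      rw [List.getElem_map, List.getElem_map, Prod.ext_iff] at this
      simpa [hL] using this
    refine ⟨?_, ?_⟩
    · rintro σ (rfl | ⟨q, hq, rfl⟩)
      · refine quot_eq_of_le hN₁ ?_
        have := hinv.quot_eq {u}ᶜ (quot_eq_of_le inf_le_right happ)
        rwa [map_mul (ret Γ {u}ᶜ), map_mul (ret Γ {u}ᶜ), hxu, hretx x hxu] at this
      · refine Eqn.Approx.mono hN₁ (Eqn.approx_ofCoset hinv ?_)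
        rw [← proj_mk, ← proj_mk, hrepmk hk (List.of_mem_zip hq).1,
          hrepmk hk' (List.of_mem_zip hq).2]
        exact (hzip q hq).1
    · intro a ha hsol
      have hau : ret Γ {u}ᶜ a = a := ret_eq_of_subset hSu ha
      refine eq_of_word_eq u ?_ ?_
      · rw [word_mul, word_mul, word_eq_one u hau, word_eq_one u (hretx a hau), map_one, mul_one,
          one_mul]
        refine freeAct_eq_of_forall_letters hau hlen fun q hq => ⟨?_, (hzip q hq).2⟩
        have := Eqn.ofCoset_solves (hsol _ (.inr ⟨q, hq, rfl⟩))
        rwa [hrepmk hk (List.of_mem_zip hq).1, hrepmk hk' (List.of_mem_zip hq).2] at this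
      · have := hsol _ (.inl rfl)
        rw [map_mul, map_mul, hau, hretx a hau]
        exact this

end RAAG

namespace RAAG

open FiniteIndexNormalSubgroup

universe u

variable {V : Type u} {Γ : SimpleGraph V}

theorem ret_eq_one_of_subset {S T : Set V} (h : S ⊆ T) {a : RAAG Γ} (ha : ret Γ T a = 1) :
    ret Γ S a = 1 := by
  rw [← ret_ret_of_subset h, ha, map_one]

namespace Eqn

/-- The coefficients of the system lie in `A(S)`. -/
def CoeffsIn (S : Set V) (sys : Set (Eqn Γ)) : Prop :=
  ∀ τ ∈ sys, ret Γ S τ.k = τ.k ∧ ret Γ S τ.k' = τ.k'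

theorem approximable_of_diff_singleton [Finite V] {S S' : Set V} {u : V} (hu : u ∈ S')
    (huS : u ∉ S)
    (hQ : ∀ sys : Set (Eqn Γ), sys.Finite → Admissible S sys → CoeffsIn (S' \ {u}) sys →
      Approximable S sys) {sys : Set (Eqn Γ)} (hfin : sys.Finite) (hadm : Admissible S sys)
    (hc : CoeffsIn S' sys) : Approximable S sys := by
  choose! l hl hcoeff hkind happ using fun τ (hτ : τ ∈ sys) =>
    exists_reduction hu huS (hc τ hτ).1 (hc τ hτ).2
  have hone : ∀ τ ∈ sys, ∀ σ ∈ l τ, ¬ S ⊆ σ.T →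
      ret Γ (σ.T ∩ S) σ.k = 1 ∧ ret Γ (σ.T ∩ S) σ.k' = 1 := by
    intro τ hτ σ hσ h
    rcases hkind τ hτ σ hσ with ⟨h1, h2, h3⟩ | h1
    · rw [h1] at h ⊢
      rw [← ret_ret τ.T, ← ret_ret τ.T, h2, h3, ret_ret, ret_ret]
      exact hadm.1 τ hτ h
    · exact h1
  have hsup : ∀ τ ∈ sys, ∀ σ ∈ l τ, S ⊆ σ.T →
      S ⊆ τ.T ∧ ret Γ S σ.k = ret Γ S τ.k ∨ ret Γ S σ.k = 1 := by
    intro τ hτ σ hσ h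
    rcases hkind τ hτ σ hσ with ⟨h1, h2, -⟩ | h1
    · exact .inl ⟨h1 ▸ h, h2⟩
    · rw [Set.inter_eq_self_of_subset_right h] at h1
      exact .inr h1.1
  intro M
  obtain ⟨N', hN'⟩ := hQ (⋃ τ ∈ sys, l τ) (hfin.biUnion hl) ⟨fun σ hσ => by
      obtain ⟨τ, hτ, hσ⟩ := Set.mem_iUnion₂.1 hσ
      exact hone τ hτ σ hσ, fun σ hσ σ₂ hσ₂ h h₂ => by
      obtain ⟨τ, hτ, hσ⟩ := Set.mem_iUnion₂.1 hσ
      obtain ⟨τ₂, hτ₂, hσ₂⟩ := Set.mem_iUnion₂.1 hσ₂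
      rcases hsup τ hτ σ hσ h with ⟨h1, h2⟩ | h1
      · rcases hsup τ₂ hτ₂ σ₂ hσ₂ h₂ with ⟨h3, h4⟩ | h3
        · rw [h2, h4]
          exact hadm.2 τ hτ τ₂ hτ₂ h1 h3
        · rw [h3]; exact Commute.one_right _
      · rw [h1]; exact Commute.one_left _⟩ (fun σ hσ => by
      obtain ⟨τ, hτ, hσ⟩ := Set.mem_iUnion₂.1 hσ
      exact hcoeff τ hτ σ hσ) M
  obtain ⟨N, -, hN⟩ := exists_forall_of_finite hfin
    (p := fun τ N => ∀ x, ret Γ S x = x → τ.Approx N x → (∀ σ ∈ l τ, σ.Approx N' x) ∧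
        ∀ a, ret Γ S a = a → (∀ σ ∈ l τ, σ.Solves a) → τ.Solves a)
    (fun τ N N' hle h x hx hxN => h x hx (hxN.mono hle)) (fun τ hτ => happ τ hτ N') N'
  refine ⟨N, fun x hx hxN => ?_⟩
  obtain ⟨a, ha, hsol, haM⟩ := hN' x hx fun σ hσ => by
    obtain ⟨τ, hτ, hσ⟩ := Set.mem_iUnion₂.1 hσ
    exact (hN τ hτ x hx (hxN τ hτ)).1 σ hσ
  exact ⟨a, ha, fun τ hτ => (hN τ hτ x hx (hxN τ hτ)).2 a ha fun σ hσ =>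
    hsol σ (Set.mem_iUnion₂.2 ⟨τ, hτ, hσ⟩), haM⟩

theorem approximable_of_not_subset [Finite V] {S : Set V}
    (hP : ∀ T ⊂ S, ∀ sys : Set (Eqn Γ), sys.Finite → Admissible T sys → Approximable T sys)
    {sys : Set (Eqn Γ)} (hfin : sys.Finite) (hadm : Admissible S sys) (hc : CoeffsIn S sys)
    {τ₀ : Eqn Γ} (hτ₀ : τ₀ ∈ sys) (hT₀ : ¬ S ⊆ τ₀.T) : Approximable S sys := by
  set T' := τ₀.T ∩ S with hT'
  have hT'S : T' ⊂ S := ⟨Set.inter_subset_right, fun h => hT₀ (h.trans Set.inter_subset_left)⟩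
  obtain ⟨hk₀, hk₀'⟩ := hadm.1 τ₀ hτ₀ hT₀
  set ψ : Eqn Γ → Eqn Γ := fun τ =>
    ⟨τ.T, τ₀.k⁻¹ * τ.k * ret Γ τ.T τ₀.k, τ₀.k'⁻¹ * τ.k' * ret Γ τ.T τ₀.k'⟩ with hψ
  have hψk : ∀ τ : Eqn Γ, ∀ U ⊆ T', ret Γ U (ψ τ).k = ret Γ U τ.k ∧
      ret Γ U (ψ τ).k' = ret Γ U τ.k' := fun τ U hU => by
    simp only [hψ, map_mul, map_inv]
    rw [ret_comm U, ret_comm U, ret_eq_one_of_subset hU hk₀, ret_eq_one_of_subset hU hk₀']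
    simp
  have hone : ∀ τ ∈ sys, ¬ S ⊆ τ.T → ∀ U ⊆ S, U ⊆ τ.T → ret Γ U τ.k = 1 ∧ ret Γ U τ.k' = 1 :=
    fun τ hτ h U hU hUT => ⟨ret_eq_one_of_subset (Set.subset_inter hUT hU) (hadm.1 τ hτ h).1,
      ret_eq_one_of_subset (Set.subset_inter hUT hU) (hadm.1 τ hτ h).2⟩
  intro M
  obtain ⟨N, hN⟩ := hP T' hT'S (ψ '' sys) (hfin.image _) (by
    constructor
    · rintro _ ⟨τ, hτ, rfl⟩ h
      rw [(hψk τ _ Set.inter_subset_right).1, (hψk τ _ Set.inter_subset_right).2]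
      exact hone τ hτ (fun h' => h (hT'S.1.trans h')) _ (Set.inter_subset_right.trans hT'S.1)
        Set.inter_subset_left
    · rintro _ ⟨τ, hτ, rfl⟩ _ ⟨τ₂, hτ₂, rfl⟩ h h₂
      rw [(hψk τ _ subset_rfl).1, (hψk τ₂ _ subset_rfl).1]
      by_cases h3 : S ⊆ τ.T
      · by_cases h4 : S ⊆ τ₂.T
        · rw [← ret_ret_of_subset hT'S.1, ← ret_ret_of_subset hT'S.1 τ₂.k]
          exact (hadm.2 τ hτ τ₂ hτ₂ h3 h4).map _
        · rw [(hone τ₂ hτ₂ h4 T' hT'S.1 h₂).1]; exact Commute.one_right _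
      · rw [(hone τ hτ h3 T' hT'S.1 h).1]; exact Commute.one_left _) M
  obtain ⟨N', hN', hinv⟩ := exists_le_retInv (N ⊓ M)
  refine ⟨N', fun x hx happ => ?_⟩
  set t := ret Γ T' x with ht
  have htx : ret Γ τ₀.T x = t := by rw [ht, hT', ← ret_ret, hx]
  have hxt : quot N' x = quot N' (τ₀.k' * t * τ₀.k⁻¹) := by
    have := happ τ₀ hτ₀
    rw [Approx, htx, map_mul] at this
    rw [map_mul, ← this, map_inv]; group
  obtain ⟨t₀, ht₀, hsol, ht₀M⟩ := hN t (ret_ret_self _ _) (by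
    rintro _ ⟨τ, hτ, rfl⟩
    refine Approx.mono (hN'.trans inf_le_left) ?_
    have h1 : quot N' (x * τ.k) = quot N' (τ.k' * ret Γ τ.T x) := happ τ hτ
    have h2 := hinv.quot_eq τ.T hxt
    rw [map_mul, map_mul, hxt, h2] at h1
    simp only [map_mul, map_inv] at h1
    change quot N' (t * (τ₀.k⁻¹ * τ.k * ret Γ τ.T τ₀.k)) =
      quot N' (τ₀.k'⁻¹ * τ.k' * ret Γ τ.T τ₀.k' * ret Γ τ.T t)
    simp only [map_mul, map_inv, mul_assoc]
    simp only [mul_assoc] at h1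
    rw [← mul_left_cancel_iff (a := quot N' τ₀.k'),
      ← mul_right_cancel_iff (a := (quot N' (ret Γ τ.T τ₀.k))⁻¹)]
    simpa [mul_assoc] using h1)
  have ha : ret Γ S (τ₀.k' * t₀ * τ₀.k⁻¹) = τ₀.k' * t₀ * τ₀.k⁻¹ := by
    rw [map_mul, map_mul, map_inv, (hc τ₀ hτ₀).1, (hc τ₀ hτ₀).2, ret_eq_of_subset hT'S.1 ht₀]
  refine ⟨τ₀.k' * t₀ * τ₀.k⁻¹, ha, fun τ hτ => ?_, ?_⟩
  · have h1 : t₀ * (τ₀.k⁻¹ * τ.k * ret Γ τ.T τ₀.k) =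
      τ₀.k'⁻¹ * τ.k' * ret Γ τ.T τ₀.k' * ret Γ τ.T t₀ := hsol _ ⟨τ, hτ, rfl⟩
    have h2 : τ₀.k' * t₀ * τ₀.k⁻¹ * τ.k =
        τ₀.k' * (t₀ * (τ₀.k⁻¹ * τ.k * ret Γ τ.T τ₀.k)) * (ret Γ τ.T τ₀.k)⁻¹ := by group
    rw [Solves, h2, h1, map_mul, map_mul, map_inv]; group
  · have hle : N' ≤ M := hN'.trans inf_le_right
    rw [← quot_eq] at ht₀M ⊢
    rw [quot_eq_of_le hle hxt]
    simp only [map_mul, ht₀M]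

end Eqn

end RAAG

namespace RAAG

open FiniteIndexNormalSubgroup

universe u

variable {V : Type u} {Γ : SimpleGraph V}

theorem exists_conj_ret_compl [Finite V] {h : RAAG Γ}
    (hv : ∀ v, ∃ g, ret Γ {v}ᶜ (g * h * g⁻¹) = g * h * g⁻¹) : h = 1 := by
  have key : ∀ S : Set V, ∃ g, ret Γ Sᶜ (g * h * g⁻¹) = g * h * g⁻¹ := by
    intro S
    induction S, Set.toFinite S using Set.Finite.induction_on with
    | empty => exact ⟨1, by simp [ret_univ]⟩
    | @insert v S _ _ ih =>
      obtain ⟨g, hg⟩ := ih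
      obtain ⟨p, hp⟩ := hv v
      have h1 : ret Γ Sᶜ (p * h * p⁻¹) =
          (ret Γ Sᶜ (p * g⁻¹) * g) * h * (ret Γ Sᶜ (p * g⁻¹) * g)⁻¹ := by
        have h2 : p * h * p⁻¹ = (p * g⁻¹) * (g * h * g⁻¹) * (p * g⁻¹)⁻¹ := by group
        rw [h2, map_mul, map_mul, hg, map_inv]; group
      refine ⟨ret Γ Sᶜ (p * g⁻¹) * g, ?_⟩
      rw [← h1, Set.insert_eq, Set.compl_union, ← ret_ret, ret_ret_self, ret_comm, hp]
  obtain ⟨g, hg⟩ := key Set.univ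
  rw [Set.compl_univ, ret_empty] at hg
  simpa using hg.symm

theorem cosetRet_of_mem_support {v : V} {S : Set V} (hv : v ∈ S) {h : RAAG Γ} (hh : ret Γ S h = h)
    {e : Cosets Γ v} (he : e ∈ (fox v h).support) :
    ((ret Γ S e.out : RAAG Γ) : Cosets Γ v) = e := by
  classical
  have h1 := fox_ret v hv h
  rw [hh] at h1
  rw [h1] at he
  obtain ⟨y, -, rfl⟩ := Finset.mem_image.1 (Finsupp.mapDomain_support he)
  rw [← cosetRet_mk]
  have h2 : (((cosetRet v S y).out : RAAG Γ) : Cosets Γ v) = cosetRet v S y :=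
    QuotientGroup.out_eq' _
  rw [h2]
  induction y using QuotientGroup.induction_on with
  | H a => rw [cosetRet_mk, cosetRet_mk, ret_ret_self]

theorem exists_pow_smul_of_foxMod_pow_ne_zero {v : V} {N : FiniteIndexNormalSubgroup (RAAG Γ)}
    {a : RAAG Γ} (r : ℕ) {y : FinCosets v N} (h : foxMod v N (a ^ r) y ≠ 0) :
    ∃ j : ℕ, ∃ e ∈ (fox v a).support, y = a ^ j • proj v N e := by
  induction r generalizing y with
  | zero => simp [foxMod_one] at h
  | succ r ih =>
    rw [pow_succ', foxMod_mul] at h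
    by_cases h1 : foxMod v N a y = 0
    · rw [h1, zero_add] at h
      obtain ⟨j, e, he, hy⟩ := ih h
      exact ⟨j + 1, e, he, by rw [pow_succ', mul_smul, ← hy, smul_inv_smul]⟩
    · obtain ⟨e, he, rfl⟩ := exists_mem_support_of_foxMod_ne_zero h1
      exact ⟨0, e, he, by simp⟩

namespace Eqn

theorem approximable_of_forall_subset [Finite V] {S : Set V}
    (hP : ∀ T ⊂ S, ∀ sys : Set (Eqn Γ), sys.Finite → Admissible T sys → Approximable T sys)
    {sys : Set (Eqn Γ)} (hfin : sys.Finite) (hadm : Admissible S sys) (hc : CoeffsIn S sys)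
    (hT : ∀ τ ∈ sys, S ⊆ τ.T) : Approximable S sys := by
  classical
  have hret : ∀ τ ∈ sys, ∀ x, ret Γ S x = x → ret Γ τ.T x = x :=
    fun τ hτ x hx => ret_eq_of_subset (hT τ hτ) hx
  intro M
  by_cases hall : ∀ τ ∈ sys, τ.k = 1
  · obtain ⟨N, hN, hsep⟩ := exists_forall_of_finite hfin
      (p := fun τ N => τ.k' ∈ N → τ.k' = 1) (fun τ N N' hle h h1 => h (hle h1)) (fun τ _ => by
        by_cases h : τ.k' = 1
        · exact ⟨M, fun _ => h⟩
        · obtain ⟨N, hN⟩ := exists_notMem h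
          exact ⟨N, fun h1 => (hN h1).elim⟩) M
    refine ⟨N, fun x hx happ => ⟨x, hx, fun τ hτ => ?_, by simp⟩⟩
    have h1 := happ τ hτ
    rw [Approx, hall τ hτ, hret τ hτ x hx, mul_one, map_mul, right_eq_mul, quot_eq_one] at h1
    rw [Solves, hall τ hτ, hsep τ hτ h1, hret τ hτ x hx, one_mul, mul_one]
  push Not at hall
  obtain ⟨τ₁, hτ₁, hne⟩ := hall
  set h := τ₁.k with hh
  set h' := τ₁.k' with hh'
  obtain ⟨v, hv⟩ : ∃ v, ∀ g, ret Γ {v}ᶜ (g * h * g⁻¹) ≠ g * h * g⁻¹ := by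
    by_contra hcon
    push Not at hcon
    exact hne (exists_conj_ret_compl hcon)
  have hS : ret Γ S h = h := (hc τ₁ hτ₁).1
  have hS' : ret Γ S h' = h' := (hc τ₁ hτ₁).2
  have hvS : v ∈ S := by
    by_contra hvS
    refine hv 1 ?_
    rw [one_mul, inv_one, mul_one]
    exact ret_eq_of_subset (fun s hs (hsv : s = v) => hvS (hsv ▸ hs)) hS
  have hcomm : ∀ τ ∈ sys, Commute h τ.k := fun τ hτ => by
    have := hadm.2 τ₁ hτ₁ τ hτ (hT τ₁ hτ₁) (hT τ hτ)
    rwa [hS, (hc τ hτ).1] at this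
  set rep : Cosets Γ v → RAAG Γ := fun e => ret Γ S e.out with hrep
  have hrepS : ∀ e, ret Γ S (rep e) = rep e := fun e => ret_ret_self _ _
  set ρ : Cosets Γ v × Cosets Γ v → Eqn Γ := fun p => ofCoset v (rep p.1) (rep p.2) with hρ
  have hnS : ¬ S ⊆ Γ.neighborSet v := fun hsub => Γ.loopless.irrefl v (hsub hvS)
  have happrox : ∀ p, Approximable S (insert (ρ p) sys) := fun p => by
    refine approximable_of_not_subset hP (hfin.insert _) ⟨?_, ?_⟩ ?_ (Set.mem_insert _ _) hnS
    · rintro τ (rfl | hτ) hsub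
      · change ret Γ (Γ.neighborSet v ∩ S) _ = 1 ∧ ret Γ (Γ.neighborSet v ∩ S) _ = 1
        exact ⟨ret_eq_one_of_subset Set.inter_subset_left (ret_ofCoset_k _ _ _),
          ret_eq_one_of_subset Set.inter_subset_left (ret_ofCoset_k' _ _ _)⟩
      · exact hadm.1 τ hτ hsub
    · rintro τ (rfl | hτ) τ₂ (rfl | hτ₂) hs hs₂
      · exact (hnS hs).elim
      · exact (hnS hs).elim
      · exact (hnS hs₂).elim
      · exact hadm.2 τ hτ τ₂ hτ₂ hs hs₂
    · rintro τ (rfl | hτ)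
      · simp only [hρ, ofCoset, map_mul, map_inv]
        rw [ret_comm S (Γ.neighborSet v), ret_comm S (Γ.neighborSet v), hrepS, hrepS]
        exact ⟨rfl, rfl⟩
      · exact hc τ hτ
  obtain ⟨M₁, hM₁, hM₁p⟩ := exists_forall_of_finite
    ((fox v h).support ×ˢ (fox v h').support).finite_toSet
    (p := fun p N => ∀ x, ret Γ S x = x → (∀ τ ∈ insert (ρ p) sys, τ.Approx N x) →
      ∃ a, ret Γ S a = a ∧ (∀ τ ∈ insert (ρ p) sys, τ.Solves a) ∧ a⁻¹ * x ∈ M)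
    (fun p N N' hle hp x hx hxN => hp x hx fun τ hτ => (hxN τ hτ).mono hle)
    (fun p _ => happrox p M) M
  obtain ⟨N, hNM₁, hN⟩ := exists_foxMod_pow_ne_zero hv M₁
  obtain ⟨N₂, hN₂, hinv⟩ := exists_le_retInv N
  obtain ⟨r, hr, hrN⟩ := exists_pow_mem N₂ h
  obtain ⟨y, hy⟩ := hN N₂ hN₂ r hr.ne' hrN
  obtain ⟨N₃, hN₃, hN₃iff⟩ := exists_mem_iff_dvd_foxMod v N₂
    (m := (foxMod v N₂ (h ^ r) y).natAbs + 1) (Nat.succ_ne_zero _)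
  refine ⟨N₃, fun x hx happ => ?_⟩
  have happ' : ∀ τ ∈ sys, quot N₃ τ.k' = quot N₃ x * quot N₃ τ.k * (quot N₃ x)⁻¹ := fun τ hτ => by
    have := happ τ hτ
    rw [Approx, hret τ hτ x hx, map_mul, map_mul] at this
    rw [this]; group
  have hxh : quot N₃ (x * h ^ r * x⁻¹) = quot N₃ (h' ^ r) := by
    rw [map_pow, happ' τ₁ hτ₁, conj_pow, map_mul, map_mul, map_inv, map_pow]
  have hne' : foxMod v N₂ (h' ^ r) (x • y) ≠ 0 := by
    intro h0
    have h1 := quot_eq.1 hxh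
    have h2 : h' ^ r = x * h ^ r * x⁻¹ * ((x * h ^ r * x⁻¹)⁻¹ * h' ^ r) := by group
    rw [h2, foxMod_mul, foxMod_conj hrN, inv_smul_smul] at h0
    have h3 := (hN₃iff _).1 h1 |>.2 ((x * h ^ r * x⁻¹)⁻¹ • x • y)
    rw [eq_neg_of_add_eq_zero_right h0, dvd_neg] at h3
    have := Int.natAbs_dvd_natAbs.2 h3
    have h4 := Nat.le_of_dvd (Int.natAbs_pos.2 hy) this
    omega
  obtain ⟨j, e, he, hye⟩ := exists_pow_smul_of_foxMod_pow_ne_zero r hy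
  obtain ⟨k, e', he', hye'⟩ := exists_pow_smul_of_foxMod_pow_ne_zero r hne'
  set x' := (h' ^ k)⁻¹ * x * h ^ j with hx'
  have hx'S : ret Γ S x' = x' := by
    rw [hx', map_mul, map_mul, map_inv, map_pow, map_pow, hS, hS', hx]
  have hx'e : x' • proj v N₂ e = proj v N₂ e' := by
    rw [hx', mul_smul, mul_smul, ← hye, hye', inv_smul_smul]
  obtain ⟨a, ha, hsol, haM⟩ := hM₁p (e, e')
    (by simpa only [Finset.coe_product, Set.mem_prod, Finset.mem_coe] using ⟨he, he'⟩) x' hx'S (by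
    rintro τ (rfl | hτ)
    · refine Approx.mono (hN₂.trans hNM₁) (approx_ofCoset hinv ?_)
      rw [← proj_mk, ← proj_mk, hrep, cosetRet_of_mem_support hvS hS he,
        cosetRet_of_mem_support hvS hS' he']
      exact hx'e
    · refine Approx.mono (hN₃.trans (hN₂.trans hNM₁)) ?_
      have hc1 : Commute (quot N₃ h) (quot N₃ τ.k) := (hcomm τ hτ).map _
      have hc2 : Commute ((quot N₃ h ^ k)⁻¹ * quot N₃ h ^ j) (quot N₃ τ.k) :=
        ((hc1.pow_left k).inv_left).mul_left (hc1.pow_left j)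
      have h1 : quot N₃ x' = quot N₃ x * ((quot N₃ h ^ k)⁻¹ * quot N₃ h ^ j) := by
        rw [hx', map_mul, map_mul, map_inv, map_pow, map_pow, happ' τ₁ hτ₁, ← hh, conj_pow]; group
      rw [Approx, hret τ hτ _ hx'S, map_mul _ x', map_mul _ _ x', h1, happ' τ hτ, mul_assoc, hc2.eq]
      simp only [mul_assoc, inv_mul_cancel_left])
  have hsys : ∀ τ ∈ sys, a * τ.k = τ.k' * a := fun τ hτ => by
    have := hsol τ (.inr hτ)
    rwa [Solves, hret τ hτ a ha] at this
  have hpow : h' ^ k * a = a * h ^ k := by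
    have : SemiconjBy a h h' := hsys τ₁ hτ₁
    exact ((this.pow_right k).eq).symm
  have haS : ret Γ S (a * (h ^ k * (h ^ j)⁻¹)) = a * (h ^ k * (h ^ j)⁻¹) := by
    simp only [map_mul, map_inv, map_pow, ha, hS]
  refine ⟨a * (h ^ k * (h ^ j)⁻¹), haS, fun τ hτ => ?_, ?_⟩
  · have hc2 : Commute (h ^ k * (h ^ j)⁻¹) τ.k :=
      ((hcomm τ hτ).pow_left k).mul_left (((hcomm τ hτ).pow_left j).inv_left)
    rw [Solves, hret τ hτ _ haS, mul_assoc, hc2.eq, ← mul_assoc, hsys τ hτ, mul_assoc]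
  · rw [← quot_eq] at haM ⊢
    have h1 : x = h' ^ k * x' * (h ^ j)⁻¹ := by rw [hx']; group
    rw [h1, ← mul_assoc, ← hpow]
    simp only [map_mul, haM]

/-- Approximate solutions of finite admissible systems are close to solutions. -/
theorem approximable [Finite V] (S : Set V) : ∀ sys : Set (Eqn Γ), sys.Finite →
    Admissible S sys → Approximable S sys := by
  refine WellFoundedLT.induction (motive := fun S : Set V => ∀ sys : Set (Eqn Γ), sys.Finite →
    Admissible S sys → Approximable S sys) S fun S hP => ?_
  have key : ∀ S' : Set V, S ⊆ S' → ∀ sys : Set (Eqn Γ), sys.Finite → Admissible S sys →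
      CoeffsIn S' sys → Approximable S sys := by
    intro S'
    refine WellFoundedLT.induction (motive := fun S' : Set V => S ⊆ S' →
      ∀ sys : Set (Eqn Γ), sys.Finite → Admissible S sys → CoeffsIn S' sys →
      Approximable S sys) S' fun S' ih hSS' sys hfin hadm hc => ?_
    by_cases hsub : S' ⊆ S
    · obtain rfl := hSS'.antisymm hsub
      by_cases hT : ∀ τ ∈ sys, S ⊆ τ.T
      · exact approximable_of_forall_subset hP hfin hadm hc hT
      · push Not at hT
        obtain ⟨τ₀, hτ₀, hT₀⟩ := hT
        exact approximable_of_not_subset hP hfin hadm hc hτ₀ hT₀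
    · obtain ⟨u, hu, huS⟩ := Set.not_subset.1 hsub
      have hlt : S' \ {u} < S' := Set.sdiff_singleton_ssubset.2 hu
      refine approximable_of_diff_singleton hu huS (ih _ hlt fun s hs => ⟨hSS' hs, fun h => ?_⟩)
        hfin hadm hc
      exact huS (h ▸ hs)
  exact fun sys hfin hadm => key Set.univ (Set.subset_univ _) sys hfin hadm fun τ _ => by
    simp [ret_univ]

end Eqn

end RAAG

namespace FiniteIndexNormalSubgroup

variable {G : Type*} [Group G]

/-- The elements whose conjugation action on the powers of `z` is invisible to the homomorphisms
from finite-index normal subgroups to the integers. -/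
def homStab (z : G) : Subgroup G where
  carrier := {j | ∀ (M : FiniteIndexNormalSubgroup G) (f : M.toSubgroup →* Multiplicative ℤ) (n : ℕ)
    (hz : z ^ n ∈ M), f ⟨j * z ^ n * j⁻¹, M.conj_mem hz j⟩ = f ⟨z ^ n, hz⟩}
  one_mem' := fun M f n hz => congrArg f (Subtype.ext (by group))
  mul_mem' := fun {j j'} hj hj' M f n hz => by
    have h := hj' M (f.comp (MulAut.conjNormal j).toMonoidHom) n hz
    refine Eq.trans (congrArg f (Subtype.ext ?_)) (h.trans (Eq.trans (congrArg f (Subtype.ext ?_))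
      (hj M f n hz)))
    · simp [mul_assoc]
    · simp
  inv_mem' := fun {j} hj M f n hz => by
    have h := hj M (f.comp (MulAut.conjNormal j⁻¹).toMonoidHom) n hz
    refine Eq.trans (congrArg f (Subtype.ext ?_)) (h.symm.trans (congrArg f (Subtype.ext ?_)))
    · simp
    · simp [mul_assoc]

theorem self_mem_homStab (z : G) : z ∈ homStab z := fun M f n hz =>
  congrArg f (Subtype.ext (by group))

theorem map_mem_homStab {G' : Type*} [Group G'] (φ : G →* G') {z j : G} (hj : j ∈ homStab z) :
    φ j ∈ homStab (φ z) := fun M f n hz => by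
  have h1 : z ^ n ∈ comap φ M := by
    change φ (z ^ n) ∈ M
    rwa [map_pow]
  have h2 := hj (comap φ M) (f.comp (φ.subgroupComap M.toSubgroup)) n h1
  refine Eq.trans (congrArg f (Subtype.ext ?_)) (h2.trans (congrArg f (Subtype.ext ?_)))
  · exact (by simp : φ j * φ z ^ n * (φ j)⁻¹ = φ (j * z ^ n * j⁻¹))
  · exact map_pow φ z n

end FiniteIndexNormalSubgroup

namespace RAAG

open FiniteIndexNormalSubgroup

universe u

variable {V : Type u} {Γ : SimpleGraph V}

theorem foxMod_pow_smul {z j : RAAG Γ} (hj : j ∈ homStab z) {v : V}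
    {N : FiniteIndexNormalSubgroup (RAAG Γ)} {r : ℕ} (hr : z ^ r ∈ N) (y : FinCosets v N) :
    foxMod v N (z ^ r) (j • y) = foxMod v N (z ^ r) y := by
  let f : N.toSubgroup →* Multiplicative ℤ :=
    { toFun := fun a => Multiplicative.ofAdd (foxMod v N a (j • y))
      map_one' := by simp [foxMod_one]
      map_mul' := fun a b => by
        rw [Subgroup.coe_mul, foxMod_mul, smul_eq_of_mem (inv_mem a.2), ofAdd_add] }
  have h : foxMod v N (j * z ^ r * j⁻¹) (j • y) = foxMod v N (z ^ r) (j • y) :=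
    Multiplicative.ofAdd.injective (hj N f r hr)
  rw [← h, foxMod_conj hr, inv_smul_smul]

theorem exists_finite_of_homStab [Finite V] {v : V} {z : RAAG Γ}
    (hv : ∀ g, ret Γ {v}ᶜ (g * z * g⁻¹) ≠ g * z * g⁻¹) :
    ∃ (t : RAAG Γ → ℤ) (e₀ : Cosets Γ v) (P : Set (Cosets Γ v)), P.Finite ∧
      (∀ j ∈ homStab z, ∀ b, t (j * b) = t j + t b) ∧
      ∀ j ∈ homStab z, t j = 0 → j • e₀ ∈ P := by
  classical
  obtain ⟨N₀, -, hN₀⟩ := exists_foxMod_pow_ne_zero hv (ker (1 : RAAG Γ →* Equiv.Perm Unit))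
  obtain ⟨n, hn, hnN⟩ := exists_pow_mem N₀ z
  obtain ⟨y₀, hy₀⟩ := hN₀ N₀ le_rfl n hn.ne' hnN
  have := Fintype.ofFinite (FinCosets v N₀)
  set t : RAAG Γ → ℤ := fun a => ∑ e, foxMod v N₀ a e * foxMod v N₀ (z ^ n) e with ht
  have htmul : ∀ j ∈ homStab z, ∀ b, t (j * b) = t j + t b := fun j hj b => by
    simp only [ht, foxMod_mul, add_mul, Finset.sum_add_distrib, add_right_inj]
    refine Fintype.sum_equiv (MulAction.toPerm j⁻¹) _ _ fun e => ?_
    rw [MulAction.toPerm_apply, foxMod_pow_smul (inv_mem hj) hnN]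
  have htN : ∀ a ∈ N₀, ∀ b, t (a * b) = t a + t b := fun a ha b => by
    simp only [ht, foxMod_mul, add_mul, Finset.sum_add_distrib, smul_eq_of_mem (inv_mem ha)]
  have htlink : ∀ l ∈ link Γ v, ∀ a, t (a * l) = t a := fun l hl a => by
    have h0 : ∀ y, foxMod v N₀ l y = 0 := fun y => by
      rw [← mem_link.1 hl]
      exact cocycle_ret (foxMod_mul v N₀) (fun u hu ω => foxMod_gen_of_ne hu N₀ ω)
        (fun h => Γ.loopless.irrefl v h) l y
    simp only [ht, foxMod_mul, h0, add_zero]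
  have hz := self_mem_homStab z
  have htpow : ∀ k : ℕ, ∀ b, t (z ^ k * b) = k * t z + t b := fun k b => by
    induction k with
    | zero => simp
    | succ k ih => rw [pow_succ', mul_assoc, htmul z hz, ih]; push_cast; ring
  have ht1 : t 1 = 0 := by simp [ht, foxMod_one]
  have htz : t z ≠ 0 := by
    intro h0
    have h1 := htpow n 1
    rw [h0, ht1, mul_one, mul_zero, add_zero] at h1
    have h2 := (Finset.sum_eq_zero_iff_of_nonneg
      (fun e _ => mul_self_nonneg (foxMod v N₀ (z ^ n) e))).1 h1 y₀ (Finset.mem_univ _)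
    exact hy₀ (mul_self_eq_zero.1 h2)
  set E := (fox v z).support with hE
  set p : Cosets Γ v → FiniteIndexNormalSubgroup (RAAG Γ) → Prop := fun e N =>
    ∃ r : ℕ, z ^ r ∈ N ∧ foxMod v N (z ^ r) (proj v N e) ≠ 0 with hp
  obtain ⟨e₀, he₀⟩ : ∃ e₀, ∀ M, ∃ N ≤ M, p e₀ N := by
    by_contra! hcon
    obtain ⟨N, hN, hNp⟩ := exists_forall_of_finite E.finite_toSet
      (p := fun e M => ∀ N ≤ M, ¬ p e N) (fun e N N' hle h N'' h'' => h N'' (h''.trans hle))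
      (fun e _ => hcon e) N₀
    obtain ⟨r, hr, hrN⟩ := exists_pow_mem N z
    obtain ⟨y, hy⟩ := hN₀ N hN r hr.ne' hrN
    obtain ⟨j, e, he, rfl⟩ := exists_pow_smul_of_foxMod_pow_ne_zero r hy
    rw [foxMod_pow_smul (pow_mem hz j) hrN] at hy
    exact hNp e he N le_rfl ⟨r, hrN, hy⟩
  have hpig : ∀ j ∈ homStab z, ∃ e ∈ E, ∀ M, ∃ k : ℕ, j • proj v M e₀ = z ^ k • proj v M e := by
    intro j hj
    by_contra! hcon
    obtain ⟨M, -, hM⟩ := exists_forall_of_finite E.finite_toSet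
      (p := fun e M => ∀ k : ℕ, j • proj v M e₀ ≠ z ^ k • proj v M e)
      (fun e N N' hle h k hk => h k (by
        rw [← proj_smul, ← proj_smul] at hk ⊢
        exact proj_eq_of_le hle hk)) hcon N₀
    obtain ⟨N, hN, r, hr, hne⟩ := he₀ M
    rw [← foxMod_pow_smul hj hr] at hne
    obtain ⟨k, e, he, hk⟩ := exists_pow_smul_of_foxMod_pow_ne_zero r hne
    refine hM e he k ?_
    rw [← proj_smul, ← proj_smul] at hk ⊢
    exact proj_eq_of_le hN hk
  refine ⟨t, e₀, (fun e => z ^ ((t e₀.out - t e.out) / t z) • e) '' E, E.finite_toSet.image _,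
    htmul, fun j hj htj => ?_⟩
  obtain ⟨e, he, hje⟩ := hpig j hj
  refine ⟨e, he, ?_⟩
  by_contra hne
  obtain ⟨M, hM⟩ := exists_proj_ne hne
  obtain ⟨q, hq, hqM⟩ := exists_pow_mem M z
  obtain ⟨N, hN, hNiff⟩ := exists_mem_iff_dvd_foxMod v N₀ (m := (t z).natAbs * q)
    (Nat.mul_ne_zero (Int.natAbs_ne_zero.2 htz) hq.ne')
  obtain ⟨k, hk⟩ := hje (N ⊓ M)
  have hout : ∀ x : Cosets Γ v, ((x.out : RAAG Γ) : Cosets Γ v) = x := fun x =>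
    QuotientGroup.out_eq' _
  have hkM : j • proj v M e₀ = z ^ k • proj v M e := by
    rw [← proj_smul, ← proj_smul] at hk ⊢
    exact proj_eq_of_le inf_le_right hk
  have hdvd : t z * q ∣ (t e₀.out - t e.out) - k * t z := by
    rw [← hout e₀, ← hout e, proj_mk, proj_mk] at hk
    change ((j * e₀.out : RAAG Γ) : FinCosets v (N ⊓ M)) = ((z ^ k * e.out : RAAG Γ)) at hk
    obtain ⟨l, hl, hk⟩ := mk_eq_mk_iff.1 hk.symm
    set w := (z ^ k * e.out * l)⁻¹ * (j * e₀.out) with hw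
    have hwN : w ∈ N := mem_of_le inf_le_left hk
    have h1 : j * e₀.out = z ^ k * (e.out * l * w * (e.out * l)⁻¹ * (e.out * l)) := by
      rw [hw]; group
    have hconj := N.conj_mem hwN (e.out * l)
    have h2 : t (j * e₀.out) = k * t z + (t (e.out * l * w * (e.out * l)⁻¹) + t e.out) := by
      rw [h1, htpow, htN _ (hN hconj), htlink l hl]
    rw [htmul j hj, htj] at h2
    have h3 : (t z * q : ℤ) ∣ t (e.out * l * w * (e.out * l)⁻¹) := by
      refine Finset.dvd_sum fun y _ => Dvd.dvd.mul_right ?_ _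
      have := ((hNiff _).1 hconj).2 y
      rw [Nat.cast_mul, Int.natCast_natAbs] at this
      exact ((mul_dvd_mul (self_dvd_abs _) dvd_rfl).trans this)
    have h4 : (t e₀.out - t e.out) - k * t z = t (e.out * l * w * (e.out * l)⁻¹) := by linarith
    rwa [h4]
  obtain ⟨s, hs⟩ := hdvd
  have h5 : (t e₀.out - t e.out) / t z = k + q * s := by
    rw [show t e₀.out - t e.out = (k + q * s) * t z by linarith]
    exact Int.mul_ediv_cancel _ htz
  refine hM ?_
  rw [proj_smul, proj_smul, hkM, h5]
  refine (smul_eq_smul_of_mem ?_ _).symm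
  rw [zpow_add, zpow_natCast, inv_mul_cancel_left, zpow_mul, zpow_natCast]
  exact zpow_mem (K := M.toSubgroup) hqM s

theorem commute_of_mem_homStab [Finite V] (S : Set V) : ∀ {z h : RAAG Γ}, ret Γ S z = z →
    ret Γ S h = h → h ∈ homStab z → Commute h z := by
  refine WellFoundedLT.induction (motive := fun S : Set V => ∀ {z h : RAAG Γ}, ret Γ S z = z →
    ret Γ S h = h → h ∈ homStab z → Commute h z) S fun S ih z h hzS hhS hh => ?_
  by_cases hall : ∀ v, ∃ g, ret Γ {v}ᶜ (g * z * g⁻¹) = g * z * g⁻¹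
  · rw [exists_conj_ret_compl hall]; exact Commute.one_right h
  push Not at hall
  obtain ⟨v, hv⟩ := hall
  have hvS : v ∈ S := by
    by_contra hvS
    refine hv 1 ?_
    rw [one_mul, inv_one, mul_one]
    exact ret_eq_of_subset (fun s hs (hsv : s = v) => hvS (hsv ▸ hs)) hzS
  have hlt : S \ {v} < S := Set.sdiff_singleton_ssubset.2 hvS
  have hret : ∀ a, ret Γ S a = a → ret Γ (S \ {v}) (ret Γ {v}ᶜ a) = ret Γ {v}ᶜ a := fun a ha => by
    rw [show S \ {v} = S ∩ {v}ᶜ from rfl, ← ret_ret, ret_ret_self, ret_comm, ha]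
  have hcomm := ih _ hlt (hret z hzS) (hret h hhS) (map_mem_homStab (ret Γ {v}ᶜ) hh)
  set c := h * z * h⁻¹ * z⁻¹ with hc
  have hretc : ret Γ {v}ᶜ c = 1 := by
    rw [hc, map_mul, map_mul, map_mul, map_inv, map_inv, hcomm.eq]; group
  have hz := self_mem_homStab z
  have hcJ : c ∈ homStab z := mul_mem (mul_mem (mul_mem hh hz) (inv_mem hh)) (inv_mem hz)
  obtain ⟨t, e₀, P, hP, htmul, htP⟩ := exists_finite_of_homStab hv
  have ht1 : t 1 = 0 := by simpa using htmul 1 (one_mem _) 1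
  have htinv : ∀ j ∈ homStab z, t j⁻¹ = - t j := fun j hj => by
    have := htmul j hj j⁻¹
    rw [mul_inv_cancel, ht1] at this
    linarith
  have htc : t c = 0 := by
    rw [hc, htmul _ (mul_mem (mul_mem hh hz) (inv_mem hh)), htmul _ (mul_mem hh hz), htmul _ hh,
      htinv z hz, htinv h hh]
    ring
  have htpow : ∀ i : ℕ, t (c ^ i) = 0 := fun i => by
    induction i with
    | zero => simpa using ht1
    | succ i ih => rw [pow_succ, htmul _ (pow_mem hcJ i), ih, htc, add_zero]
  obtain ⟨i, i', hii', heq⟩ : ∃ i i' : ℕ, i < i' ∧ c ^ i • e₀ = c ^ i' • e₀ := by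
    obtain ⟨i, -, i', -, hne, heq⟩ := Set.infinite_univ.exists_ne_map_eq_of_mapsTo
      (f := fun i : ℕ => c ^ i • e₀) (fun i _ => htP _ (pow_mem hcJ i) (htpow i)) hP
    rcases lt_or_gt_of_ne hne with h | h
    · exact ⟨i, i', h, heq⟩
    · exact ⟨i', i, h, heq.symm⟩
  obtain ⟨n, rfl⟩ := Nat.exists_eq_add_of_lt hii'
  rw [add_assoc, pow_add, mul_smul, smul_left_cancel_iff] at heq
  have hc1 : c = 1 := by
    obtain ⟨g, rfl⟩ := QuotientGroup.mk_surjective e₀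
    refine eq_one_of_pow_eq_one v hretc (Nat.succ_ne_zero n) ?_
    have h1 : g⁻¹ * (c ^ (n + 1) * g) ∈ link Γ v := QuotientGroup.eq.1 heq
    have h2 := ret_compl_of_mem_link h1
    rw [map_mul, map_mul, map_pow, hretc, one_pow, one_mul, ← map_mul, inv_mul_cancel, map_one,
      eq_comm, inv_mul_eq_one, eq_comm, mul_eq_right] at h2
    exact h2
  rw [hc, mul_inv_eq_one, mul_inv_eq_iff_eq_mul] at hc1
  exact hc1

/-- Noncommuting elements are separated by a homomorphism from a finite-index normal subgroup to
the integers. -/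
theorem exists_hom_ne_of_not_commute [Finite V] {z h : RAAG Γ} (hne : ¬ Commute h z) :
    ∃ (M : FiniteIndexNormalSubgroup (RAAG Γ)) (f : M.toSubgroup →* Multiplicative ℤ) (n : ℕ)
      (hz : z ^ n ∈ M), f ⟨h * z ^ n * h⁻¹, M.conj_mem hz h⟩ ≠ f ⟨z ^ n, hz⟩ := by
  by_contra! hcon
  exact hne (commute_of_mem_homStab Set.univ (by simp [ret_univ]) (by simp [ret_univ]) hcon)

end RAAG

theorem Module.Finite.exists_nsmul_ne {A : Type*} [AddCommGroup A] [Module.Finite ℤ A] {a : A}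
    (ha : a ≠ 0) : ∃ m : ℕ, m ≠ 0 ∧ ∀ b : A, m • b ≠ a := by
  have key : ∀ n : ℕ, n ≠ 0 → (∀ k : ℤ, (k * n) • a ≠ a) → ∃ m : ℕ, m ≠ 0 ∧ ∀ b : A, m • b ≠ a := by
    intro n hn h
    by_contra! hcon
    have h1 : a ∈ ⨅ i : ℕ, Ideal.span {(n : ℤ)} ^ i • (⊤ : Submodule ℤ A) := by
      refine (Submodule.mem_iInf _).2 fun i => ?_
      obtain ⟨b, hb⟩ := hcon (n ^ i) (pow_ne_zero i hn)
      rw [← hb, ← natCast_zsmul]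
      refine Submodule.smul_mem_smul ?_ Submodule.mem_top
      rw [Nat.cast_pow]
      exact Ideal.pow_mem_pow (Ideal.mem_span_singleton_self _) i
    obtain ⟨⟨r, hr⟩, hra⟩ := (Ideal.mem_iInf_smul_pow_eq_bot_iff _ _).1 h1
    obtain ⟨k, rfl⟩ := Ideal.mem_span_singleton'.1 hr
    exact h k hra
  by_cases h0 : addOrderOf a = 0
  · refine key 2 two_ne_zero fun k hk => ?_
    have h1 : (k * 2 - 1) • a = 0 := by
      rw [sub_smul, one_smul]
      exact sub_eq_zero.2 (by exact_mod_cast hk)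
    have h2 := addOrderOf_dvd_iff_zsmul_eq_zero.2 h1
    rw [h0, Nat.cast_zero, zero_dvd_iff] at h2
    omega
  · refine key _ h0 fun k hk => ha ?_
    rw [← hk, mul_smul, natCast_zsmul, addOrderOf_nsmul_eq_zero, smul_zero]

theorem Module.Finite.finite_quotient_nsmul {A : Type*} [AddCommGroup A] [Module.Finite ℤ A] {q : ℕ}
    (hq : q ≠ 0) : _root_.Finite (A ⧸ (nsmulAddMonoidHom (α := A) q).range) := by
  have h1 : AddGroup.FG A := Module.Finite.iff_addGroup_fg.1 inferInstance
  have h2 : AddGroup.FG (A ⧸ (nsmulAddMonoidHom (α := A) q).range) := inferInstance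
  refine AddCommGroup.finite_of_fg_isAddTorsion _ ?_
  intro x
  induction x using QuotientAddGroup.induction_on with | H a => ?_
  refine isOfFinAddOrder_iff_nsmul_eq_zero.2 ⟨q, hq.bot_lt, ?_⟩
  exact (QuotientAddGroup.eq_zero_iff (q • a)).2 ⟨a, rfl⟩

/-- Approximate solutions of integral linear equations are close to solutions. -/
theorem Module.Finite.exists_modulus {A : Type*} [AddCommGroup A] [Module.Finite ℤ A] {ι : Type*}
    [_root_.Finite ι] (β : A →+ ι → ℤ) (t : ι → ℤ) {q : ℕ} (hq : q ≠ 0) :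
    ∃ m : ℕ, m ≠ 0 ∧ ∀ x, (∀ i, (m : ℤ) ∣ β x i - t i) → ∃ ε w, x = ε + q • w ∧ β ε = t := by
  have hfin := Module.Finite.finite_quotient_nsmul (A := A) hq
  have := Fintype.ofFinite (A ⧸ (nsmulAddMonoidHom (α := A) q).range)
  set R : AddSubgroup (ι → ℤ) := (β.comp (nsmulAddMonoidHom q)).range with hR
  have hfg : Module.Finite ℤ ((ι → ℤ) ⧸ R) :=
    Module.Finite.of_surjective (QuotientAddGroup.mk' R).toIntLinearMap
      (QuotientAddGroup.mk'_surjective R)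
  have hm : ∀ c : A ⧸ (nsmulAddMonoidHom (α := A) q).range, ∃ m : ℕ, m ≠ 0 ∧
      ((∃ b, m • b = (QuotientAddGroup.mk' R) (β c.out - t)) → β c.out - t ∈ R) := fun c => by
    by_cases h : (QuotientAddGroup.mk' R) (β c.out - t) = 0
    · exact ⟨1, one_ne_zero, fun _ => (QuotientAddGroup.eq_zero_iff _).1 h⟩
    · obtain ⟨m, hm, hmb⟩ := Module.Finite.exists_nsmul_ne h
      exact ⟨m, hm, fun ⟨b, hb⟩ => (hmb b hb).elim⟩
  choose m hm0 hm using hm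
  refine ⟨∏ c, m c, Finset.prod_ne_zero_iff.2 fun c _ => hm0 c, fun x hx => ?_⟩
  choose u hu using hx
  set c : A ⧸ (nsmulAddMonoidHom (α := A) q).range := QuotientAddGroup.mk x with hc
  obtain ⟨w, hw⟩ : ∃ w, q • w = - c.out + x := QuotientAddGroup.eq.1 (QuotientAddGroup.out_eq' c)
  have hxw : x = c.out + q • w := by rw [hw]; abel
  obtain ⟨k, hk⟩ := Finset.dvd_prod_of_mem m (Finset.mem_univ c)
  obtain ⟨w', hw'⟩ := hm c ⟨QuotientAddGroup.mk' R (k • u), by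
    rw [← map_nsmul, smul_smul, ← hk]
    refine QuotientAddGroup.eq.2 ⟨- w, ?_⟩
    have h1 : (∏ c, m c) • u = β x - t := funext fun i => by
      rw [Pi.sub_apply, hu i, Pi.smul_apply, nsmul_eq_mul]
    rw [h1, hxw, map_add]
    change β (q • -w) = _
    rw [smul_neg, map_neg]
    abel⟩
  refine ⟨c.out - q • w', w + w', ?_, ?_⟩
  · conv_lhs => rw [hxw]
    rw [smul_add]; abel
  · have h2 : β (q • w') = β c.out - t := hw'
    rw [map_sub, h2]; abel

/-- The common kernel of a set of homomorphisms to the integers is already cut out by finitely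
many of them. -/
theorem exists_finset_forall_eq_one {Z : Type*} [Group Z] [Group.FG Z]
    (Φ : Set (Z →* Multiplicative ℤ)) : ∃ s : Set (Z →* Multiplicative ℤ), s ⊆ Φ ∧ s.Finite ∧
      ∀ z, (∀ φ ∈ s, φ z = 1) → ∀ φ ∈ Φ, φ z = 1 := by
  obtain ⟨g, hg⟩ := Group.fg_def.1 (inferInstance : Group.FG Z)
  let E : Additive (Z →* Multiplicative ℤ) →+ (g → ℤ) :=
    { toFun := fun φ i => Multiplicative.toAdd (φ.toMul i)
      map_zero' := rfl
      map_add' := fun _ _ => rfl }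
  have hE : Function.Injective E := fun φ ψ h => by
    refine Additive.toMul.injective (MonoidHom.eq_of_eqOn_dense hg fun i hi => ?_)
    exact Multiplicative.toAdd.injective (congrFun h ⟨i, hi⟩)
  have := isNoetherian_of_injective E.toIntLinearMap hE
  obtain ⟨s, hs, hspan⟩ := (Submodule.fg_span_iff_fg_span_finset_subset
    (Additive.toMul ⁻¹' Φ)).1 (IsNoetherian.noetherian (R := ℤ) _)
  refine ⟨Additive.toMul '' (s : Set _), fun φ hφ => ?_, s.finite_toSet.image _,
    fun z hz φ hφ => ?_⟩
  · obtain ⟨ψ, hψ, rfl⟩ := hφ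
    exact hs hψ
  · let ev : Additive (Z →* Multiplicative ℤ) →+ ℤ :=
      { toFun := fun φ => Multiplicative.toAdd (φ.toMul z)
        map_zero' := rfl
        map_add' := fun _ _ => rfl }
    have h1 : Submodule.span ℤ (Additive.toMul ⁻¹' Φ) ≤ LinearMap.ker ev.toIntLinearMap := by
      rw [hspan, Submodule.span_le]
      exact fun ψ hψ => congrArg Multiplicative.toAdd (hz _ ⟨ψ, hψ, rfl⟩)
    exact Multiplicative.toAdd.injective (h1 (Submodule.subset_span (a := Additive.ofMul φ) hφ))

theorem FreeGroup.eq_of_commute_of {X : Type*} {a b : X}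
    (h : Commute (FreeGroup.of a) (FreeGroup.of b)) : a = b := by
  classical
  by_contra hab
  have h1 := congrArg (FreeGroup.lift fun x : X => if x = a then Equiv.swap (0 : Fin 3) 1 else
    Equiv.swap 1 2) h.eq
  rw [_root_.map_mul, _root_.map_mul, FreeGroup.lift_apply_of, FreeGroup.lift_apply_of, if_pos rfl,
    if_neg (Ne.symm hab)] at h1
  exact absurd h1 (by decide)

theorem IsFreeGroup.fg_of_forall_commute {F : Type*} [Group F] [IsFreeGroup F]
    (h : ∀ a b : F, Commute a b) : Group.FG F := by
  have e := IsFreeGroup.toFreeGroup F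
  have : Subsingleton (IsFreeGroup.Generators F) := ⟨fun a b => FreeGroup.eq_of_commute_of (by
    have := (h (e.symm (FreeGroup.of a)) (e.symm (FreeGroup.of b))).map e
    simpa using this)⟩
  exact Group.fg_of_surjective (f := e.symm.toMonoidHom) e.symm.surjective

theorem Subgroup.fg_of_fg_map_of_fg_inf_ker {G G' : Type*} [Group G] [Group G'] (f : G →* G')
    {Z : Subgroup G} (h1 : (Z.map f).FG) (h2 : (Z ⊓ f.ker).FG) : Z.FG := by
  classical
  obtain ⟨s, hs⟩ := h1
  have hsub : (s : Set G') ⊆ f '' Z := fun y hy => by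
    have : y ∈ Z.map f := hs ▸ Subgroup.subset_closure hy
    exact this
  obtain ⟨t, htZ, rfl⟩ := Finset.subset_set_image_iff.1 hsub
  have hle : Subgroup.closure (t : Set G) ≤ Z := (Subgroup.closure_le _).2 htZ
  have hZ : Z = Subgroup.closure t ⊔ (Z ⊓ f.ker) := by
    refine le_antisymm (fun z hz => ?_) (sup_le hle inf_le_left)
    have h3 : f z ∈ (Subgroup.closure (t : Set G)).map f := by
      rw [MonoidHom.map_closure, ← Finset.coe_image, hs]
      exact Subgroup.mem_map_of_mem f hz
    obtain ⟨y, hy, hyz⟩ := h3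
    have h4 : y * (y⁻¹ * z) = z := by group
    rw [← h4]
    refine mul_mem (le_sup_left (a := Subgroup.closure (t : Set G)) hy) (le_sup_right
      (a := Subgroup.closure (t : Set G)) ⟨Z.mul_mem (Z.inv_mem (hle hy)) hz, ?_⟩)
    exact MonoidHom.mem_ker.2 (by rw [map_mul, map_inv, hyz, inv_mul_cancel])
  rw [hZ]
  exact Subgroup.FG.sup ⟨t, rfl⟩ h2

namespace RAAG

open FiniteIndexNormalSubgroup

universe u

variable {V : Type u} {Γ : SimpleGraph V}

theorem fg_of_forall_commute_of_ret [Finite V] (S : Set V) : ∀ Z : Subgroup (RAAG Γ),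
    (∀ a ∈ Z, ret Γ S a = a) → (∀ a ∈ Z, ∀ b ∈ Z, Commute a b) → Z.FG := by
  refine WellFoundedLT.induction (motive := fun S : Set V => ∀ Z : Subgroup (RAAG Γ),
    (∀ a ∈ Z, ret Γ S a = a) → (∀ a ∈ Z, ∀ b ∈ Z, Commute a b) → Z.FG) S fun S ih Z hS hZ => ?_
  rcases S.eq_empty_or_nonempty with rfl | ⟨v, hv⟩
  · have : Z = ⊥ := (Subgroup.eq_bot_iff_forall Z).2 fun a ha => by
      rw [← hS a ha, ret_empty]
    rw [this]
    exact Subgroup.FG.bot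
  · refine Subgroup.fg_of_fg_map_of_fg_inf_ker (ret Γ {v}ᶜ) (ih (S \ {v})
      (Set.sdiff_singleton_ssubset.2 hv) _ ?_ ?_) ?_
    · rintro _ ⟨a, ha, rfl⟩
      have h1 : S \ {v} ⊆ {v}ᶜ := fun x hx => hx.2
      have h2 : ret Γ {v}ᶜ a = ret Γ (S \ {v}) a := by
        conv_lhs => rw [← hS a ha, ret_ret, Set.inter_comm]
        rfl
      rw [ret_ret_of_subset h1, h2]
    · rintro _ ⟨a, ha, rfl⟩ _ ⟨b, hb, rfl⟩
      exact (hZ a ha b hb).map _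
    · let W : (Z ⊓ (ret Γ {v}ᶜ).ker : Subgroup (RAAG Γ)) →* FreeGroup (Cosets Γ v) :=
        { toFun := fun a => word v (a : RAAG Γ)
          map_one' := word_one v
          map_mul' := fun a b => by
            have h1 : ret Γ {v}ᶜ (a : RAAG Γ) = 1 := a.2.2
            rw [Subgroup.coe_mul, word_mul, freeAct, h1]
            simp }
      have hW : Function.Injective W := fun a b hab => Subtype.ext (eq_of_word_eq v hab
        ((a.2.2 : ret Γ {v}ᶜ (a : RAAG Γ) = 1).trans (b.2.2 : ret Γ {v}ᶜ (b : RAAG Γ) = 1).symm))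
      have e := W.ofInjective hW
      have hfg : Group.FG W.range := IsFreeGroup.fg_of_forall_commute fun a b => by
        have := (Commute.map (x := e.symm a) (y := e.symm b) (Subtype.ext
          (hZ _ (e.symm a).2.1 _ (e.symm b).2.1).eq) e)
        simpa using this
      exact (Group.fg_iff_subgroup_fg _).1
        (Group.fg_of_surjective (f := e.symm.toMonoidHom) e.symm.surjective)

/-- Abelian subgroups of right-angled Artin groups are finitely generated. -/
theorem fg_of_forall_commute [Finite V] {Z : Subgroup (RAAG Γ)}
    (hZ : ∀ a ∈ Z, ∀ b ∈ Z, Commute a b) : Group.FG Z :=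
  (Group.fg_iff_subgroup_fg _).2
    (fg_of_forall_commute_of_ret Set.univ Z (fun a _ => by rw [ret_univ]) hZ)

end RAAG

/-- Multiplicative form of `Module.Finite.exists_modulus`. -/
theorem exists_modulus_of_commute {Z : Type*} [Group Z] [Group.FG Z]
    (hZ : ∀ a b : Z, Commute a b) {ι : Type*} [Finite ι] (β : ι → Z →* Multiplicative ℤ) (t : ι → ℤ)
    {q : ℕ} (hq : q ≠ 0) : ∃ m : ℕ, m ≠ 0 ∧
      ∀ x, (∀ i, (m : ℤ) ∣ Multiplicative.toAdd (β i x) - t i) →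
        ∃ ε w, x = ε * w ^ q ∧ ∀ i, Multiplicative.toAdd (β i ε) = t i := by
  let _ : CommGroup Z := { ‹Group Z› with mul_comm := fun a b => (hZ a b).eq }
  have : AddGroup.FG (Additive Z) := AddGroup.fg_of_group_fg
  have : Module.Finite ℤ (Additive Z) := Module.Finite.iff_addGroup_fg.2 this
  let B : Additive Z →+ ι → ℤ :=
    { toFun := fun a i => Multiplicative.toAdd (β i a.toMul)
      map_zero' := funext fun i => congrArg Multiplicative.toAdd (map_one (β i))
      map_add' := fun a b => funext fun i => congrArg Multiplicative.toAdd (map_mul (β i) _ _) }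
  obtain ⟨m, hm, h⟩ := Module.Finite.exists_modulus B t hq
  refine ⟨m, hm, fun x hx => ?_⟩
  obtain ⟨ε, w, h1, h2⟩ := h (Additive.ofMul x) hx
  exact ⟨ε.toMul, w.toMul, congrArg Additive.toMul h1, fun i => congrFun h2 i⟩

namespace FiniteIndexNormalSubgroup

universe u

variable {G : Type u} [Group G]

theorem exists_forall_pow_mem (N : FiniteIndexNormalSubgroup G) :
    ∃ d : ℕ, d ≠ 0 ∧ ∀ a, a ^ d ∈ N := by
  have := N.isFiniteIndex'
  have := N.isNormal'
  refine ⟨N.toSubgroup.index, N.isFiniteIndex'.index_ne_zero, fun a => ?_⟩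
  exact N.toSubgroup.pow_index_mem a

theorem exists_forall_dvd {M : FiniteIndexNormalSubgroup G} (f : M.toSubgroup →* Multiplicative ℤ)
    {m : ℕ} (hm : m ≠ 0) : ∃ N ≤ M, ∀ a (ha : a ∈ M), a ∈ N →
      (m : ℤ) ∣ Multiplicative.toAdd (f ⟨a, ha⟩) := by
  have : NeZero m := ⟨hm⟩
  let φ : M.toSubgroup →* Multiplicative (ZMod m) :=
    (AddMonoidHom.toMultiplicative (Int.castAddHom (ZMod m))).comp f
  have h1 : (φ.ker.map M.toSubgroup.subtype).index ≠ 0 := by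
    rw [Subgroup.index_map_subtype]
    exact mul_ne_zero (Subgroup.finiteIndex_ker φ).index_ne_zero M.isFiniteIndex'.index_ne_zero
  have : (φ.ker.map M.toSubgroup.subtype).FiniteIndex := ⟨h1⟩
  refine ⟨ofSubgroup (φ.ker.map M.toSubgroup.subtype).normalCore, ?_, fun a ha haN => ?_⟩
  · exact (Subgroup.normalCore_le _).trans (Subgroup.map_subtype_le _)
  · obtain ⟨b, hb, rfl⟩ := Subgroup.normalCore_le _ haN
    exact (ZMod.intCast_zmod_eq_zero_iff_dvd _ m).1 hb

theorem exists_forall_forall_dvd {M : FiniteIndexNormalSubgroup G} {ι : Type*} [Finite ι]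
    (f : ι → M.toSubgroup →* Multiplicative ℤ) {m : ℕ} (hm : m ≠ 0) :
    ∃ N ≤ M, ∀ i a (ha : a ∈ M), a ∈ N → (m : ℤ) ∣ Multiplicative.toAdd (f i ⟨a, ha⟩) := by
  choose N hN h using fun i => exists_forall_dvd (f i) hm
  obtain ⟨N', h1, h2⟩ := exists_forall_le N M
  exact ⟨N', h1, fun i a ha haN => h i a ha (h2 i haN)⟩

/-- The elements of a finitely generated abelian subgroup killed by a family of homomorphisms from
finite index subgroups to the integers are detected by a finite subfamily. -/
theorem exists_finite_detect {Z : Subgroup G} [Group.FG Z] (hZ : ∀ a ∈ Z, ∀ b ∈ Z, Commute a b)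
    (F : ∀ M : FiniteIndexNormalSubgroup G, Set (M.toSubgroup →* Multiplicative ℤ)) :
    ∃ (M₀ : FiniteIndexNormalSubgroup G) (ι : Type u) (_ : Finite ι)
      (M : ι → FiniteIndexNormalSubgroup G) (_ : ∀ i, M₀ ≤ M i)
      (f : ∀ i, (M i).toSubgroup →* Multiplicative ℤ), (∀ i, f i ∈ F (M i)) ∧
      ∀ z ∈ Z, z ∈ M₀ → (∀ i (hz : z ∈ M i), f i ⟨z, hz⟩ = 1) →
        ∀ M, ∀ f ∈ F M, ∀ n (hz : z ^ n ∈ M), f ⟨z ^ n, hz⟩ = 1 := by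
  choose d hd hpow using exists_forall_pow_mem (G := G)
  let ψ : ∀ M : FiniteIndexNormalSubgroup G, (M.toSubgroup →* Multiplicative ℤ) →
      (Z →* Multiplicative ℤ) := fun M f =>
    { toFun := fun z => f ⟨(z : G) ^ d M, hpow M z⟩
      map_one' := by
        rw [← map_one f]
        exact congrArg f (Subtype.ext (one_pow _))
      map_mul' := fun a b => by
        rw [← map_mul f]
        exact congrArg f (Subtype.ext ((hZ a a.2 b b.2).mul_pow _)) }
  obtain ⟨s, hs, hsfin, h⟩ := exists_finset_forall_eq_one
    {φ | ∃ M, ∃ f ∈ F M, φ = ψ M f}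
  choose M f hf hψ using fun i : s => hs i.2
  have := hsfin.to_subtype
  obtain ⟨M₀, -, hM₀⟩ := exists_forall_le M (ker (1 : G →* Equiv.Perm Unit))
  refine ⟨M₀, s, inferInstance, M, hM₀, f, hf, fun z hz hz₀ h1 N g hg n hn => ?_⟩
  by_contra hne
  have h2 : ψ N g ⟨z, hz⟩ = 1 := by
    refine h ⟨z, hz⟩ (fun φ hφ => ?_) _ ⟨N, g, hg, rfl⟩
    have h3 := hψ ⟨φ, hφ⟩
    rw [show φ = _ from h3]
    have h4 := congrArg (· ^ d (M ⟨φ, hφ⟩)) (h1 ⟨φ, hφ⟩ (mem_of_le (hM₀ _) hz₀))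
    rw [← map_pow, one_pow] at h4
    exact h4
  have h3 : g ⟨z ^ n, hn⟩ ^ d N = 1 := by
    have h4 : g ⟨z ^ d N, hpow N z⟩ = 1 := h2
    rw [← map_pow]
    have h5 : (⟨z ^ n, hn⟩ : N.toSubgroup) ^ d N = ⟨z ^ d N, hpow N z⟩ ^ n :=
      Subtype.ext (by simp [← pow_mul, mul_comm])
    rw [h5, map_pow, h4, one_pow]
  have h6 := congrArg Multiplicative.toAdd h3
  rw [toAdd_pow, toAdd_one, smul_eq_zero] at h6
  exact hne (Multiplicative.toAdd.injective (h6.resolve_left (hd N)))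

end FiniteIndexNormalSubgroup

namespace RAAG

open FiniteIndexNormalSubgroup

universe u

variable {V : Type u} {Γ : SimpleGraph V}

theorem exists_hom_ne_one [Finite V] {z : RAAG Γ} (hz : z ≠ 1) :
    ∃ (M : FiniteIndexNormalSubgroup (RAAG Γ)) (f : M.toSubgroup →* Multiplicative ℤ) (n : ℕ)
      (h : z ^ n ∈ M), f ⟨z ^ n, h⟩ ≠ 1 := by
  obtain ⟨v, hv⟩ : ∃ v, ∀ g, ret Γ {v}ᶜ (g * z * g⁻¹) ≠ g * z * g⁻¹ := by
    by_contra! hcon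
    exact hz (exists_conj_ret_compl hcon)
  obtain ⟨N, -, hN⟩ := exists_foxMod_pow_ne_zero hv (ker (1 : RAAG Γ →* Equiv.Perm Unit))
  obtain ⟨r, hr, hrN⟩ := exists_pow_mem N z
  obtain ⟨y, hy⟩ := hN N le_rfl r hr.ne' hrN
  let f : N.toSubgroup →* Multiplicative ℤ :=
    { toFun := fun a => Multiplicative.ofAdd (foxMod v N a y)
      map_one' := by simp [foxMod_one]
      map_mul' := fun a b => by
        rw [Subgroup.coe_mul, foxMod_mul, smul_eq_of_mem (inv_mem a.2), ofAdd_add] }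
  exact ⟨N, f, r, hrN, fun h => hy (Multiplicative.ofAdd.injective h)⟩

/-- Deep elements of an abelian subgroup are proper powers in it. -/
theorem exists_forall_mem_eq_pow [Finite V] {Z : Subgroup (RAAG Γ)}
    (hZ : ∀ a ∈ Z, ∀ b ∈ Z, Commute a b) {q : ℕ} (hq : q ≠ 0) :
    ∃ K : FiniteIndexNormalSubgroup (RAAG Γ), ∀ z ∈ Z, z ∈ K → ∃ w ∈ Z, z = w ^ q := by
  have := fg_of_forall_commute hZ
  obtain ⟨M₀, ι, _, M, hM, f, -, hf⟩ := exists_finite_detect hZ fun _ => Set.univ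
  have hZ₁ : ∀ a ∈ Z ⊓ M₀.toSubgroup, ∀ b ∈ Z ⊓ M₀.toSubgroup, Commute a b :=
    fun a ha b hb => hZ a ha.1 b hb.1
  have := fg_of_forall_commute hZ₁
  let g : ι → M₀.toSubgroup →* Multiplicative ℤ := fun i => (f i).comp (Subgroup.inclusion (hM i))
  let β : ι → (Z ⊓ M₀.toSubgroup : Subgroup (RAAG Γ)) →* Multiplicative ℤ := fun i =>
    (g i).comp (Subgroup.inclusion inf_le_right)
  obtain ⟨m, hm, hmod⟩ := exists_modulus_of_commute
    (fun a b => Subtype.ext (hZ₁ a a.2 b b.2).eq) β 0 hq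
  obtain ⟨K, hK, hdvd⟩ := exists_forall_forall_dvd g hm
  refine ⟨K, fun z hz hzK => ?_⟩
  obtain ⟨ε, w, h1, h2⟩ := hmod ⟨z, hz, mem_of_le hK hzK⟩ fun i => by
    rw [Pi.zero_apply, sub_zero]
    exact hdvd i z (mem_of_le hK hzK) hzK
  have hε : (ε : RAAG Γ) = 1 := by
    by_contra hne
    obtain ⟨N, f', n, hn, hne⟩ := exists_hom_ne_one hne
    exact hne (hf ε ε.2.1 ε.2.2 (fun i _ => Multiplicative.toAdd.injective (h2 i)) N f' trivial n hn)
  refine ⟨w, w.2.1, ?_⟩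
  have h3 := congrArg (Subtype.val) h1
  simpa [hε] using h3

/-- The homomorphism measuring the effect of `x` on `h` by conjugation. -/
def _root_.FiniteIndexNormalSubgroup.commHom {G : Type*} [Group G]
    {M : FiniteIndexNormalSubgroup G} (f : M.toSubgroup →* Multiplicative ℤ) (h : G) :
    M.toSubgroup →* Multiplicative ℤ :=
  f / f.comp (MulAut.conjNormal h).toMonoidHom

theorem _root_.FiniteIndexNormalSubgroup.commHom_apply {G : Type*} [Group G]
    {M : FiniteIndexNormalSubgroup G} (f : M.toSubgroup →* Multiplicative ℤ) (h : G) {x : G}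
    (hx : x ∈ M) : commHom f h ⟨x, hx⟩ = f ⟨x, hx⟩ / f ⟨h * x * h⁻¹, M.conj_mem hx h⟩ := by
  change _ / f _ = _
  congr 2

theorem exists_finite_detect_commute [Finite V] {Z : Subgroup (RAAG Γ)}
    (hZ : ∀ a ∈ Z, ∀ b ∈ Z, Commute a b) {J : Type*} (h : J → RAAG Γ) :
    ∃ (M : FiniteIndexNormalSubgroup (RAAG Γ)) (ι : Type u) (_ : Finite ι) (j : ι → J)
      (f : ι → M.toSubgroup →* Multiplicative ℤ), ∀ z ∈ Z, ∀ hz : z ∈ M,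
      (∀ i, commHom (f i) (h (j i)) ⟨z, hz⟩ = 1) → ∀ j, Commute (h j) z := by
  have := fg_of_forall_commute hZ
  obtain ⟨M₀, ι, _, M, hM, f, hf, hdet⟩ := exists_finite_detect hZ
    fun _ => {g | ∃ j f, g = commHom f (h j)}
  choose j f' hf' using hf
  refine ⟨M₀, ι, inferInstance, j, fun i => (f' i).comp (Subgroup.inclusion (hM i)),
    fun z hz hz₀ h1 k => ?_⟩
  by_contra hne
  obtain ⟨N, g, n, hn, hne⟩ := exists_hom_ne_of_not_commute hne
  have h2 := hdet z hz hz₀ (fun i hi => by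
    rw [hf' i, commHom_apply]
    have h3 := h1 i
    rw [commHom_apply] at h3
    exact h3) N _ ⟨k, g, rfl⟩ n hn
  rw [commHom_apply, div_eq_one] at h2
  exact hne h2.symm

end RAAG

namespace RAAG

open FiniteIndexNormalSubgroup

universe u

variable {V : Type u} {Γ : SimpleGraph V}

theorem exists_conj_of_le [Finite V] {Z : Subgroup (RAAG Γ)}
    (hZ : ∀ a ∈ Z, ∀ b ∈ Z, Commute a b) {J : Type*} (h h' : J → RAAG Γ)
    {M : FiniteIndexNormalSubgroup (RAAG Γ)} (hM : Z ≤ M.toSubgroup) {ι : Type*} [Finite ι]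
    (j : ι → J) (f : ι → M.toSubgroup →* Multiplicative ℤ)
    (hdet : ∀ z (hz : z ∈ Z), (∀ i, commHom (f i) (h (j i)) ⟨z, hM hz⟩ = 1) →
      ∀ j, Commute (h j) z) (K : FiniteIndexNormalSubgroup (RAAG Γ)) :
    ∃ N : FiniteIndexNormalSubgroup (RAAG Γ), ∀ x ∈ Z, (∀ j, x * h j * x⁻¹ * (h' j)⁻¹ ∈ N) →
      ∃ ε ∈ Z, (∀ j, ε * h j * ε⁻¹ = h' j) ∧ ε⁻¹ * x ∈ K := by
  have := fg_of_forall_commute hZ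
  by_cases hh : ∀ j, h' j * (h j)⁻¹ ∈ M
  swap
  · push Not at hh
    obtain ⟨k, hk⟩ := hh
    refine ⟨M, fun x hx hxM => (hk ?_).elim⟩
    have h1 : x * (h k * x⁻¹ * (h k)⁻¹) ∈ M :=
      mul_mem (hM hx) (M.conj_mem (inv_mem (hM hx)) _)
    have h2 := mul_mem (inv_mem (hxM k)) h1
    rwa [show (x * h k * x⁻¹ * (h' k)⁻¹)⁻¹ * (x * (h k * x⁻¹ * (h k)⁻¹)) = h' k * (h k)⁻¹ by
      group] at h2
  let β : ι → Z →* Multiplicative ℤ := fun i =>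
    (commHom (f i) (h (j i))).comp (Subgroup.inclusion hM)
  let t : ι → ℤ := fun i => Multiplicative.toAdd (f i ⟨h' (j i) * (h (j i))⁻¹, hh (j i)⟩)
  obtain ⟨K', hK', hgood⟩ : ∃ K' ≤ K, ∀ ε₀ : Z, (∀ i, Multiplicative.toAdd (β i ε₀) = t i) →
      (∀ j, ε₀ * h j * (ε₀ : RAAG Γ)⁻¹ * (h' j)⁻¹ ∈ K') → ∀ j, ε₀ * h j * (ε₀ : RAAG Γ)⁻¹ = h' j := by
    by_cases hε : ∃ ε₁ : Z, ∀ i, Multiplicative.toAdd (β i ε₁) = t i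
    swap
    · exact ⟨K, le_rfl, fun ε₀ h0 => (hε ⟨ε₀, h0⟩).elim⟩
    obtain ⟨ε₁, hε₁⟩ := hε
    have heq : ∀ ε₀ : Z, (∀ i, Multiplicative.toAdd (β i ε₀) = t i) →
        ∀ j, ε₀ * h j * (ε₀ : RAAG Γ)⁻¹ = ε₁ * h j * (ε₁ : RAAG Γ)⁻¹ := fun ε₀ h0 k => by
      have h1 := hdet (ε₀⁻¹ * ε₁ : Z) (ε₀⁻¹ * ε₁ : Z).2 (fun i => by
        change β i (ε₀⁻¹ * ε₁) = 1
        rw [map_mul, map_inv, inv_mul_eq_one]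
        exact Multiplicative.toAdd.injective ((h0 i).trans (hε₁ i).symm)) k
      have h2 := h1.eq
      rw [Subgroup.coe_mul, Subgroup.coe_inv] at h2
      rw [show (ε₁ : RAAG Γ) * h k * (ε₁ : RAAG Γ)⁻¹ =
        ε₀ * ((ε₀ : RAAG Γ)⁻¹ * ε₁ * h k) * (ε₁ : RAAG Γ)⁻¹ by group, ← h2]
      group
    by_cases hex : ∀ j, ε₁ * h j * (ε₁ : RAAG Γ)⁻¹ = h' j
    · exact ⟨K, le_rfl, fun ε₀ h0 _ k => (heq ε₀ h0 k).trans (hex k)⟩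
    · push Not at hex
      obtain ⟨k, hk⟩ := hex
      obtain ⟨N, hN⟩ := exists_notMem (mt mul_inv_eq_one.1 hk)
      refine ⟨N ⊓ K, inf_le_right, fun ε₀ h0 h1 => (hN ?_).elim⟩
      rw [← heq ε₀ h0]
      exact mem_of_le inf_le_left (h1 k)
  obtain ⟨q, hq, hqK⟩ := exists_forall_pow_mem K'
  obtain ⟨m, hm, hmod⟩ := exists_modulus_of_commute
    (fun a b => Subtype.ext (hZ a a.2 b b.2).eq) β t hq
  obtain ⟨N, hN, hdvd⟩ := exists_forall_forall_dvd f hm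
  refine ⟨N ⊓ K', fun x hx hxN => ?_⟩
  obtain ⟨ε, w, h1, h2⟩ := hmod ⟨x, hx⟩ fun i => by
    have h3 := hdvd i _ (mem_of_le hN (mem_of_le inf_le_left (hxN (j i))))
      (mem_of_le inf_le_left (hxN (j i)))
    have h4 : (⟨x * h (j i) * x⁻¹ * (h' (j i))⁻¹, mem_of_le hN (mem_of_le inf_le_left (hxN (j i)))⟩
        : M.toSubgroup) = ⟨x, hM hx⟩ * ⟨h (j i) * x * (h (j i))⁻¹, M.conj_mem (hM hx) _⟩⁻¹ *
          ⟨h' (j i) * (h (j i))⁻¹, hh (j i)⟩⁻¹ := Subtype.ext (by simp; group)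
    rw [h4, map_mul (f i), map_mul (f i), map_inv (f i), map_inv (f i)] at h3
    convert h3 using 1
    change Multiplicative.toAdd (commHom (f i) (h (j i)) ⟨x, hM hx⟩) - _ = _
    rw [commHom_apply, toAdd_mul, toAdd_mul, toAdd_inv, toAdd_inv, toAdd_div]
    simp only [t]
    abel
  have h3 : (ε : RAAG Γ)⁻¹ * x ∈ K' := by
    have h4 : x = ε * (w : RAAG Γ) ^ q := congrArg Subtype.val h1
    rw [h4, inv_mul_cancel_left]
    exact hqK w
  refine ⟨ε, ε.2, hgood ε h2 fun k => ?_, mem_of_le hK' h3⟩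
  have h4 : quot K' ε = quot K' x := quot_eq.2 h3
  have h5 : quot K' (x * h k * x⁻¹ * (h' k)⁻¹) = 1 := quot_eq_one.2 (mem_of_le inf_le_right (hxN k))
  refine quot_eq_one.1 ?_
  rwa [map_mul, map_mul, map_mul, map_inv, map_inv, ← h4, ← map_inv, ← map_inv, ← map_mul,
    ← map_mul, ← map_mul] at h5

theorem _root_.FiniteIndexNormalSubgroup.exists_finite_reps {G : Type*} [Group G]
    (M : FiniteIndexNormalSubgroup G) (Z : Subgroup G) :
    ∃ T : Set G, T.Finite ∧ T ⊆ Z ∧ ∀ x ∈ Z, ∃ s ∈ T, s⁻¹ * x ∈ M := by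
  have := M.isFiniteIndex'
  choose g hg hmk using fun c : (QuotientGroup.mk '' (Z : Set G) : Set (G ⧸ M.toSubgroup)) => c.2
  refine ⟨Set.range g, Set.finite_range g, Set.range_subset_iff.2 hg, fun x hx => ?_⟩
  exact ⟨_, ⟨⟨_, x, hx, rfl⟩, rfl⟩, QuotientGroup.eq.1 (hmk ⟨_, x, hx, rfl⟩)⟩

/-- Approximate simultaneous conjugacy under an abelian subgroup comes from conjugacy. -/
theorem exists_conj [Finite V] {Z : Subgroup (RAAG Γ)}
    (hZ : ∀ a ∈ Z, ∀ b ∈ Z, Commute a b) {J : Type*} (h h' : J → RAAG Γ)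
    (K : FiniteIndexNormalSubgroup (RAAG Γ)) :
    ∃ N : FiniteIndexNormalSubgroup (RAAG Γ), ∀ x ∈ Z, (∀ j, x * h j * x⁻¹ * (h' j)⁻¹ ∈ N) →
      ∃ ε ∈ Z, (∀ j, ε * h j * ε⁻¹ = h' j) ∧ ε⁻¹ * x ∈ K := by
  obtain ⟨M, ι, _, j, f, hdet⟩ := exists_finite_detect_commute hZ h
  obtain ⟨T, hT, hTZ, hrep⟩ := M.exists_finite_reps Z
  obtain ⟨N, -, hN⟩ := exists_forall_of_finite hT
    (p := fun s N => ∀ x ∈ Z ⊓ M.toSubgroup, (∀ j, x * h j * x⁻¹ * (s⁻¹ * h' j * s)⁻¹ ∈ N) →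
      ∃ ε ∈ Z ⊓ M.toSubgroup, (∀ j, ε * h j * ε⁻¹ = s⁻¹ * h' j * s) ∧ ε⁻¹ * x ∈ K)
    (fun s N N' hle hs x hx hxN => hs x hx fun j => mem_of_le hle (hxN j))
    (fun s hs => exists_conj_of_le (Z := Z ⊓ M.toSubgroup) (fun a ha b hb => hZ a ha.1 b hb.1) h (fun j => s⁻¹ * h' j * s)
      inf_le_right j f (fun z hz => hdet z hz.1 hz.2) K) K
  refine ⟨N, fun x hx hxN => ?_⟩
  obtain ⟨s, hs, hsx⟩ := hrep x hx
  obtain ⟨ε, hε, h1, h2⟩ := hN s hs (s⁻¹ * x) ⟨Z.mul_mem (Z.inv_mem (hTZ hs)) hx, hsx⟩ fun k => by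
    have h3 := N.conj_mem (hxN k) s⁻¹
    rwa [show s⁻¹ * (x * h k * x⁻¹ * (h' k)⁻¹) * s⁻¹⁻¹ =
      s⁻¹ * x * h k * (s⁻¹ * x)⁻¹ * (s⁻¹ * h' k * s)⁻¹ by group] at h3
  refine ⟨s * ε, mul_mem (hTZ hs) hε.1, fun k => ?_, ?_⟩
  · rw [show s * ε * h k * (s * ε)⁻¹ = s * (ε * h k * ε⁻¹) * s⁻¹ by group, h1 k]
    group
  · rwa [mul_inv_rev, mul_assoc]

end RAAG

namespace FiniteIndexNormalSubgroup

variable {G : Type*} [Group G]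

/-- The automorphism `φ` is conjugation by `c` modulo `N`. -/
def IsConjMod (N : FiniteIndexNormalSubgroup G) (φ : MulAut G) (c : G) : Prop :=
  ∀ g, quot N (φ g) = quot N (c * g * c⁻¹)

theorem IsConjMod.of_le {N N' : FiniteIndexNormalSubgroup G} {φ : MulAut G} {c : G} (h : N' ≤ N)
    (hc : N'.IsConjMod φ c) : N.IsConjMod φ c := fun g => quot_eq_of_le h (hc g)

theorem IsConjMod.conj_mul {N : FiniteIndexNormalSubgroup G} {φ : MulAut G} {c : G}
    (hc : N.IsConjMod φ c) (s : G) : N.IsConjMod (MulAut.conj s * φ) (s * c) := fun g => by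
  rw [MulAut.mul_apply, MulAut.conj_apply, map_mul, map_mul, hc g, ← map_mul, ← map_mul]
  congr 1
  group

/-- Some coset of `H` contains conjugating elements modulo every finite index normal subgroup. -/
theorem exists_coset_isConjMod {H : Subgroup G} (hH : H.index ≠ 0) {φ : MulAut G}
    (hφ : ∀ N : FiniteIndexNormalSubgroup G, ∃ c, N.IsConjMod φ c) :
    ∃ s, ∀ N : FiniteIndexNormalSubgroup G, ∃ c ∈ H, N.IsConjMod φ (s * c) := by
  by_contra! hcon
  have : H.FiniteIndex := ⟨hH⟩
  choose N hN using hcon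
  obtain ⟨N', -, hN'⟩ := exists_forall_le (fun x : G ⧸ H => N x.out) (N 1)
  obtain ⟨c, hc⟩ := hφ N'
  refine hN (c : G ⧸ H).out ((c : G ⧸ H).out⁻¹ * c) (QuotientGroup.eq.1 ?_) ?_
  · rw [QuotientGroup.out_eq']
  · rw [mul_inv_cancel_left]
    exact hc.of_le (hN' _)

theorem exists_forall_map_mem {G' : Type*} [Group G'] {K : Subgroup G} (hK : K.index ≠ 0)
    (f : K →* G') (N : FiniteIndexNormalSubgroup G') : ∃ M : FiniteIndexNormalSubgroup G,
      M.toSubgroup ≤ K ∧ ∀ a : K, (a : G) ∈ M → f a ∈ N := by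
  have h1 : ((comap f N).toSubgroup.map K.subtype).index ≠ 0 := by
    rw [Subgroup.index_map_subtype]
    exact mul_ne_zero (comap f N).isFiniteIndex'.index_ne_zero hK
  have : ((comap f N).toSubgroup.map K.subtype).FiniteIndex := ⟨h1⟩
  refine ⟨ofSubgroup ((comap f N).toSubgroup.map K.subtype).normalCore, ?_, fun a ha => ?_⟩
  · exact (Subgroup.normalCore_le _).trans (Subgroup.map_subtype_le _)
  · obtain ⟨b, hb, hba⟩ := Subgroup.normalCore_le _ ha
    obtain rfl := Subtype.ext hba
    exact hb

end FiniteIndexNormalSubgroup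

/-- Conjugacy of homomorphisms to a group. -/
def MonoidHom.conjSetoid (G F : Type*) [Group G] [Group F] : Setoid (G →* F) where
  r ψ ψ' := ∃ c, ∀ g, ψ' g = c * ψ g * c⁻¹
  iseqv :=
    { refl := fun ψ => ⟨1, fun g => by group⟩
      symm := fun {ψ ψ'} ⟨c, hc⟩ => ⟨c⁻¹, fun g => by rw [hc]; group⟩
      trans := fun {ψ ψ' ψ''} ⟨c, hc⟩ ⟨d, hd⟩ => ⟨d * c, fun g => by rw [hd, hc]; group⟩ }

/-- Automorphisms act on conjugacy classes of homomorphisms. -/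
@[reducible]
def MulAut.conjClassAction (G F : Type*) [Group G] [Group F] :
    MulAction (MulAut G) (Quotient (MonoidHom.conjSetoid G F)) where
  smul α := Quotient.map (fun ψ => ψ.comp (α⁻¹ : MulAut G).toMonoidHom)
    fun _ _ ⟨c, hc⟩ => ⟨c, fun g => hc _⟩
  one_smul x := by
    induction x using Quotient.inductionOn with | h ψ => rfl
  mul_smul α β x := by
    induction x using Quotient.inductionOn with | h ψ => rfl

theorem MonoidHom.finite_of_fg (G F : Type*) [Group G] [Group F] [Group.FG G] [Finite F] :
    Finite (G →* F) := by
  obtain ⟨s, hs⟩ := Group.fg_def.1 (inferInstance : Group.FG G)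
  refine Finite.of_injective (fun (f : G →* F) (x : s) => f x) fun f g h => ?_
  exact MonoidHom.eq_of_eqOn_dense hs fun x hx => congrFun h ⟨x, hx⟩

open FiniteIndexNormalSubgroup in
theorem residuallyFinite_outerAut {G : Type*} [Group G] [Group.FG G]
    (h : ∀ φ : MulAut G, (∀ N : FiniteIndexNormalSubgroup G, ∃ c, N.IsConjMod φ c) →
      φ ∈ (MulAut.conj : G →* MulAut G).range) : ResiduallyFinite (OuterAut G) := by
  intro k hk
  induction k using QuotientGroup.induction_on with | H φ => ?_
  have h1 : φ ∉ (MulAut.conj : G →* MulAut G).range := fun h1 =>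
    hk ((QuotientGroup.eq_one_iff φ).2 h1)
  have h2 := mt (h φ) h1
  push Not at h2
  obtain ⟨N, hN⟩ := h2
  have := N.isFiniteIndex'
  have := N.isNormal'
  have : Finite (G ⧸ N.toSubgroup) := Subgroup.finite_quotient_of_finiteIndex
  have := MonoidHom.finite_of_fg G (G ⧸ N.toSubgroup)
  let _ := MulAut.conjClassAction G (G ⧸ N.toSubgroup)
  obtain ⟨n, ⟨e⟩⟩ := Finite.exists_equiv_fin (Quotient (MonoidHom.conjSetoid G (G ⧸ N.toSubgroup)))
  let ρ := (e.permCongrHom.toMonoidHom).comp (MulAction.toPermHom (MulAut G)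
    (Quotient (MonoidHom.conjSetoid G (G ⧸ N.toSubgroup))))
  have hρ : (MulAut.conj : G →* MulAut G).range ≤ ρ.ker := by
    rintro _ ⟨g, rfl⟩
    refine MonoidHom.mem_ker.2 ?_
    suffices h3 : MulAction.toPermHom (MulAut G)
        (Quotient (MonoidHom.conjSetoid G (G ⧸ N.toSubgroup))) (MulAut.conj g) = 1 by
      change e.permCongrHom _ = 1
      rw [h3, map_one]
    refine Equiv.ext fun x => ?_
    induction x using Quotient.inductionOn with | h ψ => ?_
    refine Quotient.sound ⟨ψ g, fun a => ?_⟩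
    change ψ a = ψ g * ψ ((MulAut.conj g)⁻¹ a) * (ψ g)⁻¹
    rw [← map_inv MulAut.conj, ← map_mul ψ, ← map_inv ψ, ← map_mul ψ, MulAut.conj_apply]
    congr 1
    group
  refine ⟨Equiv.Perm (Fin n), inferInstance, inferInstance, QuotientGroup.lift _ ρ hρ, fun h3 => ?_⟩
  have h4 : ρ φ = 1 := h3
  have h5 : ρ φ⁻¹ = 1 := by rw [map_inv, h4, inv_one]
  have h6 : MulAction.toPermHom (MulAut G)
      (Quotient (MonoidHom.conjSetoid G (G ⧸ N.toSubgroup))) φ⁻¹ = 1 :=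
    e.permCongrHom.injective (h5.trans (map_one _).symm)
  have h7 := DFunLike.congr_fun h6 ⟦quot N⟧
  obtain ⟨c, hc⟩ := Quotient.exact h7.symm
  obtain ⟨c, rfl⟩ := QuotientGroup.mk'_surjective _ c
  refine hN c fun g => ?_
  rw [map_mul, map_mul, map_inv]
  exact hc g

/-- An embedding of `H` in `A` whose image is a retract of a finite index subgroup. -/
structure VirtualRetraction (H A : Type*) [Group H] [Group A] where
  /-- The finite index subgroup. -/
  dom : Subgroup A
  index_dom : dom.index ≠ 0
  /-- The embedding. -/
  incl : H →* dom
  /-- The retraction. -/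
  retr : dom →* H
  retr_incl : ∀ h, retr (incl h) = h

namespace VirtualRetraction

variable {H A : Type*} [Group H] [Group A]

theorem nonempty_of_isVirtualRetract {R : Subgroup A} (hR : IsVirtualRetract R) :
    Nonempty (VirtualRetraction R A) := by
  obtain ⟨K, hK, hindex, r, hr⟩ := hR
  exact ⟨⟨K, hindex, Subgroup.inclusion hK, r, hr⟩⟩

theorem nonempty_of_injective (ρ : VirtualRetraction H A) {H₀ : Type*} [Group H₀] {j : H₀ →* H}
    (hj : Function.Injective j) (hindex : j.range.index ≠ 0) :
    Nonempty (VirtualRetraction H₀ A) := by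
  have e := (j.range.comap ρ.retr).equivMapOfInjective ρ.dom.subtype ρ.dom.subtype_injective
  refine ⟨⟨(j.range.comap ρ.retr).map ρ.dom.subtype, ?_, e.toMonoidHom.comp
    ((ρ.incl.comp j).codRestrict _ fun h => ⟨h, (ρ.retr_incl (j h)).symm⟩),
    (MonoidHom.ofInjective hj).symm.toMonoidHom.comp
      ((ρ.retr.subgroupComap j.range).comp e.symm.toMonoidHom), fun h => ?_⟩⟩
  · rw [Subgroup.index_map_subtype,
      Subgroup.index_comap_of_surjective _ fun h => ⟨_, ρ.retr_incl h⟩]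
    exact mul_ne_zero hindex ρ.index_dom
  · simp only [MonoidHom.comp_apply, MulEquiv.coe_toMonoidHom, MulEquiv.symm_apply_apply]
    refine (MulEquiv.symm_apply_eq _).2 (Subtype.ext ?_)
    exact ρ.retr_incl (j h)

theorem fg (ρ : VirtualRetraction H A) [Group.FG A] : Group.FG H :=
  have : ρ.dom.FiniteIndex := ⟨ρ.index_dom⟩
  Group.fg_of_surjective (f := ρ.retr) fun h => ⟨_, ρ.retr_incl h⟩

/-- The embedding of `H` in `A`. -/
def emb (ρ : VirtualRetraction H A) : H →* A := ρ.dom.subtype.comp ρ.incl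

theorem emb_injective (ρ : VirtualRetraction H A) : Function.Injective ρ.emb :=
  ρ.dom.subtype_injective.comp (Function.LeftInverse.injective ρ.retr_incl)

end VirtualRetraction

namespace RAAG

open FiniteIndexNormalSubgroup

universe u

variable {V : Type u} {Γ : SimpleGraph V}

/-- Approximate simultaneous conjugators of commuting elements are close to conjugators. -/
theorem exists_conjugator [Finite V] {J : Type*} [Finite J] {k k' : J → RAAG Γ}
    (hk : ∀ i j, Commute (k i) (k j)) (M : FiniteIndexNormalSubgroup (RAAG Γ)) :
    ∃ N : FiniteIndexNormalSubgroup (RAAG Γ), ∀ x, (∀ j, quot N (x * k j) = quot N (k' j * x)) →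
      ∃ a, (∀ j, a * k j = k' j * a) ∧ a⁻¹ * x ∈ M := by
  let E : J → Eqn Γ := fun j => ⟨Set.univ, k j, k' j⟩
  have hadm : Eqn.Admissible Set.univ (Set.range E) := by
    refine ⟨?_, ?_⟩
    · rintro _ ⟨j, rfl⟩ h
      exact (h subset_rfl).elim
    · rintro _ ⟨j, rfl⟩ _ ⟨j', rfl⟩ - -
      rw [ret_univ, ret_univ]
      exact hk j j'
  obtain ⟨N, hN⟩ := Eqn.approximable Set.univ (Set.range E) (Set.finite_range E) hadm M
  refine ⟨N, fun x hx => ?_⟩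
  obtain ⟨a, -, h1, h2⟩ := hN x (ret_univ x) (by
    rintro _ ⟨j, rfl⟩
    change quot N _ = quot N (_ * ret Γ Set.univ x)
    rw [ret_univ]
    exact hx j)
  refine ⟨a, fun j => ?_, h2⟩
  have h3 : a * k j = k' j * ret Γ Set.univ a := h1 _ ⟨j, rfl⟩
  rwa [ret_univ] at h3

end RAAG

section

open FiniteIndexNormalSubgroup RAAG

universe u

variable {V : Type u} {Γ : SimpleGraph V} {G : Type*} [Group G] {H : Subgroup G}

theorem FiniteIndexNormalSubgroup.IsConjMod.map_mem [H.Normal] {N : FiniteIndexNormalSubgroup G}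
    (hN : N.toSubgroup ≤ H) {φ : MulAut G} {c : G} (hc : N.IsConjMod φ c) {h : G} (hh : h ∈ H) :
    φ h ∈ H := by
  have h1 := hN (quot_eq.1 (hc h))
  have h2 : (φ h)⁻¹ ∈ H := by
    have := H.mul_mem h1 (H.inv_mem (Subgroup.Normal.conj_mem ‹_› h hh c))
    rwa [mul_inv_cancel_right] at this
  exact inv_mem_iff.1 h2

theorem FiniteIndexNormalSubgroup.IsConjMod.quot_map {A : Type*} [Group A] {f : H →* A}
    {N : FiniteIndexNormalSubgroup G} {M : FiniteIndexNormalSubgroup A}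
    (hf : ∀ h : H, (h : G) ∈ N → f h ∈ M) {φ : MulAut G} {c : H} (hc : N.IsConjMod φ c) {h h' : H}
    (hh : φ h = h') : quot M (f h') = quot M (f (c * h * c⁻¹)) := by
  refine quot_eq.2 ?_
  rw [← map_inv, ← map_mul]
  refine hf _ ?_
  have := quot_eq.1 (hc h)
  rwa [hh] at this

theorem VirtualRetraction.exists_finset_closure_eq [Finite V]
    (ρ : VirtualRetraction H (RAAG Γ)) {Z : Subgroup H} (hZ : ∀ a ∈ Z, ∀ b ∈ Z, Commute a b) :
    ∃ t : Finset H, Subgroup.closure (t : Set H) = Z := by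
  have h1 : Group.FG (Z.map ρ.emb) := fg_of_forall_commute (by
    rintro _ ⟨a, ha, rfl⟩ _ ⟨b, hb, rfl⟩
    exact (hZ a ha b hb).map ρ.emb)
  have e := Z.equivMapOfInjective ρ.emb ρ.emb_injective
  exact (Group.fg_iff_subgroup_fg Z).1 (Group.fg_of_surjective (f := e.symm.toMonoidHom)
    e.symm.surjective)

theorem VirtualRetraction.exists_conj_of_isConjMod [Finite V] [H.Normal] (hH : H.index ≠ 0)
    (ρ : VirtualRetraction H (RAAG Γ)) {φ : MulAut G}
    (hφ : ∀ N : FiniteIndexNormalSubgroup G, ∃ c ∈ H, N.IsConjMod φ c)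
    {Z : Subgroup H} (hZ : ∀ a ∈ Z, ∀ b ∈ Z, Commute a b) :
    ∃ c : H, ∀ z ∈ Z, φ z = c * z * (c : G)⁻¹ := by
  obtain ⟨t, rfl⟩ := ρ.exists_finset_closure_eq hZ
  have hφH : ∀ h : H, φ h ∈ H := fun h => by
    obtain ⟨N, hN, -⟩ := exists_forall_map_mem hH (1 : H →* RAAG Γ) (ker (1 : _ →* Equiv.Perm Unit))
    obtain ⟨c, -, hc⟩ := hφ N
    exact hc.map_mem hN h.2
  obtain ⟨M, hM, -⟩ := exists_forall_map_mem ρ.index_dom ρ.retr (ker (1 : H →* Equiv.Perm Unit))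
  obtain ⟨P, hP⟩ := exists_conjugator (J := t) (k := fun z => ρ.emb z)
    (k' := fun z => ρ.emb ⟨φ z, hφH z⟩) (fun i j => (hZ _ (Subgroup.subset_closure i.2) _
      (Subgroup.subset_closure j.2)).map ρ.emb) M
  obtain ⟨N, -, hN⟩ := exists_forall_map_mem hH ρ.emb P
  obtain ⟨c, hcH, hc⟩ := hφ N
  obtain ⟨a, ha, haM⟩ := hP (ρ.emb ⟨c, hcH⟩) fun z => by
    have h1 := IsConjMod.quot_map (c := ⟨c, hcH⟩) hN hc (h := z) (h' := ⟨φ z, hφH z⟩) rfl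
    rw [map_mul (quot P) (ρ.emb ⟨φ z, _⟩), h1, ← map_mul, ← map_mul, ← map_mul,
      inv_mul_cancel_right]
  have hadom : a ∈ ρ.dom := by
    have h1 := ρ.dom.mul_mem (ρ.incl ⟨c, hcH⟩).2 (ρ.dom.inv_mem (hM haM))
    change ρ.emb ⟨c, hcH⟩ * _ ∈ _ at h1
    rwa [mul_inv_rev, inv_inv, mul_inv_cancel_left] at h1
  refine ⟨ρ.retr ⟨a, hadom⟩, fun z hz => ?_⟩
  suffices h1 : Subgroup.closure (t : Set H) ≤ (φ.toMonoidHom.comp H.subtype).eqLocus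
      ((MulAut.conj (ρ.retr ⟨a, hadom⟩ : G)).toMonoidHom.comp H.subtype) from h1 hz
  refine (Subgroup.closure_le _).2 fun z hz => ?_
  have h2 : (⟨a, hadom⟩ : ρ.dom) * ρ.incl z = ρ.incl ⟨φ z, hφH z⟩ * ⟨a, hadom⟩ :=
    Subtype.ext (ha ⟨z, hz⟩)
  have h3 := congrArg (fun x => (ρ.retr x : G)) h2
  simp only [map_mul, ρ.retr_incl, Subgroup.coe_mul] at h3
  exact eq_mul_inv_of_mul_eq h3.symm

theorem VirtualRetraction.exists_conj_of_forall_eq [Finite V] [H.Normal] (hH : H.index ≠ 0)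
    (ρ : VirtualRetraction H (RAAG Γ)) {φ : MulAut G} (hφH : ∀ h : H, φ h ∈ H)
    {Z : Subgroup H} (hZ : ∀ a ∈ Z, ∀ b ∈ Z, Commute a b)
    (hZmax : ∀ h, (∀ z ∈ Z, Commute h z) → h ∈ Z) (hφZ : ∀ z ∈ Z, φ z = z)
    (M : FiniteIndexNormalSubgroup (RAAG Γ)) :
    ∃ N : FiniteIndexNormalSubgroup G, ∀ c : H, N.IsConjMod φ c →
      ∃ ζ ∈ Z, (∀ h : H, φ h = ζ * h * (ζ : G)⁻¹) ∧ (ρ.emb ζ)⁻¹ * ρ.emb c ∈ M := by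
  obtain ⟨t, rfl⟩ := ρ.exists_finset_closure_eq hZ
  set Z := Subgroup.closure (t : Set H) with hZdef
  obtain ⟨Q, hQ⟩ := exists_conj (Z := Z.map ρ.emb) (by
    rintro _ ⟨a, ha, rfl⟩ _ ⟨b, hb, rfl⟩
    exact (hZ a ha b hb).map ρ.emb) (fun h : H => ρ.emb h) (fun h => ρ.emb ⟨φ h, hφH h⟩) M
  obtain ⟨M', hM', hretr⟩ := exists_forall_map_mem ρ.index_dom (ρ.emb.comp ρ.retr) (Q ⊓ M)
  obtain ⟨P, hP⟩ := exists_conjugator (J := t) (k := fun z => ρ.emb z)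
    (k' := fun z => ρ.emb z) (fun i j => (hZ _ (Subgroup.subset_closure i.2) _
      (Subgroup.subset_closure j.2)).map ρ.emb) M'
  obtain ⟨N, -, hN⟩ := exists_forall_map_mem hH ρ.emb (P ⊓ Q)
  refine ⟨N, fun c hc => ?_⟩
  obtain ⟨a, ha, haM⟩ := hP (ρ.emb c) fun z => by
    have h1 := hc.quot_map hN (hφZ z (Subgroup.subset_closure z.2))
    replace h1 := quot_eq_of_le inf_le_left h1
    rw [map_mul (quot P) (ρ.emb z), h1, ← map_mul, ← map_mul, ← map_mul, inv_mul_cancel_right]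
  have hadom : a ∈ ρ.dom := by
    have h1 := ρ.dom.mul_mem (ρ.incl c).2 (ρ.dom.inv_mem (hM' haM))
    change ρ.emb c * _ ∈ _ at h1
    rwa [mul_inv_rev, inv_inv, mul_inv_cancel_left] at h1
  set y := ρ.retr ⟨a, hadom⟩ with hy
  have hyZ : y ∈ Z := by
    refine hZmax y fun z hz => ?_
    suffices h1 : Z ≤ Subgroup.centralizer {y} from
      (Subgroup.mem_centralizer_singleton_iff.1 (h1 hz)).symm
    refine (Subgroup.closure_le _).2 fun z hz => Subgroup.mem_centralizer_singleton_iff.2 ?_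
    have h2 : (⟨a, hadom⟩ : ρ.dom) * ρ.incl z = ρ.incl z * ⟨a, hadom⟩ := Subtype.ext (ha ⟨z, hz⟩)
    have h3 := congrArg ρ.retr h2
    rw [map_mul, map_mul, ρ.retr_incl] at h3
    exact h3.symm
  have hyc : (ρ.emb y)⁻¹ * ρ.emb c ∈ Q ⊓ M := by
    have h1 := hretr (⟨a, hadom⟩⁻¹ * ρ.incl c) haM
    rwa [MonoidHom.comp_apply, map_mul ρ.retr, map_inv, ρ.retr_incl, map_mul, map_inv] at h1
  obtain ⟨_, ⟨ζ, hζ, rfl⟩, h1, h2⟩ := hQ (ρ.emb y) ⟨y, hyZ, rfl⟩ fun h => by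
    have h3 := hc.quot_map hN (h := h) (h' := ⟨φ h, hφH h⟩) rfl
    replace h3 := quot_eq_of_le inf_le_right h3
    have h4 : quot Q (ρ.emb y) = quot Q (ρ.emb c) := quot_eq.2 (mem_of_le inf_le_left hyc)
    rw [← quot_eq_one, map_mul, map_mul, map_mul, map_inv, map_inv, h3, h4, mul_inv_eq_one,
      map_mul, map_mul, map_inv, map_mul, map_mul, map_inv]
  refine ⟨ζ, hζ, fun h => ?_, ?_⟩
  · have h3 := h1 h
    rw [← map_inv, ← map_mul, ← map_mul] at h3
    exact congrArg Subtype.val (ρ.emb_injective h3).symm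
  · have h3 := mul_mem h2 (mem_of_le inf_le_right hyc)
    rwa [mul_assoc, mul_inv_cancel_left] at h3

end

instance RAAG.instGroupFG {V : Type*} [Finite V] (Γ : SimpleGraph V) : Group.FG (RAAG Γ) :=
  Group.fg_of_surjective (f := PresentedGroup.mk (raagRels Γ)) (PresentedGroup.mk_surjective _)

/-- Every group contains a self-centralizing commutative subgroup. -/
theorem Subgroup.exists_maximal_commute (G : Type*) [Group G] :
    ∃ Z : Subgroup G, (∀ a ∈ Z, ∀ b ∈ Z, Commute a b) ∧
      ∀ h, (∀ z ∈ Z, Commute h z) → h ∈ Z := by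
  obtain ⟨s, hs⟩ := zorn_subset {s : Set G | ∀ a ∈ s, ∀ b ∈ s, Commute a b} (by
    intro c hc hchain
    refine ⟨⋃₀ c, ?_, fun t ht => Set.subset_sUnion_of_mem ht⟩
    rintro a ⟨t, ht, hat⟩ b ⟨t', ht', hbt⟩
    rcases hchain.total ht ht' with h | h
    · exact hc ht' a (h hat) b hbt
    · exact hc ht a hat b (h hbt))
  have hmax : ∀ h, (∀ z ∈ s, Commute h z) → h ∈ s := fun h hh => by
    refine hs.le_of_ge (y := insert h s) ?_ (Set.subset_insert h s) (Set.mem_insert h s)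
    rintro a (rfl | ha) b (rfl | hb)
    · exact Commute.refl _
    · exact hh b hb
    · exact (hh a ha).symm
    · exact hs.prop a ha b hb
  have hmem : ∀ h, h ∈ Subgroup.centralizer s ↔ h ∈ s := fun h =>
    ⟨fun hh => hmax h fun z hz => (Subgroup.mem_centralizer_iff.1 hh z hz).symm,
      fun hh => Subgroup.mem_centralizer_iff.2 fun z hz => hs.prop z hz h hh⟩
  refine ⟨Subgroup.centralizer s, fun a ha b hb => ?_, fun h hh => ?_⟩
  · exact hs.prop a ((hmem a).1 ha) b ((hmem b).1 hb)
  · exact (hmem h).2 (hmax h fun z hz => hh z ((hmem z).2 hz))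

theorem Subgroup.group_fg_of_normal {G : Type*} [Group G] {H : Subgroup G} [H.Normal]
    (hH : H.index ≠ 0) [Group.FG H] : Group.FG G := by
  have : H.FiniteIndex := ⟨hH⟩
  have : Finite (G ⧸ H) := Subgroup.finite_quotient_of_finiteIndex
  refine Group.fg_def.2 (Subgroup.fg_of_fg_map_of_fg_inf_ker (QuotientGroup.mk' H) ?_ ?_)
  · exact (Group.fg_iff_subgroup_fg _).1 inferInstance
  · rw [top_inf_eq, QuotientGroup.ker_mk']
    exact (Group.fg_iff_subgroup_fg _).1 inferInstance

section

open FiniteIndexNormalSubgroup RAAG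

universe u

variable {V : Type u} {Γ : SimpleGraph V} {G : Type*} [Group G] {H : Subgroup G}

/-- An automorphism which is trivial on `H` and close to conjugations by central elements of `H`
is inner. -/
theorem VirtualRetraction.mem_range_conj_of_forall_eq [Finite V] [H.Normal] (hH : H.index ≠ 0)
    (ρ : VirtualRetraction H (RAAG Γ)) {φ : MulAut G}
    (hφ : ∀ N : FiniteIndexNormalSubgroup G, ∃ c ∈ H, N.IsConjMod φ c)
    (hid : ∀ h : H, φ h = h)
    (hclose : ∀ M : FiniteIndexNormalSubgroup (RAAG Γ), ∃ N : FiniteIndexNormalSubgroup G,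
      ∀ c : H, N.IsConjMod φ c →
        ∃ ζ : H, (∀ h : H, Commute ζ h) ∧ (ρ.emb ζ)⁻¹ * ρ.emb c ∈ M) :
    φ ∈ (MulAut.conj : G →* MulAut G).range := by
  have : H.FiniteIndex := ⟨hH⟩
  have : Finite (G ⧸ H) := Subgroup.finite_quotient_of_finiteIndex
  let C : Subgroup G := H ⊓ Subgroup.centralizer H
  have hCH : C ≤ H := inf_le_left
  have hCcomm : ∀ a ∈ C, ∀ b ∈ H, Commute a b := fun a ha b hb =>
    (Subgroup.mem_centralizer_iff.1 ha.2 b hb).symm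
  let _ : CommGroup C :=
    { (inferInstance : Group C) with
      mul_comm := fun a b => Subtype.ext (hCcomm a a.2 b (hCH b.2)) }
  have hdC : ∀ g, φ g * g⁻¹ ∈ C := fun g => by
    refine ⟨?_, Subgroup.mem_centralizer_iff.2 fun h hh => ?_⟩
    · obtain ⟨N, hN, -⟩ :=
        exists_forall_map_mem hH (1 : H →* RAAG Γ) (ker (1 : _ →* Equiv.Perm Unit))
      obtain ⟨c, hcH, hc⟩ := hφ N
      have h1 : quot N (φ g * g⁻¹) = quot N (c * (g * c⁻¹ * g⁻¹)) := by
        rw [map_mul, hc g, ← map_mul]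
        simp only [mul_assoc]
      have h2 := H.mul_mem (H.mul_mem hcH
        (Subgroup.Normal.conj_mem ‹H.Normal› _ (H.inv_mem hcH) g)) (H.inv_mem (hN (quot_eq.1 h1)))
      rwa [mul_inv_rev, inv_inv, mul_inv_cancel_left] at h2
    · have h1 := hid ⟨_, Subgroup.Normal.conj_mem ‹H.Normal› h hh g⁻¹⟩
      have h2 := hid ⟨h, hh⟩
      simp only [map_mul, map_inv, inv_inv] at h1 h2
      rw [h2, mul_assoc, inv_mul_eq_iff_eq_mul] at h1
      rw [← mul_assoc, h1]
      group
  let ε : C →* RAAG Γ := ρ.emb.comp (Subgroup.inclusion hCH)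
  have hε : Function.Injective ε := ρ.emb_injective.comp (Subgroup.inclusion_injective hCH)
  have hεcomm : ∀ a ∈ ε.range, ∀ b ∈ ε.range, Commute a b := by
    rintro _ ⟨a, rfl⟩ _ ⟨b, rfl⟩
    exact (Commute.all a b).map ε
  have : Group.FG C := by
    have := fg_of_forall_commute hεcomm
    have e := MonoidHom.ofInjective hε
    exact Group.fg_of_surjective (f := e.symm.toMonoidHom) e.symm.surjective
  have : Module.Finite ℤ (Additive C) := by
    rw [Module.Finite.iff_addGroup_fg]
    infer_instance
  let β : Additive C →ₗ[ℤ] (G ⧸ H → Additive C) := LinearMap.pi fun q =>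
    (MonoidHom.toAdditive
      (MonoidHom.id C / (MulAut.conjNormal (q.out : G) : MulAut C).toMonoidHom)).toIntLinearMap
  let d : G ⧸ H → Additive C := fun q => Additive.ofMul ⟨_, hdC q.out⟩
  have hd : d ∈ LinearMap.range β := by
    by_contra hd
    have h1 : (LinearMap.range β).mkQ d ≠ 0 := fun h =>
      hd ((Submodule.Quotient.mk_eq_zero _).1 h)
    obtain ⟨m, hm, hmd⟩ := Module.Finite.exists_nsmul_ne h1
    obtain ⟨K, hK⟩ := RAAG.exists_forall_mem_eq_pow hεcomm hm
    obtain ⟨N, hNH, hN⟩ := exists_forall_map_mem hH ρ.emb K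
    obtain ⟨M, hM, hMN⟩ := exists_forall_map_mem ρ.index_dom (H.subtype.comp ρ.retr) N
    obtain ⟨N', hN'⟩ := hclose M
    obtain ⟨c, hcH, hc⟩ := hφ (N ⊓ N')
    obtain ⟨ζ, hζ, hζc⟩ := hN' ⟨c, hcH⟩ (hc.of_le inf_le_right)
    have hζC : (ζ : G) ∈ C := ⟨ζ.2, Subgroup.mem_centralizer_iff.2 fun h hh =>
      (congrArg Subtype.val (hζ ⟨h, hh⟩)).symm⟩
    have hcζ : quot N ζ = quot N c := by
      have h2 := hMN ((ρ.incl ζ)⁻¹ * ρ.incl ⟨c, hcH⟩) hζc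
      rw [MonoidHom.comp_apply, map_mul, map_inv, ρ.retr_incl, ρ.retr_incl] at h2
      exact quot_eq.2 h2
    have hw : ∀ q, ∃ w : C, d q - β (Additive.ofMul ⟨ζ, hζC⟩) q = m • Additive.ofMul w := by
      intro q
      have h2 : ((d q - β (Additive.ofMul ⟨ζ, hζC⟩) q).toMul : C) ∈
          N.toSubgroup.comap C.subtype := by
        change φ q.out * q.out⁻¹ / (ζ / (q.out * ζ * q.out⁻¹)) ∈ N
        rw [← quot_eq_one]
        simp only [div_eq_mul_inv, map_mul, map_inv, hc.of_le inf_le_left q.out, hcζ]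
        group
      obtain ⟨_, ⟨w, rfl⟩, h3⟩ := hK _ ⟨_, rfl⟩ (hN (Subgroup.inclusion hCH _) h2)
      exact ⟨w, hε (h3.trans (map_pow ε w m).symm)⟩
    choose w hw using hw
    refine hmd ((LinearMap.range β).mkQ fun q => Additive.ofMul (w q)) ?_
    rw [← map_nsmul, ← sub_eq_zero, ← map_sub]
    refine (Submodule.Quotient.mk_eq_zero _).2 ?_
    refine ⟨- Additive.ofMul ⟨ζ, hζC⟩, funext fun q => ?_⟩
    rw [map_neg, Pi.neg_apply, Pi.sub_apply, Pi.smul_apply, ← hw q]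
    abel
  obtain ⟨ζ, hζ⟩ := hd
  refine ⟨(ζ.toMul : G), MulEquiv.ext fun g => ?_⟩
  have h1 : φ (g : G ⧸ H).out * (g : G ⧸ H).out⁻¹ = ζ.toMul /
      ((g : G ⧸ H).out * ζ.toMul * (g : G ⧸ H).out⁻¹) :=
    (congrArg (fun f => ((f (g : G ⧸ H)).toMul : G)) hζ).symm
  have h2 : (g : G ⧸ H).out⁻¹ * g ∈ H := QuotientGroup.eq.1 (QuotientGroup.out_eq' _)
  have h3 := hid ⟨_, h2⟩
  have h4 := (hCcomm _ ζ.toMul.2 _ h2).eq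
  rw [map_mul, map_inv, inv_mul_eq_iff_eq_mul] at h3
  rw [MulAut.conj_apply, h3, mul_inv_eq_iff_eq_mul.1 h1, mul_inv_eq_iff_eq_mul]
  simp only [div_eq_mul_inv, mul_inv_rev, inv_inv, mul_assoc, inv_mul_cancel_left] at h4 ⊢
  rw [← h4, inv_mul_cancel_left, mul_inv_cancel_left]

/-- Automorphisms which are conjugations modulo every finite index normal subgroup are inner. -/
theorem VirtualRetraction.mem_range_conj [Finite V] [H.Normal] (hH : H.index ≠ 0)
    (ρ : VirtualRetraction H (RAAG Γ)) {φ : MulAut G}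
    (hφ : ∀ N : FiniteIndexNormalSubgroup G, ∃ c, N.IsConjMod φ c) :
    φ ∈ (MulAut.conj : G →* MulAut G).range := by
  have hconj : ∀ {ψ : MulAut G} (s : G),
      MulAut.conj s * ψ ∈ (MulAut.conj : G →* MulAut G).range →
      ψ ∈ (MulAut.conj : G →* MulAut G).range := fun s =>
    (Subgroup.mul_mem_cancel_left _ (MonoidHom.mem_range.2 ⟨s, rfl⟩)).1
  obtain ⟨Z, hZ, hZmax⟩ := Subgroup.exists_maximal_commute H
  obtain ⟨s, hs⟩ := exists_coset_isConjMod hH hφ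
  refine hconj s⁻¹ ?_
  replace hs : ∀ N : FiniteIndexNormalSubgroup G, ∃ c ∈ H,
      N.IsConjMod (MulAut.conj s⁻¹ * φ) c := fun N => by
    obtain ⟨c, hc, h1⟩ := hs N
    exact ⟨c, hc, by simpa using h1.conj_mul s⁻¹⟩
  generalize MulAut.conj s⁻¹ * φ = φ at hs
  have hmul : ∀ {φ : MulAut G} (s : H),
      (∀ N : FiniteIndexNormalSubgroup G, ∃ c ∈ H, N.IsConjMod φ c) →
      ∀ N : FiniteIndexNormalSubgroup G, ∃ c ∈ H, N.IsConjMod (MulAut.conj (s : G) * φ) c :=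
    fun s hφ N => by
      obtain ⟨c, hc, h1⟩ := hφ N
      exact ⟨_, H.mul_mem s.2 hc, h1.conj_mul s⟩
  obtain ⟨c, hc⟩ := ρ.exists_conj_of_isConjMod hH hs hZ
  refine hconj (c⁻¹ : H) ?_
  replace hs := hmul c⁻¹ hs
  replace hc : ∀ z ∈ Z, (MulAut.conj ((c⁻¹ : H) : G) * φ) z = z := fun z hz => by
    rw [MulAut.mul_apply, hc z hz, MulAut.conj_apply, Subgroup.coe_inv]
    group
  generalize MulAut.conj ((c⁻¹ : H) : G) * φ = φ at hs hc
  have hφH : ∀ {φ : MulAut G},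
      (∀ N : FiniteIndexNormalSubgroup G, ∃ c ∈ H, N.IsConjMod φ c) → ∀ h : H, φ h ∈ H :=
    fun hφ h => by
      obtain ⟨N, hN, -⟩ :=
        exists_forall_map_mem hH (1 : H →* RAAG Γ) (ker (1 : _ →* Equiv.Perm Unit))
      obtain ⟨c, -, hc⟩ := hφ N
      exact hc.map_mem hN h.2
  obtain ⟨N, hN⟩ := ρ.exists_conj_of_forall_eq hH (hφH hs) hZ hZmax hc
    (ker (1 : _ →* Equiv.Perm Unit))
  obtain ⟨c, hcH, h1⟩ := hs N
  obtain ⟨ζ, hζ, h2, -⟩ := hN ⟨c, hcH⟩ h1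
  refine hconj (ζ⁻¹ : H) ?_
  replace hs := hmul ζ⁻¹ hs
  replace h2 : ∀ h : H, (MulAut.conj ((ζ⁻¹ : H) : G) * φ) h = h := fun h => by
    rw [MulAut.mul_apply, h2, MulAut.conj_apply, Subgroup.coe_inv]
    group
  refine ρ.mem_range_conj_of_forall_eq hH hs h2 fun M => ?_
  obtain ⟨N, hN⟩ := ρ.exists_conj_of_forall_eq hH (hφH hs) hZ hZmax (fun z _ => h2 z) M
  refine ⟨N, fun c hc => ?_⟩
  obtain ⟨ζ, -, h3, h4⟩ := hN c hc
  refine ⟨ζ, fun h => Subtype.ext ?_, h4⟩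
  have h5 := h3 h
  rw [h2 h] at h5
  exact (eq_mul_inv_iff_mul_eq.1 h5).symm

end

/-- If `G` contains a finite-index subgroup isomorphic to a virtual retract of a
finitely generated right-angled Artin group (i.e. `G ∈ 𝒜𝒱ℛ`), then `Out(G)` is
residually finite. -/
theorem out_residuallyFinite_of_AVR {V : Type*} [Fintype V] (Γ : SimpleGraph V)
    (G : Type*) [Group G] (H : Subgroup G) (hH : H.index ≠ 0)
    (R : Subgroup (RAAG Γ)) (hR : IsVirtualRetract R) (e : H ≃* R) :
    ResiduallyFinite (OuterAut G) := by
  have : H.FiniteIndex := ⟨hH⟩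
  have hcore : H.normalCore.index ≠ 0 := Subgroup.FiniteIndex.index_ne_zero
  obtain ⟨ρ₀⟩ := VirtualRetraction.nonempty_of_isVirtualRetract hR
  obtain ⟨ρ⟩ := ρ₀.nonempty_of_injective
    (j := e.toMonoidHom.comp (Subgroup.inclusion H.normalCore_le))
    (e.injective.comp (Subgroup.inclusion_injective _)) (by
      rw [MonoidHom.range_comp, Subgroup.inclusion_range]
      refine (Subgroup.index_map_equiv _ e).trans_ne ?_
      exact fun h => hcore (Nat.eq_zero_of_zero_dvd (h ▸ Subgroup.relIndex_dvd_index_of_normal _ _)))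
  have := ρ.fg
  have := Subgroup.group_fg_of_normal hcore
  exact residuallyFinite_outerAut fun φ => ρ.mem_range_conj hcore
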